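/- (Exponential decay of relative entropy.) Assume V ∈ C²(𝕋^d). There exist constants C, a > 0, depending only on d, m, β, the α_j, λ_j and V, with the following property: let f : [0,∞) × X → (0,∞) be smooth, with each f(t,·) a probability density on X such that f(t,·)/ρ together with all its spatial derivatives lies in L²(μ_β) locally uniformly in t, and suppose f solves the Fokker–Planck equation ∂_t f = −∇_q·(p f) + ∇_p·((∇V(q) − Σ_j λ_j z_j) f) + Σ_j ∇_{z_j}·((λ_j p + α_j z_j) f) + β^{-1} Σ_j α_j Δ_{z_j} f, with finite initial relative entropy H_ρ(f(0,·)) = ∫_X f(0,x) log(f(0,x)/ρ(x)) dx. Then H_ρ(f(t,·)) ≤ C e^{−a t} H_ρ(f(0,·)) for all t ≥ 0. -/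

import Mathlib

open MeasureTheory Real Filter

noncomputable section

/-- The state space `X = 𝕋^d × ℝ^d × ℝ^{dm}`, realised as
`ℝ^d × ℝ^d × (ℝ^d)^m` with functions that are `ℤ^d`-periodic in the first variable. -/
abbrev Xsp (d m : ℕ) := (Fin d → ℝ) × (Fin d → ℝ) × (Fin m → Fin d → ℝ)

/-- The direction in the `z_j`-block given by the vector `v`. -/
def zdir (d m : ℕ) (j : Fin m) (v : Fin d → ℝ) : Xsp d m :=
  (0, 0, Function.update 0 j v)

/-- The partial derivative `∂_{z_{j,k}} φ`. -/
def pZ (d m : ℕ) (j : Fin m) (k : Fin d) (φ : Xsp d m → ℝ) (x : Xsp d m) : ℝ :=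
  fderiv ℝ φ x (zdir d m j (Pi.single k 1))

/-- The partial derivative `∂_{p_k} φ`. -/
def pP (d m : ℕ) (k : Fin d) (φ : Xsp d m → ℝ) (x : Xsp d m) : ℝ :=
  fderiv ℝ φ x (0, Pi.single k 1, 0)

/-- The partial derivative `∂_{q_k} φ`. -/
def pQ (d m : ℕ) (k : Fin d) (φ : Xsp d m → ℝ) (x : Xsp d m) : ℝ :=
  fderiv ℝ φ x (Pi.single k 1, 0, 0)

/-- The operator `𝓛` (negative of the generator of the Markovian GLE dynamics):
`𝓛φ = −p·∇_qφ + ∇V·∇_pφ − Σ_j λ_j z_j·∇_pφ + Σ_j λ_j p·∇_{z_j}φ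
      + Σ_j α_j z_j·∇_{z_j}φ − β⁻¹ Σ_j α_j Δ_{z_j}φ`. -/
def gen (d m : ℕ) (β : ℝ) (α lam : Fin m → ℝ) (V : (Fin d → ℝ) → ℝ)
    (φ : Xsp d m → ℝ) (x : Xsp d m) : ℝ :=
  - fderiv ℝ φ x (x.2.1, 0, 0)
  + fderiv ℝ φ x (0, (fun i => fderiv ℝ V x.1 (Pi.single i 1)), 0)
  - fderiv ℝ φ x (0, ∑ j, lam j • x.2.2 j, 0)
  + ∑ j, lam j * fderiv ℝ φ x (zdir d m j x.2.1)
  + ∑ j, α j * fderiv ℝ φ x (zdir d m j (x.2.2 j))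
  - β⁻¹ * ∑ j, α j * ∑ k, fderiv ℝ (pZ d m j k φ) x (zdir d m j (Pi.single k 1))

/-- The (unnormalised) Gibbs density `exp(−β(V(q) + |p|²/2 + |z|²/2))`. -/
def gdens (d m : ℕ) (β : ℝ) (V : (Fin d → ℝ) → ℝ) (x : Xsp d m) : ℝ :=
  Real.exp (-β * (V x.1 + (∑ i, (x.2.1 i) ^ 2) / 2 + (∑ j, ∑ i, (x.2.2 j i) ^ 2) / 2))

/-- The fundamental domain `[0,1)^d` for the torus in the `q`-variable. -/
def cube (d : ℕ) : Set (Fin d → ℝ) := {q | ∀ i, q i ∈ Set.Ico (0 : ℝ) 1}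

/-- Lebesgue measure on `X = 𝕋^d × ℝ^d × ℝ^{dm}` (the `q`-variable being
restricted to a fundamental domain of the torus). -/
def volX (d m : ℕ) : Measure (Xsp d m) :=
  (volume : Measure (Xsp d m)).restrict {x | x.1 ∈ cube d}

/-- The Gibbs measure `μ_β`, with density `Z⁻¹ exp(−β(V(q)+|p|²/2+|z|²/2))`. -/
def gibbs (d m : ℕ) (β Z : ℝ) (V : (Fin d → ℝ) → ℝ) : Measure (Xsp d m) :=
  (volX d m).withDensity fun x => ENNReal.ofReal (Z⁻¹ * gdens d m β V x)

/-- `ℤ^d`-periodicity in the `q`-variable. -/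
def PerQ (d m : ℕ) (φ : Xsp d m → ℝ) : Prop :=
  ∀ (k : Fin d → ℤ) (x : Xsp d m), φ (x.1 + (fun i => (k i : ℝ)), x.2) = φ x

/-- `ℤ^d`-periodicity of the potential. -/
def PerV (d : ℕ) (V : (Fin d → ℝ) → ℝ) : Prop :=
  ∀ (k : Fin d → ℤ) (q : Fin d → ℝ), V (q + fun i => (k i : ℝ)) = V q

/-- A test function: smooth, periodic in `q`, compactly supported in `(p,z)`. -/
def IsTest (d m : ℕ) (φ : Xsp d m → ℝ) : Prop :=
  ContDiff ℝ (⊤ : ℕ∞) φ ∧ PerQ d m φ ∧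
    ∃ K : Set ((Fin d → ℝ) × (Fin m → Fin d → ℝ)),
      IsCompact K ∧ ∀ x : Xsp d m, x.2 ∉ K → φ x = 0

/-- The Fokker–Planck operator
`FP f = −∇_q·(p f) + ∇_p·((∇V(q) − Σ_j λ_j z_j) f)
        + Σ_j ∇_{z_j}·((λ_j p + α_j z_j) f) + β⁻¹ Σ_j α_j Δ_{z_j} f`. -/
def FP (d m : ℕ) (β : ℝ) (α lam : Fin m → ℝ) (V : (Fin d → ℝ) → ℝ)
    (f : Xsp d m → ℝ) (x : Xsp d m) : ℝ :=
  - fderiv ℝ f x (x.2.1, 0, 0)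
  + fderiv ℝ f x (0, (fun i => fderiv ℝ V x.1 (Pi.single i 1)) - ∑ j, lam j • x.2.2 j, 0)
  + ∑ j, (fderiv ℝ f x (zdir d m j (lam j • x.2.1 + α j • x.2.2 j)) + α j * d * f x)
  + β⁻¹ * ∑ j, α j * ∑ k, fderiv ℝ (pZ d m j k f) x (zdir d m j (Pi.single k 1))

/-- The relative entropy `H_ρ(f) = ∫_X f log(f/ρ) dx`. -/
def relEnt (d m : ℕ) (ρ f : Xsp d m → ℝ) : ℝ :=
  ∫ x, f x * Real.log (f x / ρ x) ∂(volX d m)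

/-- The unnormalised one-dimensional Gaussian weight. -/
def gaussW (β x : ℝ) : ℝ := Real.exp (-β * x ^ 2 / 2)

lemma gaussW_pos (β x : ℝ) : 0 < gaussW β x := Real.exp_pos _

@[fun_prop]
lemma continuous_gaussW (β : ℝ) : Continuous (gaussW β) := by
  unfold gaussW; fun_prop

lemma hasDerivAt_gaussW (β x : ℝ) : HasDerivAt (gaussW β) (-β * x * gaussW β x) x := by
  have h : HasDerivAt (fun x : ℝ => -β * x ^ 2 / 2) (-β * x) x := by
    have := (((hasDerivAt_id x).pow 2).const_mul (-β)).div_const 2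
    convert! this using 1
    simp; ring
  have := h.exp
  unfold gaussW
  convert! this using 1
  ring

/-- A monotone `C¹` transport between two positive continuous densities on `[a, b]`. -/
lemma exists_transport {a b : ℝ} (hab : a < b) {g k : ℝ → ℝ} (hg : Continuous g)
    (hk : Continuous k) (hg0 : ∀ x, 0 < g x) (hk0 : ∀ x, 0 < k x)
    (hgk : ∫ x in a..b, g x = ∫ x in a..b, k x) :
    ∃ S : ℝ → ℝ, S a = a ∧ S b = b ∧ (∀ x ∈ Set.Icc a b, S x ∈ Set.Icc a b) ∧
      Continuous S ∧
      ∀ x ∈ Set.Icc a b, HasDerivWithinAt S (g x / k (S x)) (Set.Icc a b) x := by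
  set k' : ℝ → ℝ := fun x => k (max a (min b x)) with hk'
  have hk'c : Continuous k' := by fun_prop
  have hmem : ∀ x, max a (min b x) ∈ Set.Icc a b := fun x =>
    ⟨le_max_left _ _, max_le hab.le (min_le_left _ _)⟩
  have hk'eq : ∀ x ∈ Set.Icc a b, k' x = k x := by
    intro x hx
    simp [hk', min_eq_right hx.2, max_eq_right hx.1]
  obtain ⟨x0, hx0, hmin⟩ := isCompact_Icc.exists_isMinOn (Set.nonempty_Icc.2 hab.le)
    hk.continuousOn
  set c := k x0
  have hc : 0 < c := hk0 x0
  have hck : ∀ x, c ≤ k' x := fun x => hmin (hmem x)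
  set G : ℝ → ℝ := fun x => ∫ y in a..x, k' y with hG
  have hGd : ∀ x, HasDerivAt G (k' x) x := fun x =>
    intervalIntegral.integral_hasDerivAt_right (hk'c.intervalIntegrable _ _)
      hk'c.aestronglyMeasurable.stronglyMeasurableAtFilter hk'c.continuousAt
  have hGc : Continuous G := continuous_iff_continuousAt.2 fun x => (hGd x).continuousAt
  have hGm : StrictMono G := strictMono_of_hasDerivAt_pos hGd fun x => hk0 _
  have hlow : ∀ x y, x ≤ y → c * (y - x) ≤ G y - G x := by
    intro x y hxy
    have h1 : G y - G x = ∫ z in x..y, k' z := by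
      simp only [hG]
      rw [intervalIntegral.integral_interval_sub_left] <;> exact hk'c.intervalIntegrable _ _
    rw [h1]
    have : ∫ z in x..y, c = c * (y - x) := by simp [mul_comm]
    rw [← this]
    exact intervalIntegral.integral_mono hxy (by simp) (hk'c.intervalIntegrable _ _) fun z => hck z
  have hGa : G a = 0 := by simp [hG]
  have htop : Tendsto G atTop atTop := by
    have h1 : Tendsto (fun x => c * (x - a)) atTop atTop :=
      (tendsto_atTop_add_const_right _ (-a) tendsto_id).const_mul_atTop hc
    refine tendsto_atTop_mono' _ ?_ h1
    filter_upwards [eventually_ge_atTop a] with x hx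
    have := hlow a x hx
    rw [hGa] at this; linarith
  have hbot : Tendsto G atBot atBot := by
    have h1 : Tendsto (fun x => c * (x - a)) atBot atBot :=
      (tendsto_atBot_add_const_right _ (-a) tendsto_id).const_mul_atBot hc
    refine tendsto_atBot_mono' _ ?_ h1
    filter_upwards [eventually_le_atBot a] with x hx
    have := hlow x a hx
    rw [hGa] at this; linarith
  have hsurj := hGc.surjective htop hbot
  set e := (StrictMono.orderIsoOfSurjective G hGm hsurj).toHomeomorph
  have he : ∀ x, e x = G x := fun x => rfl
  set F : ℝ → ℝ := fun x => ∫ y in a..x, g y with hF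
  have hFd : ∀ x, HasDerivAt F (g x) x := fun x =>
    intervalIntegral.integral_hasDerivAt_right (hg.intervalIntegrable _ _)
      hg.aestronglyMeasurable.stronglyMeasurableAtFilter hg.continuousAt
  have hFc : Continuous F := continuous_iff_continuousAt.2 fun x => (hFd x).continuousAt
  have hFm : StrictMono F := strictMono_of_hasDerivAt_pos hFd hg0
  have hGS : ∀ x, G (e.symm x) = x := fun x => e.apply_symm_apply x
  have hFa : F a = 0 := by simp [hF]
  have hFb : F b = G b := by
    simp only [hF, hG, hgk]
    refine intervalIntegral.integral_congr fun x hx => ?_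
    rw [Set.uIcc_of_le hab.le] at hx
    exact (hk'eq x hx).symm
  have hSa : e.symm (F a) = a := hGm.injective (by rw [hGS, hFa, hGa])
  have hSb : e.symm (F b) = b := hGm.injective (by rw [hGS, hFb])
  have hSm : ∀ x ∈ Set.Icc a b, e.symm (F x) ∈ Set.Icc a b := by
    intro x hx
    constructor
    · rw [← hGm.le_iff_le, hGS, hGa, ← hFa]; exact hFm.monotone hx.1
    · rw [← hGm.le_iff_le, hGS, ← hFb]; exact hFm.monotone hx.2
  refine ⟨fun x => e.symm (F x), hSa, hSb, hSm, e.symm.continuous.comp hFc, ?_⟩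
  intro x hx
  have h1 : HasDerivAt e.symm (k' (e.symm (F x)))⁻¹ (F x) :=
    HasDerivAt.of_local_left_inverse e.symm.continuous.continuousAt (hGd _) (hk0 _).ne'
      (Eventually.of_forall hGS)
  have h2 := h1.comp x (hFd x)
  rw [hk'eq _ (hSm x hx)] at h2
  convert! h2.hasDerivWithinAt using 1
  rw [div_eq_inv_mul]

/-- The logarithmic Sobolev inequality for the Gaussian weight on an interval, by monotone
transport. -/
lemma logSobolev_interval {β a b : ℝ} (hβ : 0 < β) (hab : a < b) {u : ℝ → ℝ}
    (hu : ContDiff ℝ 1 u) (hu0 : ∀ x, 0 < u x) :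
    (∫ x in a..b, u x * log (u x) * gaussW β x) -
      (∫ x in a..b, u x * gaussW β x) *
        log ((∫ x in a..b, u x * gaussW β x) / ∫ x in a..b, gaussW β x) ≤
    1 / (2 * β) * ∫ x in a..b, (deriv u x) ^ 2 / u x * gaussW β x := by
  have huc : Continuous u := hu.continuous
  have hdu : Continuous (deriv u) := hu.continuous_deriv le_rfl
  have hlc : Continuous fun x => log (u x) := huc.log fun x => (hu0 x).ne'
  have hw := continuous_gaussW β
  have hw0 := gaussW_pos β
  set m := ∫ x in a..b, u x * gaussW β x with hm
  set M := ∫ x in a..b, gaussW β x with hM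
  have hMpos : 0 < M := intervalIntegral.intervalIntegral_pos_of_pos
    (hw.intervalIntegrable _ _) hw0 hab
  have hmpos : 0 < m := intervalIntegral.intervalIntegral_pos_of_pos
    ((huc.mul hw).intervalIntegrable _ _) (fun x => mul_pos (hu0 x) (hw0 x)) hab
  set c := m / M with hc
  have hcpos : 0 < c := div_pos hmpos hMpos
  obtain ⟨S, hSa, hSb, hSm, hSc, hSd⟩ := exists_transport hab
    (g := fun x => u x * gaussW β x / c) (k := gaussW β) (by fun_prop) hw
    (fun x => div_pos (mul_pos (hu0 x) (hw0 x)) hcpos) hw0 (by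
      rw [intervalIntegral.integral_div, ← hm, ← hM, hc]; field_simp)
  set S' : ℝ → ℝ := fun x => u x * gaussW β x / c / gaussW β (S x) with hS'
  have hS'c : Continuous S' := by
    refine Continuous.div (by fun_prop) (by fun_prop) fun x => (hw0 _).ne'
  have hS'0 : ∀ x, 0 < S' x := fun x =>
    div_pos (div_pos (mul_pos (hu0 x) (hw0 x)) hcpos) (hw0 _)
  set Q : ℝ → ℝ := fun x => (S' x - 1) * (u x * gaussW β x) +
    (S x - x) * (deriv u x * gaussW β x + u x * (-β * x * gaussW β x)) with hQ
  have hQc : Continuous Q := by fun_prop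
  have hint : ∫ x in a..b, Q x = 0 := by
    have := intervalIntegral.integral_eq_sub_of_hasDerivAt_of_le hab.le
      (f := fun x => (S x - x) * (u x * gaussW β x)) (f' := Q) (by fun_prop)
      (fun x hx => by
        have h1 : HasDerivAt S (S' x) x := (hSd x (Set.Ioo_subset_Icc_self hx)).hasDerivAt
          (Icc_mem_nhds hx.1 hx.2)
        have h2 := (hu.differentiable one_ne_zero x).hasDerivAt
        exact (h1.sub (hasDerivAt_id x)).mul (h2.mul (hasDerivAt_gaussW β x)))
      (hQc.intervalIntegrable _ _)
    rw [this, hSa, hSb]; simp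
  have hpt : ∀ x ∈ Set.Icc a b, u x * log (u x) * gaussW β x - u x * gaussW β x * log c ≤
      Q x + 1 / (2 * β) * ((deriv u x) ^ 2 / u x * gaussW β x) := by
    intro x hx
    have h1 : log (S' x) = log (u x) - log c + (-β * x ^ 2 / 2) - (-β * S x ^ 2 / 2) := by
      simp only [hS']
      rw [log_div (div_pos (mul_pos (hu0 x) (hw0 x)) hcpos).ne' (hw0 _).ne',
        log_div (mul_pos (hu0 x) (hw0 x)).ne' hcpos.ne', log_mul (hu0 x).ne' (hw0 x).ne']
      simp only [gaussW, log_exp]; ring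
    have h2 := log_le_sub_one_of_pos (hS'0 x)
    have h3 : log (u x) - log c ≤ S' x - 1 - β * x * (S x - x) - β / 2 * (S x - x) ^ 2 := by
      nlinarith
    have hux := hu0 x
    have h4 : -((S x - x) * deriv u x) ≤
        β / 2 * (S x - x) ^ 2 * u x + 1 / (2 * β) * ((deriv u x) ^ 2 / u x) := by
      have : 0 ≤ (β * (S x - x) * u x + deriv u x) ^ 2 / (2 * β * u x) := by positivity
      have e : (β * (S x - x) * u x + deriv u x) ^ 2 / (2 * β * u x) =
        β / 2 * (S x - x) ^ 2 * u x + 1 / (2 * β) * ((deriv u x) ^ 2 / u x)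
          + (S x - x) * deriv u x := by field_simp; ring
      linarith
    have h5 := mul_le_mul_of_nonneg_left h3 hux.le
    have h6 : u x * (log (u x) - log c) ≤ (S' x - 1) * u x +
        (S x - x) * (deriv u x + u x * (-β * x)) + 1 / (2 * β) * ((deriv u x) ^ 2 / u x) := by
      nlinarith
    have h7 := mul_le_mul_of_nonneg_right h6 (hw0 x).le
    simp only [hQ]
    nlinarith
  have hfc : Continuous fun x => (deriv u x) ^ 2 / u x * gaussW β x :=
    ((hdu.pow 2).div huc fun x => (hu0 x).ne').mul hw
  have hlec := intervalIntegral.integral_mono_on hab.le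
    (f := fun x => u x * log (u x) * gaussW β x - u x * gaussW β x * log c)
    (g := fun x => Q x + 1 / (2 * β) * ((deriv u x) ^ 2 / u x * gaussW β x))
    (Continuous.intervalIntegrable (μ := volume) (by fun_prop) a b)
    (Continuous.intervalIntegrable (μ := volume) (by fun_prop) a b) hpt
  rw [intervalIntegral.integral_sub, intervalIntegral.integral_add (hQc.intervalIntegrable _ _),
    hint, intervalIntegral.integral_mul_const, intervalIntegral.integral_const_mul, ← hm] at hlec
  · linarith
  all_goals exact Continuous.intervalIntegrable (by fun_prop) _ _

/-- The logarithmic Sobolev inequality with constant `K` for the measure `w μ`, where the energy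
is computed along the directions `v i`. -/
def LogSob {E ι : Type*} [NormedAddCommGroup E] [NormedSpace ℝ E] [MeasurableSpace E] [Fintype ι]
    (μ : Measure E) (w : E → ℝ) (v : ι → E) (K : ℝ) : Prop :=
  ∀ u : E → ℝ, ContDiff ℝ 1 u → (∀ x, 0 < u x) →
    (∫ x, u x * log (u x) * w x ∂μ) -
      (∫ x, u x * w x ∂μ) * log ((∫ x, u x * w x ∂μ) / ∫ x, w x ∂μ) ≤
    K * ∫ x, (∑ i, (fderiv ℝ u x (v i)) ^ 2) / u x * w x ∂μ

/-- The measure is concentrated on a compact set. -/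
def CompConc {E : Type*} [TopologicalSpace E] [MeasurableSpace E] (μ : Measure E) : Prop :=
  ∃ S : Set E, IsCompact S ∧ μ Sᶜ = 0

lemma CompConc.prod {E F : Type*} [TopologicalSpace E] [TopologicalSpace F] [MeasurableSpace E]
    [MeasurableSpace F] {μ : Measure E} {ν : Measure F} [SFinite μ] [SFinite ν] (hμ : CompConc μ)
    (hν : CompConc ν) : CompConc (μ.prod ν) := by
  obtain ⟨S, hS, h0⟩ := hμ
  obtain ⟨S', hS', h0'⟩ := hν
  refine ⟨S ×ˢ S', hS.prod hS', ?_⟩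
  rw [Set.compl_prod_eq_union]
  refine measure_union_null ?_ ?_ <;> simp [Measure.prod_prod, h0, h0']

section

variable {E F : Type*} [NormedAddCommGroup E] [NormedSpace ℝ E]
  [NormedAddCommGroup F] [NormedSpace ℝ F] [MeasurableSpace F] [BorelSpace F]

lemma CompConc.integrable {E : Type*} [NormedAddCommGroup E] [MeasurableSpace E] [BorelSpace E]
    {μ : Measure E} [IsFiniteMeasure μ] (h : CompConc μ)
    {f : E → ℝ} (hf : Continuous f) : Integrable f μ := by
  obtain ⟨S, hS, h0⟩ := h
  rw [← Measure.restrict_eq_self_of_ae_mem h0]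
  exact hf.continuousOn.integrableOn_compact hS

/-- Differentiation under the integral sign against a finite measure concentrated on a compact
set. -/
lemma CompConc.hasFDerivAt_integral [FiniteDimensional ℝ E] [SecondCountableTopology F]
    {ν : Measure F} [IsFiniteMeasure ν]
    (hν : CompConc ν) {u : E × F → ℝ} (hu : ContDiff ℝ 1 u) {w : F → ℝ} (hw : Continuous w)
    (x : E) :
    HasFDerivAt (fun x => ∫ y, u (x, y) * w y ∂ν)
      (∫ y, w y • (fderiv ℝ u (x, y)).comp (ContinuousLinearMap.inl ℝ E F) ∂ν) x := by
  have : ProperSpace E := FiniteDimensional.proper ℝ E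
  have hu' : Continuous (fderiv ℝ u) := hu.continuous_fderiv one_ne_zero
  have huc := hu.continuous
  set F' : E → F → E →L[ℝ] ℝ := fun x y =>
    w y • (fderiv ℝ u (x, y)).comp (ContinuousLinearMap.inl ℝ E F) with hF'
  have hF'c : Continuous (fun p : E × F => F' p.1 p.2) := by
    simp only [hF']; fun_prop
  obtain ⟨S, hS, h0⟩ := id hν
  obtain ⟨C, hC⟩ := (((isCompact_closedBall x 1).prod hS).image hF'c).isBounded.exists_norm_le
  refine hasFDerivAt_integral_of_dominated_of_fderiv_le (𝕜 := ℝ) (μ := ν)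
    (F := fun x y => u (x, y) * w y) (F' := F')
    (s := Metric.closedBall x 1) (bound := fun _ => C) (Metric.closedBall_mem_nhds x one_pos)
    ?_ ?_ ?_ ?_ ?_ ?_
  · exact Eventually.of_forall fun z => (by fun_prop :
      Continuous fun y => u (z, y) * w y).aestronglyMeasurable
  · exact hν.integrable (by fun_prop)
  · exact (hF'c.comp (by fun_prop : Continuous fun y : F => (x, y))).aestronglyMeasurable
  · have : ∀ᵐ y ∂ν, y ∈ S := h0
    filter_upwards [this] with y hy z hz
    exact hC _ ⟨(z, y), ⟨hz, hy⟩, rfl⟩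
  · exact integrable_const _
  · refine Eventually.of_forall fun y z _ => ?_
    have h1 : HasFDerivAt (fun z : E => (z, y)) (ContinuousLinearMap.inl ℝ E F) z :=
      hasFDerivAt_prodMk_left z y
    have h2 := ((hu.differentiable one_ne_zero (z, y)).hasFDerivAt.comp z h1).mul_const (w y)
    exact h2

lemma CompConc.contDiff_integral [FiniteDimensional ℝ E] [SecondCountableTopology F]
    {ν : Measure F} [IsFiniteMeasure ν]
    (hν : CompConc ν) {u : E × F → ℝ} (hu : ContDiff ℝ 1 u) {w : F → ℝ} (hw : Continuous w) :
    ContDiff ℝ 1 (fun x => ∫ y, u (x, y) * w y ∂ν) := by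
  have : ProperSpace E := FiniteDimensional.proper ℝ E
  have hu' : Continuous (fderiv ℝ u) := hu.continuous_fderiv one_ne_zero
  rw [contDiff_one_iff_hasFDerivAt]
  refine ⟨_, ?_, fun x => hν.hasFDerivAt_integral hu hw x⟩
  obtain ⟨S, hS, h0⟩ := id hν
  rw [← Measure.restrict_eq_self_of_ae_mem h0]
  exact continuous_parametric_integral_of_continuous
    (by simp only [Function.uncurry_def]; fun_prop) hS

lemma CompConc.fderiv_integral_apply [FiniteDimensional ℝ E] [SecondCountableTopology F]
    {ν : Measure F} [IsFiniteMeasure ν]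
    (hν : CompConc ν) {u : E × F → ℝ} (hu : ContDiff ℝ 1 u) {w : F → ℝ} (hw : Continuous w)
    (x v : E) :
    fderiv ℝ (fun x => ∫ y, u (x, y) * w y ∂ν) x v = ∫ y, fderiv ℝ u (x, y) (v, 0) * w y ∂ν := by
  have hu' : Continuous (fderiv ℝ u) := hu.continuous_fderiv one_ne_zero
  rw [(hν.hasFDerivAt_integral hu hw x).fderiv, ContinuousLinearMap.integral_apply]
  · simp [mul_comm]
  · obtain ⟨S, hS, h0⟩ := id hν
    rw [← Measure.restrict_eq_self_of_ae_mem h0]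
    exact (by fun_prop : Continuous _).continuousOn.integrableOn_compact hS

end

section

variable {E F : Type*} [NormedAddCommGroup E] [NormedSpace ℝ E] [MeasurableSpace E] [BorelSpace E]
  [NormedAddCommGroup F] [NormedSpace ℝ F] [MeasurableSpace F] [BorelSpace F]

/-- Tensorization of the logarithmic Sobolev inequality. -/
lemma LogSob.prod [FiniteDimensional ℝ E] [SecondCountableTopology F] {ι κ : Type*} [Fintype ι]
    [Fintype κ] {μ : Measure E} {ν : Measure F} [IsFiniteMeasure μ] [IsFiniteMeasure ν]
    [NeZero ν]
    (hμ : CompConc μ) (hν : CompConc ν) {w₁ : E → ℝ} {w₂ : F → ℝ} (hw₁ : Continuous w₁)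
    (hw₂ : Continuous w₂) (h₁ : ∀ x, 0 < w₁ x) (h₂ : ∀ x, 0 < w₂ x) {v₁ : ι → E} {v₂ : κ → F}
    {K : ℝ} (hK : 0 ≤ K) (H₁ : LogSob μ w₁ v₁ K) (H₂ : LogSob ν w₂ v₂ K) :
    LogSob (μ.prod ν) (fun p => w₁ p.1 * w₂ p.2)
      (Sum.elim (fun i => (v₁ i, (0 : F))) (fun j => ((0 : E), v₂ j))) K := by
  have : ProperSpace E := FiniteDimensional.proper ℝ E
  intro u hu hu0
  have hu' : Continuous (fderiv ℝ u) := hu.continuous_fderiv one_ne_zero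
  have huc := hu.continuous
  have hlc : Continuous fun x => log (u x) := huc.log fun x => (hu0 x).ne'
  have hui : Continuous fun x => (u x)⁻¹ := huc.inv₀ fun x => (hu0 x).ne'
  have hfib : ∀ x : E, Continuous fun y : F => (x, y) := fun x => by fun_prop
  have hpos : ∀ g : F → ℝ, Continuous g → (∀ y, 0 < g y) → 0 < ∫ y, g y ∂ν := by
    intro g hg hg0
    rw [integral_pos_iff_support_of_nonneg (fun y => (hg0 y).le) (hν.integrable hg)]
    have : Function.support g = Set.univ := by
      ext y; simp [(hg0 y).ne']
    rw [this]
    exact Measure.measure_univ_pos.2 (NeZero.ne ν)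
  have hμν := hμ.prod hν
  set N := ∫ y, w₂ y ∂ν with hN
  have hNpos : 0 < N := hpos _ hw₂ h₂
  set U : E → ℝ := fun x => ∫ y, u (x, y) * w₂ y ∂ν with hU
  have hUd : ContDiff ℝ 1 U := hν.contDiff_integral hu hw₂
  have hUc := hUd.continuous
  have hU0 : ∀ x, 0 < U x := fun x => hpos _ (by fun_prop) fun y => mul_pos (hu0 _) (h₂ _)
  have hUlc : Continuous fun x => log (U x) := hUc.log fun x => (hU0 x).ne'
  have hUi : Continuous fun x => (U x)⁻¹ := hUc.inv₀ fun x => (hU0 x).ne'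
  have hU' : Continuous (fderiv ℝ U) := hUd.continuous_fderiv one_ne_zero
  have iterate : ∀ g : E × F → ℝ, Continuous g →
      ∫ p, g p * (w₁ p.1 * w₂ p.2) ∂(μ.prod ν) = ∫ x, (∫ y, g (x, y) * w₂ y ∂ν) * w₁ x ∂μ := by
    intro g hg
    rw [integral_prod _ (hμν.integrable (by fun_prop))]
    refine integral_congr_ae (Eventually.of_forall fun x => ?_)
    simp only
    rw [← integral_mul_const]
    congr 1; ext y; ring
  have intOut : ∀ g : E × F → ℝ, Continuous g →
      Integrable (fun x => (∫ y, g (x, y) * w₂ y ∂ν) * w₁ x) μ := by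
    intro g hg
    have := (hμν.integrable (f := fun p => g p * (w₁ p.1 * w₂ p.2))
      (by fun_prop)).integral_prod_left
    refine this.congr (Eventually.of_forall fun x => ?_)
    simp only
    rw [← integral_mul_const]
    congr 1; ext y; ring
  have hm : ∫ p, u p * (w₁ p.1 * w₂ p.2) ∂(μ.prod ν) = ∫ x, U x * w₁ x ∂μ := iterate u huc
  have hM : ∫ p : E × F, w₁ p.1 * w₂ p.2 ∂(μ.prod ν) = N * ∫ x, w₁ x ∂μ := by
    have := iterate (fun _ => 1) continuous_const
    simp only [one_mul] at this
    rw [this, integral_const_mul]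
  have hfv : ∀ x y (v : F), fderiv ℝ (fun y => u (x, y)) y v = fderiv ℝ u (x, y) (0, v) := by
    intro x y v
    have := (hu.differentiable one_ne_zero (x, y)).hasFDerivAt.comp y (hasFDerivAt_prodMk_right x y)
    rw [HasFDerivAt.fderiv (f := fun y => u (x, y)) this]
    simp
  set A : E × F → ℝ := fun p => (∑ i, (fderiv ℝ u p (v₁ i, 0)) ^ 2) / u p with hA
  set B : E × F → ℝ := fun p => (∑ j, (fderiv ℝ u p (0, v₂ j)) ^ 2) / u p with hB
  have hAc : Continuous A := by simp only [hA, div_eq_mul_inv]; fun_prop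
  have hBc : Continuous B := by simp only [hB, div_eq_mul_inv]; fun_prop
  have hAi : ∀ x i, Continuous fun y => (fderiv ℝ u (x, y) (v₁ i, 0)) ^ 2 * (u (x, y))⁻¹ * w₂ y :=
    fun x i => (Continuous.mul (by fun_prop) (hui.comp (hfib x))).mul hw₂
  have inner : ∀ x, ∫ y, u (x, y) * log (u (x, y)) * w₂ y ∂ν ≤
      U x * log (U x / N) + K * ∫ y, B (x, y) * w₂ y ∂ν := by
    intro x
    have := H₂ (fun y => u (x, y)) (hu.comp (by fun_prop)) fun y => hu0 _
    simp only [hfv] at this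
    simp only [hB]
    linarith
  have energy : ∀ x, (∑ i, (fderiv ℝ U x (v₁ i)) ^ 2) / U x ≤ ∫ y, A (x, y) * w₂ y ∂ν := by
    intro x
    have h1 : ∀ i, (fderiv ℝ U x (v₁ i)) ^ 2 / U x ≤
        ∫ y, (fderiv ℝ u (x, y) (v₁ i, 0)) ^ 2 * (u (x, y))⁻¹ * w₂ y ∂ν := by
      intro i
      set s := fderiv ℝ U x (v₁ i) / U x with hs
      have e1 : ∫ y, (2 * s * (fderiv ℝ u (x, y) (v₁ i, 0) * w₂ y) - s ^ 2 * (u (x, y) * w₂ y)) ∂ν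
          = (fderiv ℝ U x (v₁ i)) ^ 2 / U x := by
        rw [integral_sub (hν.integrable (by fun_prop)) (hν.integrable (by fun_prop)),
          integral_const_mul, integral_const_mul, ← hν.fderiv_integral_apply hu hw₂]
        change 2 * s * fderiv ℝ U x (v₁ i) - s ^ 2 * U x = _
        rw [hs]
        have := (hU0 x).ne'
        field_simp; ring
      rw [← e1]
      refine integral_mono (hν.integrable (by fun_prop)) (hν.integrable (hAi x i)) fun y => ?_
      have hy := hu0 (x, y)
      have hw := h₂ y
      have : 0 ≤ (fderiv ℝ u (x, y) (v₁ i, 0) - s * u (x, y)) ^ 2 * (u (x, y))⁻¹ * w₂ y := by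
        positivity
      have e2 : (fderiv ℝ u (x, y) (v₁ i, 0) - s * u (x, y)) ^ 2 * (u (x, y))⁻¹ * w₂ y =
        (fderiv ℝ u (x, y) (v₁ i, 0)) ^ 2 * (u (x, y))⁻¹ * w₂ y -
        (2 * s * (fderiv ℝ u (x, y) (v₁ i, 0) * w₂ y) - s ^ 2 * (u (x, y) * w₂ y)) := by
        field_simp; ring
      simp only
      linarith
    rw [Finset.sum_div]
    refine (Finset.sum_le_sum fun i _ => h1 i).trans (le_of_eq ?_)
    rw [← integral_finsetSum _ fun i _ => hν.integrable (hAi x i)]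
    congr 1; ext y
    simp only [hA, div_eq_mul_inv, Finset.sum_mul]
  have outer := H₁ U hUd hU0
  have hent := iterate (fun p => u p * log (u p)) (by fun_prop)
  have hE : ∫ p, (∑ i, (fderiv ℝ u p (Sum.elim (fun i => (v₁ i, (0 : F)))
      (fun j => ((0 : E), v₂ j)) i)) ^ 2) / u p * (w₁ p.1 * w₂ p.2) ∂(μ.prod ν) =
      (∫ x, (∫ y, A (x, y) * w₂ y ∂ν) * w₁ x ∂μ) + ∫ x, (∫ y, B (x, y) * w₂ y ∂ν) * w₁ x ∂μ := by
    rw [← iterate A hAc, ← iterate B hBc,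
      ← integral_add (hμν.integrable (by fun_prop)) (hμν.integrable (by fun_prop))]
    congr 1; ext p
    simp only [Fintype.sum_sum_type, Sum.elim_inl, Sum.elim_inr, hA, hB]
    ring
  have step1 : ∫ x, (∫ y, u (x, y) * log (u (x, y)) * w₂ y ∂ν) * w₁ x ∂μ ≤
      (∫ x, U x * log (U x) * w₁ x ∂μ) - log N * (∫ x, U x * w₁ x ∂μ) +
        K * ∫ x, (∫ y, B (x, y) * w₂ y ∂ν) * w₁ x ∂μ := by
    have i1 : Integrable (fun x => U x * log (U x) * w₁ x) μ := hμ.integrable (by fun_prop)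
    have i2 : Integrable (fun x => log N * (U x * w₁ x)) μ := hμ.integrable (by fun_prop)
    have i3 := (intOut B hBc).const_mul K
    have i4 : Integrable (fun x => U x * log (U x) * w₁ x - log N * (U x * w₁ x)) μ := i1.sub i2
    rw [← integral_const_mul, ← integral_const_mul, ← integral_sub i1 i2, ← integral_add i4 i3]
    refine integral_mono (intOut (fun p => u p * log (u p)) (by fun_prop))
      (i4.add i3) fun x => ?_
    have := mul_le_mul_of_nonneg_right (inner x) (h₁ x).le
    rw [log_div (hU0 x).ne' hNpos.ne'] at this
    simp only
    linarith
  have step2 : ∫ x, (∑ i, (fderiv ℝ U x (v₁ i)) ^ 2) / U x * w₁ x ∂μ ≤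
      ∫ x, (∫ y, A (x, y) * w₂ y ∂ν) * w₁ x ∂μ := by
    refine integral_mono (hμ.integrable ?_) (intOut A hAc) fun x =>
      mul_le_mul_of_nonneg_right (energy x) (h₁ x).le
    simp only [div_eq_mul_inv]; fun_prop
  rw [hE, hent, hm, hM]
  set m := ∫ x, U x * w₁ x ∂μ
  set M := ∫ x, w₁ x ∂μ
  have hlog : m * log (m / (N * M)) = m * log (m / M) - log N * m := by
    rcases eq_or_ne m 0 with h | h
    · simp [h]
    rcases eq_or_ne M 0 with h' | h'
    · exfalso
      have : μ = 0 := by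
        have h3 : Function.support w₁ = Set.univ := by ext y; simp [(h₁ y).ne']
        have h4 := (integral_pos_iff_support_of_nonneg (μ := μ) (fun y => (h₁ y).le)
          (hμ.integrable hw₁)).not.1 (by change ¬ 0 < M; simp [h'])
        rw [h3] at h4
        exact Measure.measure_univ_eq_zero.1 (by simpa using h4)
      exact h (by simp [m, this])
    rw [log_div h (by positivity), log_div h h', log_mul hNpos.ne' h']
    ring
  rw [hlog]
  have := mul_le_mul_of_nonneg_left step2 hK
  linarith

end

lemma LogSob.congr {E ι κ : Type*} [NormedAddCommGroup E] [NormedSpace ℝ E] [MeasurableSpace E]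
    [Fintype ι] [Fintype κ] {μ : Measure E} {w : E → ℝ} {v : ι → E} {v' : κ → E} {K : ℝ}
    (H : LogSob μ w v K) (h : ∀ L : E →L[ℝ] ℝ, ∑ i, (L (v i)) ^ 2 = ∑ i, (L (v' i)) ^ 2) :
    LogSob μ w v' K := by
  intro u hu hu0
  simpa only [h] using H u hu hu0

/-- Transport of a logarithmic Sobolev inequality along a linear isomorphism. -/
lemma LogSob.comp_equiv {E F ι : Type*} [NormedAddCommGroup E] [NormedSpace ℝ E]
    [MeasurableSpace E] [BorelSpace E] [NormedAddCommGroup F] [NormedSpace ℝ F]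
    [MeasurableSpace F] [BorelSpace F] [Fintype ι] {μ : Measure E} {ν : Measure F} {w : F → ℝ}
    {v : ι → F} {K : ℝ} (e : E ≃L[ℝ] F) (he : MeasurePreserving e μ ν) (H : LogSob ν w v K) :
    LogSob μ (fun x => w (e x)) (fun i => e.symm (v i)) K := by
  intro u hu hu0
  have h := H (fun y => u (e.symm y)) (hu.comp e.symm.contDiff) fun y => hu0 _
  have hm := e.toHomeomorph.measurableEmbedding
  have hf : ∀ y (z : F), fderiv ℝ (fun y => u (e.symm y)) y z
      = fderiv ℝ u (e.symm y) (e.symm z) := by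
    intro y z
    have h1 : HasFDerivAt (fun y => u (e.symm y)) _ y :=
      (hu.differentiable one_ne_zero (e.symm y)).hasFDerivAt.comp y e.symm.hasFDerivAt
    rw [h1.fderiv]; rfl
  simp only [hf] at h
  have key : ∀ g : F → ℝ, ∫ y, g y ∂ν = ∫ x, g (e x) ∂μ := fun g => (he.integral_comp hm g).symm
  simp only [key, ContinuousLinearEquiv.symm_apply_apply] at h
  exact h

lemma neZero_pi {E : Type*} [MeasurableSpace E] (μ : Measure E) [SigmaFinite μ] [h : NeZero μ]
    (n : ℕ) : NeZero (Measure.pi fun _ : Fin n => μ) := by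
  refine ⟨fun h => ?_⟩
  have h1 : (Measure.pi fun _ : Fin n => μ) Set.univ = 0 := by rw [h]; rfl
  rw [Measure.pi_univ] at h1
  simp [NeZero.ne μ] at h1

lemma LogSob.pi {E κ : Type*} [NormedAddCommGroup E] [NormedSpace ℝ E] [FiniteDimensional ℝ E]
    [MeasurableSpace E] [BorelSpace E] [Fintype κ] {μ : Measure E} [IsFiniteMeasure μ]
    [NeZero μ] (hμ : CompConc μ) {w : E → ℝ} (hw : Continuous w) (hw0 : ∀ x, 0 < w x)
    {v : κ → E} {K : ℝ} (hK : 0 ≤ K) (H : LogSob μ w v K) (n : ℕ) :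
    CompConc (Measure.pi fun _ : Fin n => μ) ∧
    LogSob (Measure.pi fun _ : Fin n => μ) (fun x => ∏ i, w (x i))
      (fun ik : Fin n × κ => (Pi.single ik.1 (v ik.2) : Fin n → E)) K := by
  have : SecondCountableTopology E := by
    have : ProperSpace E := FiniteDimensional.proper ℝ E
    infer_instance
  induction n with
  | zero =>
    constructor
    · exact ⟨Set.univ, (Set.subsingleton_univ).isCompact, by simp⟩
    · intro u hu hu0
      rw [Measure.pi_of_empty (fun _ : Fin 0 => μ)]
      simp
  | succ n ih =>
    obtain ⟨ih1, ih2⟩ := ih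
    have hnz := neZero_pi μ n
    have he := measurePreserving_piFinSuccAbove (fun _ : Fin (n + 1) => μ) 0
    set e : (Fin (n + 1) → E) ≃L[ℝ] E × (Fin n → E) := (Fin.consEquivL ℝ fun _ => E).symm with hed
    have he' : MeasurePreserving e (Measure.pi fun _ : Fin (n + 1) => μ)
        (μ.prod (Measure.pi fun _ : Fin n => μ)) := he
    refine ⟨?_, ?_⟩
    · obtain ⟨S, hS, h0⟩ := hμ.prod ih1
      refine ⟨e ⁻¹' S, ?_, ?_⟩
      · exact e.toHomeomorph.isClosedEmbedding.isCompact_preimage hS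
      · rw [← Set.preimage_compl, he'.measure_preimage_emb e.toHomeomorph.measurableEmbedding, h0]
    · have hp := hμ.prod ih1
      have h1 := (LogSob.prod hμ ih1 hw (w₂ := fun x => ∏ i, w (x i)) (by fun_prop) hw0
        (fun x => Finset.prod_pos fun i _ => hw0 _) hK H ih2).comp_equiv e he'
      have h2 : (fun x => w (e x).1 * ∏ i, w ((e x).2 i)) =
          fun x : Fin (n + 1) → E => ∏ i, w (x i) := by
        ext x
        rw [Fin.prod_univ_succ]; rfl
      rw [h2] at h1
      refine h1.congr fun L => ?_
      rw [Fintype.sum_sum_type, Fintype.sum_prod_type, Fintype.sum_prod_type, Fin.sum_univ_succ]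
      have e1 : ∀ a : E, e.symm (a, 0) = Pi.single 0 a := by
        intro a; ext i
        refine Fin.cases ?_ (fun j => ?_) i <;> simp [hed, Fin.consEquivL, Fin.consLinearEquiv]
      have e2 : ∀ (j : Fin n) (a : E), e.symm (0, Pi.single j a) = Pi.single j.succ a := by
        intro j a; ext i
        refine Fin.cases ?_ (fun k => ?_) i
        · simp [hed, Fin.consEquivL, Fin.consLinearEquiv]
        · by_cases h : k = j
          · subst h; simp [hed, Fin.consEquivL, Fin.consLinearEquiv]
          · simp [hed, Fin.consEquivL, Fin.consLinearEquiv, h]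
      simp only [Sum.elim_inl, Sum.elim_inr, e1, e2]

lemma logSob_gaussW {β : ℝ} (hβ : 0 < β) {a b : ℝ} (hab : a < b) :
    LogSob (volume.restrict (Set.Ico a b)) (gaussW β) (fun _ : Unit => (1 : ℝ)) (1 / (2 * β)) := by
  intro u hu hu0
  have h := logSobolev_interval hβ hab hu hu0
  have key : ∀ g : ℝ → ℝ, ∫ x in a..b, g x = ∫ x in Set.Ico a b, g x := by
    intro g
    rw [intervalIntegral.integral_of_le hab.le, integral_Ico_eq_integral_Ioc]
  simp only [key] at h
  simpa using h

lemma compConc_Ico (a b : ℝ) : CompConc (volume.restrict (Set.Ico a b)) := by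
  refine ⟨Set.Icc a b, isCompact_Icc, ?_⟩
  rw [Measure.restrict_apply measurableSet_Icc.compl]
  convert! measure_empty (μ := (volume : Measure ℝ))
  ext x; simp; intro h1 h2; linarith [h1 h2]

/-- The bounded box `[0,1)^d × [-R,R)^{d(1+m)}`. -/
def boxX (d m : ℕ) (R : ℝ) : Set (Xsp d m) :=
  cube d ×ˢ ((Set.univ.pi fun _ => Set.Ico (-R) R) ×ˢ
    (Set.univ.pi fun _ => Set.univ.pi fun _ => Set.Ico (-R) R))

/-- The squared Euclidean norm of the gradient. -/
def gradSq (d m : ℕ) (u : Xsp d m → ℝ) (x : Xsp d m) : ℝ :=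
  (∑ k, (pQ d m k u x) ^ 2) + (∑ k, (pP d m k u x) ^ 2) + ∑ j, ∑ k, (pZ d m j k u x) ^ 2

/-- The standard Gaussian weight. -/
def gaussX (d m : ℕ) (β : ℝ) (x : Xsp d m) : ℝ :=
  (∏ i, gaussW β (x.1 i)) * ((∏ i, gaussW β (x.2.1 i)) * ∏ j, ∏ i, gaussW β (x.2.2 j i))

lemma cube_eq (d : ℕ) : cube d = Set.univ.pi fun _ => Set.Ico (0 : ℝ) 1 := by
  ext q; simp [cube]

lemma neZero_restrict_Ico {a b : ℝ} (hab : a < b) :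
    NeZero ((volume : Measure ℝ).restrict (Set.Ico a b)) :=
  ⟨fun h => by simp at h; linarith⟩

lemma logSobolev_box (d m : ℕ) {β : ℝ} (hβ : 0 < β) {R : ℝ} (hR : 0 < R)
    {u : Xsp d m → ℝ} (hu : ContDiff ℝ 1 u) (hu0 : ∀ x, 0 < u x) :
    (∫ x in boxX d m R, u x * log (u x) * gaussX d m β x) -
      (∫ x in boxX d m R, u x * gaussX d m β x) *
        log ((∫ x in boxX d m R, u x * gaussX d m β x) / ∫ x in boxX d m R, gaussX d m β x) ≤
    1 / (2 * β) * ∫ x in boxX d m R, gradSq d m u x / u x * gaussX d m β x := by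
  have hK : 0 ≤ 1 / (2 * β) := by positivity
  have n1 := neZero_restrict_Ico (zero_lt_one' ℝ)
  have n2 := neZero_restrict_Ico (show -R < R by linarith)
  have hc := continuous_gaussW β
  have hp := gaussW_pos β
  obtain ⟨c1, l1⟩ := LogSob.pi (compConc_Ico 0 1) hc hp hK (logSob_gaussW hβ zero_lt_one) d
  obtain ⟨c2, l2⟩ := LogSob.pi (compConc_Ico (-R) R) hc hp hK
    (logSob_gaussW hβ (show -R < R by linarith)) d
  have n3 := neZero_pi ((volume : Measure ℝ).restrict (Set.Ico (-R) R)) d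
  have n4 := neZero_pi
    (Measure.pi fun _ : Fin d => (volume : Measure ℝ).restrict (Set.Ico (-R) R)) m
  have g2c : Continuous fun x : Fin d → ℝ => ∏ i, gaussW β (x i) := by fun_prop
  have g2p : ∀ x : Fin d → ℝ, 0 < ∏ i, gaussW β (x i) := fun x => Finset.prod_pos fun i _ => hp _
  obtain ⟨c3, l3⟩ := LogSob.pi c2 g2c g2p hK l2 m
  have l4 := LogSob.prod c2 c3 g2c (w₂ := fun x => ∏ j, ∏ i, gaussW β (x j i)) (by fun_prop) g2p
    (fun x => Finset.prod_pos fun j _ => g2p _) hK l2 l3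
  have n5 : NeZero ((Measure.pi fun _ : Fin d => (volume : Measure ℝ).restrict (Set.Ico (-R) R)).prod
    (Measure.pi fun _ : Fin m => Measure.pi fun _ : Fin d =>
      (volume : Measure ℝ).restrict (Set.Ico (-R) R))) :=
    ⟨fun h => by
      have h1 := congrArg (fun μ => μ Set.univ) h
      simp only [← Set.univ_prod_univ, Measure.prod_prod, Measure.coe_zero, Pi.zero_apply,
        mul_eq_zero, Measure.measure_univ_eq_zero] at h1
      exact h1.elim (NeZero.ne _) (NeZero.ne _)⟩
  have l5 := LogSob.prod c1 (c2.prod c3) g2c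
    (w₂ := fun x : (Fin d → ℝ) × (Fin m → Fin d → ℝ) =>
      (∏ i, gaussW β (x.1 i)) * ∏ j, ∏ i, gaussW β (x.2 j i)) (by fun_prop) g2p
    (fun x => mul_pos (g2p _) (Finset.prod_pos fun j _ => g2p _)) hK l1 l4
  have hmeas : (Measure.pi fun _ : Fin d => (volume : Measure ℝ).restrict (Set.Ico 0 1)).prod
      ((Measure.pi fun _ : Fin d => (volume : Measure ℝ).restrict (Set.Ico (-R) R)).prod
      (Measure.pi fun _ : Fin m => Measure.pi fun _ : Fin d =>
      (volume : Measure ℝ).restrict (Set.Ico (-R) R))) =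
      (volume : Measure (Xsp d m)).restrict (boxX d m R) := by
    rw [← Measure.restrict_pi_pi, ← Measure.restrict_pi_pi, ← Measure.restrict_pi_pi,
      Measure.prod_restrict, Measure.prod_restrict, boxX, cube_eq]
    rfl
  rw [hmeas] at l5
  have h := l5 u hu hu0
  convert! h using 6 with x
  simp only [gradSq, pQ, pP, pZ, zdir, Fintype.sum_sum_type, Fintype.sum_prod_type, Sum.elim_inl,
    Sum.elim_inr, Finset.univ_unique, Finset.sum_singleton, Pi.single, ← add_assoc,
    Prod.mk_zero_zero]

/-- The normalised Gibbs density. -/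
def rho (d m : ℕ) (β Z : ℝ) (V : (Fin d → ℝ) → ℝ) (x : Xsp d m) : ℝ := Z⁻¹ * gdens d m β V x

section

variable {d m : ℕ} {β Z : ℝ} {V : (Fin d → ℝ) → ℝ}

lemma gdens_pos (x : Xsp d m) : 0 < gdens d m β V x := Real.exp_pos _

lemma rho_pos (hZ : 0 < Z) (x : Xsp d m) : 0 < rho d m β Z V x :=
  mul_pos (inv_pos.2 hZ) (gdens_pos x)

lemma continuous_rho (hV : Continuous V) : Continuous (rho d m β Z V) := by
  unfold rho gdens; fun_prop

lemma measurableSet_cube (d : ℕ) : MeasurableSet (cube d) := by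
  rw [cube_eq]; exact MeasurableSet.univ_pi fun _ => measurableSet_Ico

lemma measurableSet_boxX (d m : ℕ) (R : ℝ) : MeasurableSet (boxX d m R) :=
  (measurableSet_cube d).prod ((MeasurableSet.univ_pi fun _ => measurableSet_Ico).prod
    (MeasurableSet.univ_pi fun _ => MeasurableSet.univ_pi fun _ => measurableSet_Ico))

lemma gibbs_eq : gibbs d m β Z V =
    (volX d m).withDensity fun x => ENNReal.ofReal (rho d m β Z V x) := rfl

lemma integral_gibbs (hV : Continuous V) (hZ : 0 < Z) (g : Xsp d m → ℝ) :
    ∫ x, g x ∂(gibbs d m β Z V) = ∫ x, rho d m β Z V x * g x ∂(volX d m) := by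
  rw [gibbs_eq, integral_withDensity_eq_integral_toReal_smul]
  · refine integral_congr_ae (Eventually.of_forall fun x => ?_)
    simp only [smul_eq_mul]
    rw [ENNReal.toReal_ofReal (rho_pos (β := β) (V := V) hZ x).le]
  · exact (continuous_rho (β := β) (Z := Z) hV).measurable.ennreal_ofReal
  · simp

lemma integrable_gibbs (hV : Continuous V) (hZ : 0 < Z) {g : Xsp d m → ℝ} :
    Integrable g (gibbs d m β Z V) ↔ Integrable (fun x => rho d m β Z V x * g x) (volX d m) := by
  rw [gibbs_eq, integrable_withDensity_iff_integrable_smul']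
  · refine integrable_congr (Eventually.of_forall fun x => ?_)
    simp only [smul_eq_mul]
    rw [ENNReal.toReal_ofReal (rho_pos (β := β) (V := V) hZ x).le]
  · exact (continuous_rho (β := β) (Z := Z) hV).measurable.ennreal_ofReal
  · simp

lemma setIntegral_gibbs_boxX (hV : Continuous V) (hZ : 0 < Z) (g : Xsp d m → ℝ) (R : ℝ) :
    ∫ x in boxX d m R, g x ∂(gibbs d m β Z V) = ∫ x in boxX d m R, rho d m β Z V x * g x := by
  rw [gibbs_eq, setIntegral_withDensity_eq_setIntegral_toReal_smul
    (continuous_rho (β := β) (Z := Z) hV).measurable.ennreal_ofReal (by simp) _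
    (measurableSet_boxX d m R), volX, Measure.restrict_restrict (measurableSet_boxX d m R)]
  have : boxX d m R ∩ {x | x.1 ∈ cube d} = boxX d m R :=
    Set.inter_eq_left.2 fun x hx => hx.1
  rw [this]
  refine integral_congr_ae (Eventually.of_forall fun x => ?_)
  simp only [smul_eq_mul]
  rw [ENNReal.toReal_ofReal (rho_pos (β := β) (V := V) hZ x).le]

lemma integrableOn_boxX {g : Xsp d m → ℝ} (hg : Continuous g) (R : ℝ) :
    IntegrableOn g (boxX d m R) := by
  have hc : IsCompact ((Set.univ.pi fun _ : Fin d => Set.Icc (0 : ℝ) 1) ×ˢ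
      ((Set.univ.pi fun _ : Fin d => Set.Icc (-R) R) ×ˢ
      (Set.univ.pi fun _ : Fin m => Set.univ.pi fun _ : Fin d => Set.Icc (-R) R))) :=
    (isCompact_univ_pi fun _ => isCompact_Icc).prod ((isCompact_univ_pi fun _ => isCompact_Icc).prod
      (isCompact_univ_pi fun _ => isCompact_univ_pi fun _ => isCompact_Icc))
  refine (hg.continuousOn.integrableOn_compact hc).mono_set ?_
  rw [boxX, cube_eq]
  refine Set.prod_mono ?_ (Set.prod_mono ?_ ?_)
  · exact Set.pi_mono fun _ _ => Set.Ico_subset_Icc_self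
  · exact Set.pi_mono fun _ _ => Set.Ico_subset_Icc_self
  · exact Set.pi_mono fun _ _ => Set.pi_mono fun _ _ => Set.Ico_subset_Icc_self

lemma gaussX_eq (x : Xsp d m) : gaussX d m β x =
    exp (-β * ((∑ i, (x.1 i) ^ 2) / 2 + (∑ i, (x.2.1 i) ^ 2) / 2 +
      (∑ j, ∑ i, (x.2.2 j i) ^ 2) / 2)) := by
  simp only [gaussX, gaussW, ← Real.exp_sum, ← Real.exp_add]
  congr 1
  simp only [Finset.sum_div, Finset.mul_sum, mul_add]
  ring_nf

lemma continuous_gaussX : Continuous (gaussX d m β) := by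
  unfold gaussX; fun_prop

lemma gaussX_pos (x : Xsp d m) : 0 < gaussX d m β x := by rw [gaussX_eq]; exact exp_pos _

/-- On the boxes, the Gibbs density is comparable to the Gaussian weight, uniformly in the size. -/
lemma exists_rho_gaussX_bounds (hβ : 0 < β) (hZ : 0 < Z) (hV : Continuous V) :
    ∃ c C : ℝ, 0 < c ∧ 0 < C ∧ ∀ x : Xsp d m, x.1 ∈ cube d →
      c * gaussX d m β x ≤ rho d m β Z V x ∧ rho d m β Z V x ≤ C * gaussX d m β x := by
  have hc : IsCompact (Set.univ.pi fun _ : Fin d => Set.Icc (0 : ℝ) 1) :=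
    isCompact_univ_pi fun _ => isCompact_Icc
  obtain ⟨B, hB⟩ := (hc.image (f := fun q => V q - (∑ i, (q i) ^ 2) / 2)
    (by fun_prop)).isBounded.exists_norm_le
  refine ⟨Z⁻¹ * exp (-β * B), Z⁻¹ * exp (β * B), by positivity, by positivity, fun x hx => ?_⟩
  have h1 : |V x.1 - (∑ i, (x.1 i) ^ 2) / 2| ≤ B := by
    refine hB _ ⟨x.1, ?_, rfl⟩
    intro i _; exact Set.Ico_subset_Icc_self (hx i)
  obtain ⟨h2, h3⟩ := abs_le.1 h1
  rw [rho, gdens, gaussX_eq, mul_assoc, mul_assoc, ← Real.exp_add, ← Real.exp_add]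
  constructor <;> refine mul_le_mul_of_nonneg_left (Real.exp_le_exp.2 ?_) (by positivity) <;>
  nlinarith

lemma mul_log_div_le {a b c : ℝ} (ha : 0 < a) (hb : 0 < b) (hc : 0 < c) :
    - (a * log (a / b)) ≤ -(a * log c) - a + c * b := by
  have h := Real.log_le_sub_one_of_pos (show 0 < c * b / a by positivity)
  rw [log_div (by positivity) ha.ne', log_mul hc.ne' hb.ne'] at h
  rw [log_div ha.ne' hb.ne']
  have : a * (c * b / a - 1) = c * b - a := by field_simp
  nlinarith

lemma iUnion_boxX (d m : ℕ) : ⋃ n : ℕ, boxX d m ((n : ℝ) + 1) = {x | x.1 ∈ cube d} := by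
  ext x
  simp only [Set.mem_iUnion, Set.mem_ofPred_eq]
  refine ⟨fun ⟨n, h⟩ => h.1, fun h => ?_⟩
  obtain ⟨n, hn⟩ := exists_nat_gt (‖x‖)
  refine ⟨n, h, ?_, ?_⟩
  · intro i _
    have h1 : |x.2.1 i| ≤ ‖x‖ :=
      (norm_le_pi_norm x.2.1 i).trans ((norm_fst_le x.2).trans (norm_snd_le x))
    have := abs_le.1 h1
    constructor <;> linarith
  · intro j _ i _
    have h1 : |x.2.2 j i| ≤ ‖x‖ := (norm_le_pi_norm (x.2.2 j) i).trans
      ((norm_le_pi_norm x.2.2 j).trans ((norm_snd_le x.2).trans (norm_snd_le x)))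
    have := abs_le.1 h1
    constructor <;> linarith

lemma monotone_boxX (d m : ℕ) : Monotone fun n : ℕ => boxX d m ((n : ℝ) + 1) := by
  intro a b hab
  have h : (a : ℝ) ≤ b := by exact_mod_cast hab
  refine Set.prod_mono subset_rfl (Set.prod_mono ?_ ?_)
  · exact Set.pi_mono fun _ _ => Set.Ico_subset_Ico (by linarith) (by linarith)
  · exact Set.pi_mono fun _ _ => Set.pi_mono fun _ _ =>
      Set.Ico_subset_Ico (by linarith) (by linarith)

lemma tendsto_setIntegral_boxX {g : Xsp d m → ℝ} (hg : Integrable g (gibbs d m β Z V)) :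
    Tendsto (fun n : ℕ => ∫ x in boxX d m ((n : ℝ) + 1), g x ∂(gibbs d m β Z V)) atTop
      (nhds (∫ x, g x ∂(gibbs d m β Z V))) := by
  have h := tendsto_setIntegral_of_monotone (fun n : ℕ => measurableSet_boxX d m ((n : ℝ) + 1))
    (monotone_boxX d m) hg.integrableOn
  rw [iUnion_boxX] at h
  have hm : MeasurableSet {x : Xsp d m | x.1 ∈ cube d} := measurable_fst (measurableSet_cube d)
  have h2 : (gibbs d m β Z V).restrict {x | x.1 ∈ cube d} = gibbs d m β Z V := by
    rw [gibbs_eq, restrict_withDensity hm, volX, Measure.restrict_restrict hm, Set.inter_self]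
  rwa [h2] at h

lemma boxX_pos (d m : ℕ) {R : ℝ} (hR : 0 < R) : (volume : Measure (Xsp d m)) (boxX d m R) ≠ 0 := by
  rw [boxX, cube_eq]
  simp only [Measure.volume_eq_prod, Measure.prod_prod, volume_pi_pi, Real.volume_Ico]
  simp [hR]

lemma setIntegral_boxX_pos {R : ℝ} (hR : 0 < R) {g : Xsp d m → ℝ} (hg : Continuous g)
    (h0 : ∀ x, 0 < g x) : 0 < ∫ x in boxX d m R, g x := by
  rw [setIntegral_pos_iff_support_of_nonneg_ae (Eventually.of_forall fun x => (h0 x).le)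
    (integrableOn_boxX hg R)]
  have : Function.support g = Set.univ := by ext y; simp [(h0 y).ne']
  rw [this, Set.univ_inter]
  exact pos_iff_ne_zero.2 (boxX_pos d m hR)

/-- The logarithmic Sobolev inequality for the Gibbs measure. -/
theorem exists_logSobolev_gibbs (hβ : 0 < β) (hZ : 0 < Z) (hV : Continuous V)
    [IsProbabilityMeasure (gibbs d m β Z V)] :
    ∃ K : ℝ, 0 < K ∧ ∀ u : Xsp d m → ℝ, ContDiff ℝ 1 u → (∀ x, 0 < u x) →
      Integrable u (gibbs d m β Z V) → Integrable (fun x => u x * log (u x)) (gibbs d m β Z V) →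
      Integrable (fun x => gradSq d m u x / u x) (gibbs d m β Z V) →
      (∫ x, u x * log (u x) ∂(gibbs d m β Z V)) -
        (∫ x, u x ∂(gibbs d m β Z V)) * log (∫ x, u x ∂(gibbs d m β Z V)) ≤
      K * ∫ x, gradSq d m u x / u x ∂(gibbs d m β Z V) := by
  obtain ⟨c, C, hc, hC, hcC⟩ := exists_rho_gaussX_bounds (m := m) hβ hZ hV
  refine ⟨C * (1 / (2 * β)) / c, by positivity, fun u hu hu0 i1 i2 i3 => ?_⟩
  have hul : Continuous fun x => log (u x) := hu.continuous.log fun x => (hu0 x).ne'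
  have hui : Continuous fun x => (u x)⁻¹ := hu.continuous.inv₀ fun x => (hu0 x).ne'
  have huc := hu.continuous
  have hu' : Continuous (fderiv ℝ u) := hu.continuous_fderiv one_ne_zero
  have hrc : Continuous (rho d m β Z V) := continuous_rho hV
  have hwc : Continuous (gaussX d m β) := continuous_gaussX
  have hw0 := gaussX_pos (d := d) (m := m) (β := β)
  have hr0 := rho_pos (d := d) (m := m) (β := β) (V := V) hZ
  have hG : Continuous fun x => gradSq d m u x / u x := by
    simp only [gradSq, pQ, pP, pZ, div_eq_mul_inv]; fun_prop
  have hG0 : ∀ x, 0 ≤ gradSq d m u x / u x := fun x =>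
    div_nonneg (by unfold gradSq; positivity) (hu0 x).le
  have hbox : ∀ n : ℕ, (∫ x in boxX d m ((n : ℝ) + 1), u x * log (u x) ∂(gibbs d m β Z V)) -
      (∫ x in boxX d m ((n : ℝ) + 1), u x ∂(gibbs d m β Z V)) *
        log ((∫ x in boxX d m ((n : ℝ) + 1), u x ∂(gibbs d m β Z V)) /
          ∫ x in boxX d m ((n : ℝ) + 1), 1 ∂(gibbs d m β Z V)) ≤
      C * (1 / (2 * β)) / c *
        ∫ x in boxX d m ((n : ℝ) + 1), gradSq d m u x / u x ∂(gibbs d m β Z V) := by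
    intro n
    have hR : (0 : ℝ) < n + 1 := by positivity
    simp only [setIntegral_gibbs_boxX hV hZ]
    set R : ℝ := n + 1
    have hls := logSobolev_box d m hβ hR hu hu0
    set W := ∫ x in boxX d m R, gaussX d m β x with hW
    set M := ∫ x in boxX d m R, u x * gaussX d m β x with hM
    have hW0 : 0 < W := setIntegral_boxX_pos hR hwc hw0
    have hM0 : 0 < M := setIntegral_boxX_pos hR (by fun_prop) fun x => mul_pos (hu0 x) (hw0 x)
    set s := M / W with hs
    have hs0 : 0 < s := div_pos hM0 hW0
    set φ : Xsp d m → ℝ := fun x => u x * log (u x) - log s * u x - u x + s with hφ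
    have hφc : Continuous φ := by simp only [hφ]; fun_prop
    have hφ0 : ∀ x, 0 ≤ φ x := by
      intro x
      have := mul_log_div_le (hu0 x) one_pos hs0
      rw [div_one] at this
      simp only [hφ]; linarith
    have expand : ∀ w : Xsp d m → ℝ, Continuous w → ∫ x in boxX d m R, w x * φ x =
        (∫ x in boxX d m R, w x * (u x * log (u x))) - log s * (∫ x in boxX d m R, w x * u x)
          - (∫ x in boxX d m R, w x * u x) + s * ∫ x in boxX d m R, w x * 1 := by
      intro w hw
      have j1 : IntegrableOn (fun x => w x * (u x * log (u x))) (boxX d m R) :=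
        integrableOn_boxX (by fun_prop) R
      have j2 : IntegrableOn (fun x => log s * (w x * u x)) (boxX d m R) :=
        integrableOn_boxX (by fun_prop) R
      have j3 : IntegrableOn (fun x => w x * u x) (boxX d m R) := integrableOn_boxX (by fun_prop) R
      have j4 : IntegrableOn (fun x => s * (w x * 1)) (boxX d m R) :=
        integrableOn_boxX (by fun_prop) R
      rw [← integral_const_mul, ← integral_const_mul, ← integral_sub j1 j2,
        ← integral_sub (by exact j1.sub j2) j3, ← integral_add (by exact (j1.sub j2).sub j3) j4]
      congr 1; ext x; simp only [hφ]; ring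
    have e1 : ∫ x in boxX d m R, gaussX d m β x * φ x ≤
        1 / (2 * β) * ∫ x in boxX d m R, gradSq d m u x / u x * gaussX d m β x := by
      rw [expand _ hwc]
      simp only [mul_comm (gaussX d m β _), one_mul]
      rw [← hM, ← hW]
      have : s * W = M := div_mul_cancel₀ _ hW0.ne'
      linarith
    have e2 : ∫ x in boxX d m R, rho d m β Z V x * φ x ≤
        C * ∫ x in boxX d m R, gaussX d m β x * φ x := by
      rw [← integral_const_mul]
      refine setIntegral_mono_on (integrableOn_boxX (by fun_prop) R)
        (integrableOn_boxX (by fun_prop) R) (measurableSet_boxX d m R) fun x hx => ?_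
      rw [← mul_assoc]
      exact mul_le_mul_of_nonneg_right (hcC x hx.1).2 (hφ0 x)
    have e3 : c * ∫ x in boxX d m R, gradSq d m u x / u x * gaussX d m β x ≤
        ∫ x in boxX d m R, rho d m β Z V x * (gradSq d m u x / u x) := by
      rw [← integral_const_mul]
      refine setIntegral_mono_on (integrableOn_boxX (by fun_prop) R)
        (integrableOn_boxX (by fun_prop) R) (measurableSet_boxX d m R) fun x hx => ?_
      have := mul_le_mul_of_nonneg_right (hcC x hx.1).1 (hG0 x)
      linarith
    rw [expand _ hrc] at e2
    have e4 := mul_log_div_le (a := ∫ x in boxX d m R, rho d m β Z V x * u x)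
      (b := ∫ x in boxX d m R, rho d m β Z V x * 1) (c := s)
      (setIntegral_boxX_pos hR (by fun_prop) fun x => mul_pos (hr0 x) (hu0 x))
      (setIntegral_boxX_pos hR (by fun_prop) fun x => mul_pos (hr0 x) one_pos) hs0
    have e5 : C * (1 / (2 * β)) / c * ∫ x in boxX d m R, rho d m β Z V x * (gradSq d m u x / u x) ≥
        C * (1 / (2 * β) * ∫ x in boxX d m R, gradSq d m u x / u x * gaussX d m β x) := by
      calc _ ≥ C * (1 / (2 * β)) / c *
          (c * ∫ x in boxX d m R, gradSq d m u x / u x * gaussX d m β x) := by gcongr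
        _ = _ := by field_simp
    have e6 := mul_le_mul_of_nonneg_left e1 hC.le
    linarith
  have t1 := tendsto_setIntegral_boxX i1
  have t2 := tendsto_setIntegral_boxX i2
  have t3 := tendsto_setIntegral_boxX i3
  have t4 := tendsto_setIntegral_boxX (integrable_const (μ := gibbs d m β Z V) (1 : ℝ))
  have hone : ∫ x, (1 : ℝ) ∂(gibbs d m β Z V) = 1 := by simp
  rw [hone] at t4
  have hpos : 0 < ∫ x, u x ∂(gibbs d m β Z V) := by
    rw [integral_pos_iff_support_of_nonneg (fun y => (hu0 y).le) i1]
    have : Function.support u = Set.univ := by ext y; simp [(hu0 y).ne']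
    rw [this]; simp
  have t5 := t2.sub (t1.mul (Tendsto.log (t1.div t4 one_ne_zero) (by simpa using hpos.ne')))
  simp only [div_one] at t5
  exact le_of_tendsto_of_tendsto' t5 (t3.const_mul _) hbox

end

section

open scoped Pointwise

variable {d m : ℕ}

/-- The lattice `ℤ^d` acting on the position variable. -/
def latticeX (d m : ℕ) : AddSubgroup (Xsp d m) where
  carrier := Set.range fun k : Fin d → ℤ => ((fun i => (k i : ℝ)), 0)
  zero_mem' := ⟨0, by ext <;> simp⟩
  add_mem' := by
    rintro _ _ ⟨k, rfl⟩ ⟨l, rfl⟩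
    exact ⟨k + l, by ext <;> simp⟩
  neg_mem' := by
    rintro _ ⟨k, rfl⟩
    exact ⟨-k, by ext <;> simp⟩

instance : Countable (latticeX d m) :=
  (Set.countable_range fun k : Fin d → ℤ => (((fun i => (k i : ℝ)), 0) : Xsp d m)).to_subtype

lemma isAddFundamentalDomain_cube (d m : ℕ) :
    IsAddFundamentalDomain (latticeX d m) {x : Xsp d m | x.1 ∈ cube d} volume := by
  refine IsAddFundamentalDomain.mk'
    (measurable_fst (measurableSet_cube d)).nullMeasurableSet fun x => ?_
  refine ⟨⟨((fun i => ((-⌊x.1 i⌋ : ℤ) : ℝ)), 0), ⟨fun i => -⌊x.1 i⌋, rfl⟩⟩, ?_, ?_⟩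
  · intro i
    have h1 := Int.floor_le (x.1 i)
    have h2 := Int.lt_floor_add_one (x.1 i)
    simp only [AddSubgroup.vadd_def, vadd_eq_add, Prod.fst_add, Pi.add_apply, Int.cast_neg]
    constructor <;> linarith
  · rintro ⟨_, k, rfl⟩ hk
    refine Subtype.ext (Prod.ext (funext fun i => ?_) rfl)
    have hi := hk i
    simp only [AddSubgroup.vadd_def, vadd_eq_add, Prod.fst_add, Pi.add_apply] at hi
    have : ⌊x.1 i⌋ = - k i := by
      rw [Int.floor_eq_iff]
      push_cast
      constructor <;> linarith [hi.1, hi.2]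
    simp [this]

instance instIsAddLeftInvariantVolumeXsp (d m : ℕ) :
    (volume : Measure (Xsp d m)).IsAddLeftInvariant := by
  have h1 : (volume : Measure (Fin m → Fin d → ℝ)).IsAddLeftInvariant :=
    Measure.pi.isAddLeftInvariant (μ := fun _ : Fin m => (volume : Measure (Fin d → ℝ)))
  have h2 : (volume : Measure ((Fin d → ℝ) × (Fin m → Fin d → ℝ))).IsAddLeftInvariant :=
    Measure.prod.instIsAddLeftInvariant
  exact Measure.prod.instIsAddLeftInvariant

lemma integral_volX_comp_add {φ : Xsp d m → ℝ} (hφ : PerQ d m φ) (v : Xsp d m) :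
    ∫ x, φ (x + v) ∂(volX d m) = ∫ x, φ x ∂(volX d m) := by
  have hd := isAddFundamentalDomain_cube d m
  have h1 := hd.vadd_of_comm v
  have hinv : ∀ (g : latticeX d m) (x : Xsp d m), φ (g +ᵥ x) = φ x := by
    rintro ⟨_, k, rfl⟩ x
    rw [← hφ k x]
    congr 1
    ext <;> simp [AddSubgroup.vadd_def, add_comm]
  have h2 := h1.setIntegral_eq hd hinv
  have h3 := (measurePreserving_add_right (volume : Measure (Xsp d m)) v).setIntegral_preimage_emb
    (Homeomorph.addRight v).measurableEmbedding φ (v +ᵥ {x : Xsp d m | x.1 ∈ cube d})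
  have h4 : (fun x : Xsp d m => x + v) ⁻¹' (v +ᵥ {x : Xsp d m | x.1 ∈ cube d}) =
      {x : Xsp d m | x.1 ∈ cube d} := by
    ext x
    rw [Set.mem_preimage, Set.mem_vadd_set_iff_neg_vadd_mem]
    simp
  rw [h4] at h3
  exact h3.trans h2

/-- Bounded support in the momentum and auxiliary variables. -/
def BddSupp (φ : Xsp d m → ℝ) : Prop := ∃ r : ℝ, ∀ x : Xsp d m, r ≤ ‖x.2‖ → φ x = 0

lemma BddSupp.mul_left {φ ψ : Xsp d m → ℝ} (h : BddSupp φ) : BddSupp fun x => ψ x * φ x := by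
  obtain ⟨r, hr⟩ := h
  exact ⟨r, fun x hx => by simp [hr x hx]⟩

lemma BddSupp.mul_right {φ ψ : Xsp d m → ℝ} (h : BddSupp φ) : BddSupp fun x => φ x * ψ x := by
  obtain ⟨r, hr⟩ := h
  exact ⟨r, fun x hx => by simp [hr x hx]⟩

lemma BddSupp.fderiv {φ : Xsp d m → ℝ} (h : BddSupp φ) (v : Xsp d m) :
    BddSupp fun x => fderiv ℝ φ x v := by
  obtain ⟨r, hr⟩ := h
  refine ⟨r + 1, fun x hx => ?_⟩
  have : φ =ᶠ[nhds x] fun _ => 0 := by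
    have ho : IsOpen {y : Xsp d m | r < ‖y.2‖} := isOpen_lt (by fun_prop) (by fun_prop)
    filter_upwards [ho.mem_nhds (show r < ‖x.2‖ by linarith)] with y hy
    exact hr y (le_of_lt hy)
  simp only [Filter.EventuallyEq.fderiv_eq this]; simp

lemma mem_boxX_of_norm_lt {x : Xsp d m} {r : ℝ} (h : x.1 ∈ cube d) (hx : ‖x.2‖ < r) :
    x ∈ boxX d m r := by
  refine ⟨h, ?_, ?_⟩
  · intro i _
    have h1 : |x.2.1 i| ≤ ‖x.2‖ := (norm_le_pi_norm x.2.1 i).trans (norm_fst_le x.2)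
    have := abs_le.1 h1
    constructor <;> linarith
  · intro j _ i _
    have h1 : |x.2.2 j i| ≤ ‖x.2‖ := (norm_le_pi_norm (x.2.2 j) i).trans
      ((norm_le_pi_norm x.2.2 j).trans (norm_snd_le x.2))
    have := abs_le.1 h1
    constructor <;> linarith

lemma integral_volX_eq_boxX {g : Xsp d m → ℝ} {r : ℝ} (h : ∀ x, r ≤ ‖x.2‖ → g x = 0) :
    ∫ x, g x ∂(volX d m) = ∫ x in boxX d m r, g x := by
  have hm : MeasurableSet {x : Xsp d m | x.1 ∈ cube d} := measurable_fst (measurableSet_cube d)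
  refine (setIntegral_eq_of_subset_of_forall_sdiff_eq_zero hm (fun x hx => hx.1) ?_)
  intro x hx
  by_contra hne
  exact hx.2 (mem_boxX_of_norm_lt hx.1 (lt_of_not_ge fun h' => hne (h x h')))

lemma BddSupp.integrable {φ : Xsp d m → ℝ} (h : BddSupp φ) (hc : Continuous φ) :
    Integrable φ (volX d m) := by
  obtain ⟨r, hr⟩ := h
  have hm : MeasurableSet {x : Xsp d m | x.1 ∈ cube d} := measurable_fst (measurableSet_cube d)
  refine (integrableOn_boxX hc r).of_forall_sdiff_eq_zero hm fun x hx => ?_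
  by_contra hne
  exact hx.2 (mem_boxX_of_norm_lt hx.1 (lt_of_not_ge fun hle => hne (hr x hle)))

/-- The integral of a derivative vanishes. -/
lemma integral_fderiv_volX {φ : Xsp d m → ℝ} (hφ : ContDiff ℝ 1 φ) (hp : PerQ d m φ)
    (hs : BddSupp φ) (v : Xsp d m) : ∫ x, fderiv ℝ φ x v ∂(volX d m) = 0 := by
  obtain ⟨r, hr⟩ := hs
  set R := r + ‖v‖ + 1 with hR
  have hvan : ∀ s : ℝ, |s| ≤ 1 → ∀ x : Xsp d m, R ≤ ‖x.2‖ → φ (x + s • v) = 0 := by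
    intro s hs x hx
    apply hr
    have h1 : ‖x.2‖ ≤ ‖(x + s • v).2‖ + ‖s • v.2‖ := by
      have := norm_sub_le (x + s • v).2 (s • v.2)
      simpa using this
    have h2 : ‖s • v.2‖ ≤ ‖v‖ := by
      rw [norm_smul]
      calc ‖s‖ * ‖v.2‖ ≤ 1 * ‖v‖ := mul_le_mul hs (norm_snd_le v) (norm_nonneg _) zero_le_one
        _ = _ := one_mul _
    linarith
  have hcc : CompConc ((volume : Measure (Xsp d m)).restrict (boxX d m R)) := by
    refine ⟨_, (isCompact_univ_pi fun _ : Fin d => isCompact_Icc (a := (0 : ℝ)) (b := 1)).prod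
      ((isCompact_univ_pi fun _ : Fin d => isCompact_Icc (a := -R) (b := R)).prod
      (isCompact_univ_pi fun _ : Fin m => isCompact_univ_pi fun _ : Fin d =>
        isCompact_Icc (a := -R) (b := R))), ?_⟩
    refine measure_mono_null (t := (boxX d m R)ᶜ) (Set.compl_subset_compl.2 ?_) ?_
    · rw [boxX, cube_eq]
      refine Set.prod_mono ?_ (Set.prod_mono ?_ ?_)
      · exact Set.pi_mono fun _ _ => Set.Ico_subset_Icc_self
      · exact Set.pi_mono fun _ _ => Set.Ico_subset_Icc_self
      · exact Set.pi_mono fun _ _ => Set.pi_mono fun _ _ => Set.Ico_subset_Icc_self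
    · rw [Measure.restrict_apply (measurableSet_boxX d m R).compl]; simp
  have hfin : IsFiniteMeasure ((volume : Measure (Xsp d m)).restrict (boxX d m R)) := by
    constructor
    have := (integrableOn_boxX (d := d) (m := m) (continuous_const (y := (1 : ℝ))) R)
    rw [integrableOn_const_iff (by simp)] at this
    simpa using this
  have hu : ContDiff ℝ 1 (fun p : ℝ × Xsp d m => φ (p.2 + p.1 • v)) := hφ.comp (by fun_prop)
  have hd := hcc.hasFDerivAt_integral hu (w := fun _ => 1) continuous_const 0
  have hc : (fun s : ℝ => ∫ x in boxX d m R, φ (x + s • v) * 1) =ᶠ[nhds 0]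
      fun _ => ∫ x, φ x ∂(volX d m) := by
    filter_upwards [Metric.closedBall_mem_nhds (0 : ℝ) one_pos] with s hs
    have hs' : |s| ≤ 1 := by simpa using hs
    simp only [mul_one]
    rw [← integral_volX_eq_boxX (hvan s hs'), integral_volX_comp_add hp]
  have h0 := hcc.fderiv_integral_apply hu (w := fun _ => 1) continuous_const 0 1
  rw [hc.fderiv_eq] at h0
  have hv0 : ∀ x, R ≤ ‖x.2‖ → fderiv ℝ φ x v = 0 := by
    intro x hx
    have : φ =ᶠ[nhds x] fun _ => 0 := by
      have ho : IsOpen {y : Xsp d m | r < ‖y.2‖} := isOpen_lt (by fun_prop) (by fun_prop)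
      filter_upwards [ho.mem_nhds (show r < ‖x.2‖ by linarith [norm_nonneg v])] with y hy
      exact hr y (le_of_lt hy)
    rw [this.fderiv_eq]; simp
  rw [integral_volX_eq_boxX hv0]
  have hf : ∀ x : Xsp d m, fderiv ℝ (fun p : ℝ × Xsp d m => φ (p.2 + p.1 • v)) (0, x) (1, 0) =
      fderiv ℝ φ x v := by
    intro x
    have h1 : HasFDerivAt (fun p : ℝ × Xsp d m => p.2 + p.1 • v)
        (ContinuousLinearMap.snd ℝ ℝ (Xsp d m) +
          (ContinuousLinearMap.fst ℝ ℝ (Xsp d m)).smulRight v) ((0 : ℝ), x) :=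
      hasFDerivAt_snd.add (hasFDerivAt_fst.smul_const v)
    have h2 : HasFDerivAt φ (fderiv ℝ φ x) ((fun p : ℝ × Xsp d m => p.2 + p.1 • v) (0, x)) := by
      simpa using (hφ.differentiable one_ne_zero x).hasFDerivAt
    have h3 : HasFDerivAt (fun p : ℝ × Xsp d m => φ (p.2 + p.1 • v)) _ (0, x) :=
      HasFDerivAt.comp (g := φ) ((0 : ℝ), x) h2 h1
    rw [h3.fderiv]
    simp
  simp only [hf, mul_one] at h0
  simpa using h0.symm

/-- Integration by parts on the state space. -/
lemma integral_mul_fderiv_volX {φ ψ : Xsp d m → ℝ} (hφ : ContDiff ℝ 1 φ) (hψ : ContDiff ℝ 1 ψ)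
    (hφp : PerQ d m φ) (hψp : PerQ d m ψ) (hs : BddSupp φ) (v : Xsp d m) :
    ∫ x, φ x * fderiv ℝ ψ x v ∂(volX d m) = - ∫ x, ψ x * fderiv ℝ φ x v ∂(volX d m) := by
  have h := integral_fderiv_volX (hφ.mul hψ) (fun k x => by
    simp only [hφp k x, hψp k x]) hs.mul_right v
  have hφ' : Continuous (fderiv ℝ φ) := hφ.continuous_fderiv one_ne_zero
  have hψ' : Continuous (fderiv ℝ ψ) := hψ.continuous_fderiv one_ne_zero
  have e : ∀ x, fderiv ℝ (φ * ψ) x v = φ x * fderiv ℝ ψ x v + ψ x * fderiv ℝ φ x v := by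
    intro x
    rw [fderiv_mul (hφ.differentiable one_ne_zero x) (hψ.differentiable one_ne_zero x)]
    simp
  have hφc := hφ.continuous
  have hψc := hψ.continuous
  change ∫ x, fderiv ℝ (φ * ψ) x v ∂(volX d m) = 0 at h
  simp only [e] at h
  rw [integral_add (hs.mul_right.integrable (by fun_prop))
    ((hs.fderiv v).mul_left.integrable (by fun_prop))] at h
  linarith

end

section

variable {d m : ℕ} {β : ℝ} {α lam : Fin m → ℝ} {V : (Fin d → ℝ) → ℝ}

/-- The drift of the backward equation satisfied by the relative density. -/
def drift (α lam : Fin m → ℝ) (V : (Fin d → ℝ) → ℝ) (x : Xsp d m) : Xsp d m :=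
  (-x.2.1, (fun i => fderiv ℝ V x.1 (Pi.single i 1)) - ∑ j, lam j • x.2.2 j,
    fun j => lam j • x.2.1 - α j • x.2.2 j)

/-- The degenerate elliptic operator governing the relative density. -/
def backOp (β : ℝ) (α lam : Fin m → ℝ) (V : (Fin d → ℝ) → ℝ) (φ : Xsp d m → ℝ) (x : Xsp d m) : ℝ :=
  fderiv ℝ φ x (drift α lam V x) +
    β⁻¹ * ∑ j, α j * ∑ k, fderiv ℝ (pZ d m j k φ) x (zdir d m j (Pi.single k 1))

/-- Functions on which the operator `backOp` acts classically. -/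
def Reg (φ : Xsp d m → ℝ) : Prop := ContDiff ℝ 1 φ ∧ ∀ j k, ContDiff ℝ 1 (pZ d m j k φ)

/-- The quadratic form of the noise. -/
def noiseSq (β : ℝ) (α : Fin m → ℝ) (L : Xsp d m → ℝ) : ℝ :=
  β⁻¹ * ∑ j, α j * ∑ k, (L (zdir d m j (Pi.single k 1))) ^ 2

lemma noiseSq_nonneg (hβ : 0 < β) (hα : ∀ j, 0 < α j) (L : Xsp d m → ℝ) :
    0 ≤ noiseSq β α L := by
  unfold noiseSq
  have := fun j => (hα j).le
  exact mul_nonneg (inv_nonneg.2 hβ.le) (Finset.sum_nonneg fun j _ =>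
    mul_nonneg (this j) (Finset.sum_nonneg fun k _ => sq_nonneg _))

lemma Reg.differentiableAt {φ : Xsp d m → ℝ} (h : Reg φ) (x : Xsp d m) :
    DifferentiableAt ℝ φ x := h.1.differentiable one_ne_zero x

lemma Reg.differentiableAt_pZ {φ : Xsp d m → ℝ} (h : Reg φ) (j : Fin m) (k : Fin d)
    (x : Xsp d m) : DifferentiableAt ℝ (pZ d m j k φ) x := (h.2 j k).differentiable one_ne_zero x

lemma pZ_add {φ ψ : Xsp d m → ℝ} (hφ : Reg φ) (hψ : Reg ψ) (j : Fin m) (k : Fin d) :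
    pZ d m j k (fun x => φ x + ψ x) = fun x => pZ d m j k φ x + pZ d m j k ψ x := by
  ext x
  simp only [pZ]
  rw [fderiv_fun_add (hφ.differentiableAt x) (hψ.differentiableAt x)]; rfl

lemma Reg.add {φ ψ : Xsp d m → ℝ} (hφ : Reg φ) (hψ : Reg ψ) : Reg fun x => φ x + ψ x := by
  refine ⟨hφ.1.add hψ.1, fun j k => ?_⟩
  rw [pZ_add hφ hψ]
  exact (hφ.2 j k).add (hψ.2 j k)

lemma backOp_add {φ ψ : Xsp d m → ℝ} (hφ : Reg φ) (hψ : Reg ψ) (x : Xsp d m) :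
    backOp β α lam V (fun x => φ x + ψ x) x = backOp β α lam V φ x + backOp β α lam V ψ x := by
  simp only [backOp, pZ_add hφ hψ]
  rw [fderiv_fun_add (hφ.differentiableAt x) (hψ.differentiableAt x)]
  simp only [fderiv_fun_add (hφ.differentiableAt_pZ _ _ x) (hψ.differentiableAt_pZ _ _ x),
    add_apply, Finset.sum_add_distrib, mul_add]
  ring

lemma pZ_const_mul {φ : Xsp d m → ℝ} (hφ : Reg φ) (c : ℝ) (j : Fin m) (k : Fin d) :
    pZ d m j k (fun x => c * φ x) = fun x => c * pZ d m j k φ x := by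
  ext x
  simp only [pZ]
  rw [fderiv_const_mul (hφ.differentiableAt x)]; rfl

lemma Reg.const_mul {φ : Xsp d m → ℝ} (hφ : Reg φ) (c : ℝ) : Reg fun x => c * φ x := by
  refine ⟨contDiff_const.mul hφ.1, fun j k => ?_⟩
  rw [pZ_const_mul hφ]
  exact contDiff_const.mul (hφ.2 j k)

lemma backOp_const_mul {φ : Xsp d m → ℝ} (hφ : Reg φ) (c : ℝ) (x : Xsp d m) :
    backOp β α lam V (fun x => c * φ x) x = c * backOp β α lam V φ x := by
  simp only [backOp, pZ_const_mul hφ]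
  rw [fderiv_const_mul (hφ.differentiableAt x)]
  simp only [fderiv_const_mul (hφ.differentiableAt_pZ _ _ x), smul_apply, smul_eq_mul,
    ← Finset.mul_sum]
  simp only [Finset.mul_sum, mul_add]
  congr 1
  refine Finset.sum_congr rfl fun j _ => Finset.sum_congr rfl fun k _ => ?_
  ring

lemma reg_const (c : ℝ) : Reg fun _ : Xsp d m => c := by
  refine ⟨contDiff_const, fun j k => ?_⟩
  have : pZ d m j k (fun _ => c) = fun _ => 0 := by ext x; simp [pZ]
  rw [this]; exact contDiff_const

lemma backOp_const (c : ℝ) (x : Xsp d m) : backOp β α lam V (fun _ => c) x = 0 := by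
  have : ∀ j k, pZ d m j k (fun _ => c) = fun _ => 0 := by intro j k; ext x; simp [pZ]
  simp [backOp, this]

lemma reg_sum_and_backOp {ι : Type*} (s : Finset ι) {φ : ι → Xsp d m → ℝ} (h : ∀ i, Reg (φ i)) :
    Reg (fun x => ∑ i ∈ s, φ i x) ∧ ∀ x,
      backOp β α lam V (fun x => ∑ i ∈ s, φ i x) x = ∑ i ∈ s, backOp β α lam V (φ i) x := by
  classical
  induction s using Finset.induction_on with
  | empty =>
    simp only [Finset.sum_empty]
    exact ⟨reg_const 0, fun x => backOp_const 0 x⟩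
  | insert a s ha ih =>
    simp only [Finset.sum_insert ha]
    exact ⟨(h a).add ih.1, fun x => by rw [backOp_add (h a) ih.1, ih.2]⟩

lemma weighted_sum_linear (a b c : ℝ) (F G H : Fin m → Fin d → ℝ) :
    β⁻¹ * ∑ j, α j * ∑ k, (a * F j k + b * G j k + c * H j k) =
      a * (β⁻¹ * ∑ j, α j * ∑ k, F j k) + b * (β⁻¹ * ∑ j, α j * ∑ k, G j k) +
        c * (β⁻¹ * ∑ j, α j * ∑ k, H j k) := by
  simp only [Finset.mul_sum, ← Finset.sum_add_distrib]
  refine Finset.sum_congr rfl fun j _ => Finset.sum_congr rfl fun k _ => ?_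
  ring

lemma hasFDerivAt_quot {G u : Xsp d m → ℝ} {x : Xsp d m} (hG : DifferentiableAt ℝ G x)
    (hu : DifferentiableAt ℝ u x) (h0 : u x ≠ 0) :
    HasFDerivAt (fun y => G y / u y)
      ((u x)⁻¹ • (fderiv ℝ G x - (G x / u x) • fderiv ℝ u x)) x := by
  have h := hG.hasFDerivAt.mul ((hasDerivAt_inv h0).comp_hasFDerivAt x hu.hasFDerivAt)
  change HasFDerivAt (fun y => G y * (u y)⁻¹) _ x at h
  simp only [div_eq_mul_inv (G _) (u _)]
  convert! h using 1
  refine ContinuousLinearMap.ext fun v => ?_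
  simp
  field_simp
  ring

lemma fderiv_sq_div {G u : Xsp d m → ℝ} {x : Xsp d m} (hG : DifferentiableAt ℝ G x)
    (hu : DifferentiableAt ℝ u x) (h0 : u x ≠ 0) (v : Xsp d m) :
    fderiv ℝ (fun y => (G y) ^ 2 / u y) x v =
      2 * (G x / u x) * fderiv ℝ G x v - (G x / u x) ^ 2 * fderiv ℝ u x v := by
  have h := hasFDerivAt_quot (hG.pow 2) hu h0
  change HasFDerivAt (fun y => (G y) ^ 2 / u y) _ x at h
  rw [h.fderiv, fderiv_pow 2 hG]
  simp
  field_simp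

lemma Reg.sq_div {G u : Xsp d m → ℝ} (hG : Reg G) (hu : Reg u) (h0 : ∀ x, 0 < u x) :
    Reg fun x => (G x) ^ 2 / u x := by
  refine ⟨(hG.1.pow 2).div hu.1 fun x => (h0 x).ne', fun j k => ?_⟩
  have : pZ d m j k (fun x => (G x) ^ 2 / u x) = fun x =>
      2 * (G x / u x) * pZ d m j k G x - (G x / u x) ^ 2 * pZ d m j k u x := by
    ext x
    exact fderiv_sq_div (hG.differentiableAt x) (hu.differentiableAt x) (h0 x).ne' _
  rw [this]
  have h1 : ContDiff ℝ 1 fun x => G x / u x := hG.1.div hu.1 fun x => (h0 x).ne'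
  exact ((contDiff_const.mul h1).mul (hG.2 j k)).sub ((h1.pow 2).mul (hu.2 j k))

lemma backOp_sq_div {G u : Xsp d m → ℝ} (hG : Reg G) (hu : Reg u) (h0 : ∀ x, 0 < u x)
    (x : Xsp d m) :
    backOp β α lam V (fun x => (G x) ^ 2 / u x) x =
      2 * (G x / u x) * backOp β α lam V G x - (G x / u x) ^ 2 * backOp β α lam V u x +
      2 / u x * noiseSq β α (fun v => fderiv ℝ G x v - G x / u x * fderiv ℝ u x v) := by
  have hp : ∀ j k, pZ d m j k (fun x => (G x) ^ 2 / u x) = fun x =>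
      2 * (G x / u x) * pZ d m j k G x - (G x / u x) ^ 2 * pZ d m j k u x := by
    intro j k; ext x
    exact fderiv_sq_div (hG.differentiableAt x) (hu.differentiableAt x) (h0 x).ne' _
  have h2 : ∀ j k v, fderiv ℝ (fun x =>
      2 * (G x / u x) * pZ d m j k G x - (G x / u x) ^ 2 * pZ d m j k u x) x v =
      2 * (G x / u x) * fderiv ℝ (pZ d m j k G) x v - (G x / u x) ^ 2 * fderiv ℝ (pZ d m j k u) x v
      + 2 / u x * ((fderiv ℝ G x v - G x / u x * fderiv ℝ u x v) *
        (pZ d m j k G x - G x / u x * pZ d m j k u x)) := by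
    intro j k v
    have hq := hasFDerivAt_quot (hG.differentiableAt x) (hu.differentiableAt x) (h0 x).ne'
    have := ((hq.const_mul 2).mul (hG.differentiableAt_pZ j k x).hasFDerivAt).sub
      ((hq.pow 2).mul (hu.differentiableAt_pZ j k x).hasFDerivAt)
    change HasFDerivAt (fun x =>
      2 * (G x / u x) * pZ d m j k G x - (G x / u x) ^ 2 * pZ d m j k u x) _ x at this
    rw [this.fderiv]
    have := (h0 x).ne'
    simp
    field_simp
    ring
  simp only [backOp, hp, h2, noiseSq]
  rw [fderiv_sq_div (hG.differentiableAt x) (hu.differentiableAt x) (h0 x).ne']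
  have e := weighted_sum_linear (β := β) (α := α) (2 * (G x / u x)) (-(G x / u x) ^ 2) (2 / u x)
    (fun j k => fderiv ℝ (pZ d m j k G) x (zdir d m j (Pi.single k 1)))
    (fun j k => fderiv ℝ (pZ d m j k u) x (zdir d m j (Pi.single k 1)))
    (fun j k => (fderiv ℝ G x (zdir d m j (Pi.single k 1)) -
      G x / u x * fderiv ℝ u x (zdir d m j (Pi.single k 1))) ^ 2)
  simp only [neg_mul, ← sub_eq_add_neg] at e
  simp only [pZ, ← sq] at e ⊢
  rw [e]
  ring

lemma fderiv_mul_log {u : Xsp d m → ℝ} {x : Xsp d m}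
    (hu : DifferentiableAt ℝ u x) (h0 : 0 < u x) (v : Xsp d m) :
    fderiv ℝ (fun y => u y * log (u y)) x v = (log (u x) + 1) * fderiv ℝ u x v := by
  have h := hu.hasFDerivAt.mul (hu.hasFDerivAt.log h0.ne')
  change HasFDerivAt (fun y => u y * log (u y)) _ x at h
  rw [h.fderiv]
  simp
  field_simp
  ring

lemma Reg.mul_log {u : Xsp d m → ℝ} (hu : Reg u) (h0 : ∀ x, 0 < u x) :
    Reg fun x => u x * log (u x) := by
  have hl : ContDiff ℝ 1 fun x => log (u x) := hu.1.log fun x => (h0 x).ne'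
  refine ⟨hu.1.mul hl, fun j k => ?_⟩
  have : pZ d m j k (fun x => u x * log (u x)) = fun x => (log (u x) + 1) * pZ d m j k u x := by
    ext x
    exact fderiv_mul_log (hu.differentiableAt x) (h0 x) _
  rw [this]
  exact (hl.add contDiff_const).mul (hu.2 j k)

lemma backOp_mul_log {u : Xsp d m → ℝ} (hu : Reg u) (h0 : ∀ x, 0 < u x) (x : Xsp d m) :
    backOp β α lam V (fun x => u x * log (u x)) x =
      (log (u x) + 1) * backOp β α lam V u x + 1 / u x * noiseSq β α (fderiv ℝ u x) := by
  have hp : ∀ j k, pZ d m j k (fun x => u x * log (u x)) =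
      fun x => (log (u x) + 1) * pZ d m j k u x := by
    intro j k; ext x
    exact fderiv_mul_log (hu.differentiableAt x) (h0 x) _
  have h2 : ∀ j k v, fderiv ℝ (fun x => (log (u x) + 1) * pZ d m j k u x) x v =
      (log (u x) + 1) * fderiv ℝ (pZ d m j k u) x v +
      1 / u x * (fderiv ℝ u x v * pZ d m j k u x) := by
    intro j k v
    have := (((hu.differentiableAt x).hasFDerivAt.log (h0 x).ne').add_const 1).mul
      (hu.differentiableAt_pZ j k x).hasFDerivAt
    change HasFDerivAt (fun x => (log (u x) + 1) * pZ d m j k u x) _ x at this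
    rw [this.fderiv]
    simp
    ring
  simp only [backOp, hp, h2, noiseSq]
  rw [fderiv_mul_log (hu.differentiableAt x) (h0 x)]
  have e := weighted_sum_linear (β := β) (α := α) (log (u x) + 1) (1 / u x) 0
    (fun j k => fderiv ℝ (pZ d m j k u) x (zdir d m j (Pi.single k 1)))
    (fun j k => (fderiv ℝ u x (zdir d m j (Pi.single k 1))) ^ 2) (fun _ _ => 0)
  simp only [zero_mul, add_zero] at e
  simp only [pZ, ← sq] at e ⊢
  rw [e]
  ring

end

section

variable {d m : ℕ} {β : ℝ} {α lam : Fin m → ℝ} {V : (Fin d → ℝ) → ℝ}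

lemma hasFDerivAt_fderiv_of_contDiff {E : Type*} [NormedAddCommGroup E] [NormedSpace ℝ E]
    {φ : E → ℝ} (hφ : ContDiff ℝ 2 φ) (x : E) :
    HasFDerivAt (fderiv ℝ φ) (fderiv ℝ (fderiv ℝ φ) x) x :=
  ((hφ.fderiv_right (m := 1) (by norm_num)).differentiable one_ne_zero x).hasFDerivAt

lemma fderiv_fderiv_apply {E : Type*} [NormedAddCommGroup E] [NormedSpace ℝ E]
    {φ : E → ℝ} (hφ : ContDiff ℝ 2 φ) (x v w : E) :
    fderiv ℝ (fun y => fderiv ℝ φ y w) x v = fderiv ℝ (fderiv ℝ φ) x v w := by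
  have h := (hasFDerivAt_fderiv_of_contDiff hφ x).clm_apply (hasFDerivAt_const w x)
  rw [h.fderiv]; simp

lemma fderiv_fderiv_comm {E : Type*} [NormedAddCommGroup E] [NormedSpace ℝ E]
    {φ : E → ℝ} (hφ : ContDiff ℝ 2 φ) (x v w : E) :
    fderiv ℝ (fun y => fderiv ℝ φ y w) x v = fderiv ℝ (fun y => fderiv ℝ φ y v) x w := by
  rw [fderiv_fderiv_apply hφ, fderiv_fderiv_apply hφ]
  exact (hφ.contDiffAt.isSymmSndFDerivAt (by simp)).eq v w

lemma contDiff_fderiv_apply {E : Type*} [NormedAddCommGroup E] [NormedSpace ℝ E]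
    {φ : E → ℝ} (hφ : ContDiff ℝ 2 φ) (w : E) : ContDiff ℝ 1 fun y => fderiv ℝ φ y w :=
  (hφ.fderiv_right (m := 1) (by norm_num)).clm_apply contDiff_const

lemma contDiff_drift (hV : ContDiff ℝ 2 V) :
    ContDiff ℝ 1 (drift (d := d) (m := m) α lam V) := by
  have h : ∀ i : Fin d, ContDiff ℝ 1 fun x : Xsp d m => fderiv ℝ V x.1 (Pi.single i 1) := fun i =>
    (contDiff_fderiv_apply hV _).comp contDiff_fst
  have h2 : ContDiff ℝ 1 fun x : Xsp d m => fun i => fderiv ℝ V x.1 (Pi.single i 1) :=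
    contDiff_pi.2 h
  unfold drift
  fun_prop

/-- The part of the regularity of a solution at a fixed time that allows to differentiate the
equation once in space. -/
def RegTwo (φ : Xsp d m → ℝ) : Prop := ContDiff ℝ 2 φ ∧ ∀ j k, ContDiff ℝ 2 (pZ d m j k φ)

lemma RegTwo.reg {φ : Xsp d m → ℝ} (h : RegTwo φ) : Reg φ :=
  ⟨h.1.of_le (by norm_num), fun j k => (h.2 j k).of_le (by norm_num)⟩

lemma RegTwo.pZ_fderiv {φ : Xsp d m → ℝ} (h : RegTwo φ) (w : Xsp d m) (j : Fin m) (k : Fin d) :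
    pZ d m j k (fun y => fderiv ℝ φ y w) = fun y => fderiv ℝ (pZ d m j k φ) y w := by
  ext x
  exact fderiv_fderiv_comm h.1 x _ w

lemma RegTwo.reg_fderiv {φ : Xsp d m → ℝ} (h : RegTwo φ) (w : Xsp d m) :
    Reg fun y => fderiv ℝ φ y w := by
  refine ⟨contDiff_fderiv_apply h.1 w, fun j k => ?_⟩
  rw [h.pZ_fderiv]
  exact contDiff_fderiv_apply (h.2 j k) w

lemma RegTwo.fderiv_backOp (hV : ContDiff ℝ 2 V) {φ : Xsp d m → ℝ} (h : RegTwo φ)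
    (x w : Xsp d m) :
    fderiv ℝ (backOp β α lam V φ) x w =
      backOp β α lam V (fun y => fderiv ℝ φ y w) x +
        fderiv ℝ φ x (fderiv ℝ (drift α lam V) x w) := by
  have h1 := (hasFDerivAt_fderiv_of_contDiff h.1 x).clm_apply
    ((contDiff_drift (α := α) (lam := lam) hV).differentiable one_ne_zero x).hasFDerivAt
  have h2 : ∀ j k, HasFDerivAt
      (fun y => fderiv ℝ (pZ d m j k φ) y (zdir d m j (Pi.single k 1)))
      (fderiv ℝ (fun y => fderiv ℝ (pZ d m j k φ) y (zdir d m j (Pi.single k 1))) x) x :=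
    fun j k => ((contDiff_fderiv_apply (h.2 j k) _).differentiable one_ne_zero x).hasFDerivAt
  have h3 := h1.add ((HasFDerivAt.fun_sum (u := Finset.univ) fun j _ =>
    (HasFDerivAt.fun_sum (u := Finset.univ) fun k _ => h2 j k).const_mul (α j)).const_mul β⁻¹)
  change HasFDerivAt (backOp β α lam V φ) _ x at h3
  rw [h3.fderiv]
  simp only [backOp, h.pZ_fderiv]
  rw [fderiv_fderiv_apply h.1]
  simp [add_apply, smul_apply]
  rw [(h.1.contDiffAt.isSymmSndFDerivAt (by simp)).eq w]
  simp only [fun j k => fderiv_fderiv_comm (h.2 j k) x w (zdir d m j (Pi.single k 1))]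
  ring

/-- Solutions of the backward equation bounded below by `δ`. -/
structure Sol (β : ℝ) (α lam : Fin m → ℝ) (V : (Fin d → ℝ) → ℝ) (δ : ℝ)
    (u : ℝ → Xsp d m → ℝ) : Prop where
  smooth : ContDiff ℝ 2 fun p : ℝ × Xsp d m => u p.1 p.2
  smooth_pZ : ∀ j k, ContDiff ℝ 2 fun p : ℝ × Xsp d m => pZ d m j k (u p.1) p.2
  lower : ∀ t x, 0 ≤ t → δ ≤ u t x
  per : ∀ t, 0 ≤ t → PerQ d m (u t)
  eq : ∀ t x, 0 ≤ t → deriv (fun s => u s x) t = backOp β α lam V (u t) x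

namespace Sol

variable {δ : ℝ} {u : ℝ → Xsp d m → ℝ}

lemma regTwo (h : Sol β α lam V δ u) (t : ℝ) : RegTwo (u t) :=
  ⟨h.smooth.comp (contDiff_const.prodMk contDiff_id), fun j k =>
    (h.smooth_pZ j k).comp (contDiff_const.prodMk contDiff_id)⟩

lemma fderiv_eq (h : Sol β α lam V δ u) (t : ℝ) (x v : Xsp d m) :
    fderiv ℝ (u t) x v = fderiv ℝ (fun p : ℝ × Xsp d m => u p.1 p.2) (t, x) (0, v) := by
  have h1 := (h.smooth.differentiable two_ne_zero (t, x)).hasFDerivAt.comp x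
    (((hasFDerivAt_const t x).prodMk (hasFDerivAt_id x)))
  change HasFDerivAt (u t) _ x at h1
  rw [h1.fderiv]; simp

lemma deriv_eq (h : Sol β α lam V δ u) (t : ℝ) (x : Xsp d m) :
    deriv (fun s => u s x) t = fderiv ℝ (fun p : ℝ × Xsp d m => u p.1 p.2) (t, x) (1, 0) := by
  have h1 := (h.smooth.differentiable two_ne_zero (t, x)).hasFDerivAt.comp_hasDerivAt t
    ((hasDerivAt_id t).prodMk (hasDerivAt_const t x))
  change HasDerivAt (fun s => u s x) _ t at h1
  rw [h1.deriv]

lemma hasDerivAt (h : Sol β α lam V δ u) {t : ℝ} (ht : 0 ≤ t) (x : Xsp d m) :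
    HasDerivAt (fun s => u s x) (backOp β α lam V (u t) x) t := by
  rw [← h.eq t x ht]
  have h1 := (h.smooth.differentiable two_ne_zero (t, x)).hasFDerivAt.comp_hasDerivAt t
    ((hasDerivAt_id t).prodMk (hasDerivAt_const t x))
  change HasDerivAt (fun s => u s x) _ t at h1
  exact h1.differentiableAt.hasDerivAt

lemma hasDerivAt_fderiv (h : Sol β α lam V δ u) (hV : ContDiff ℝ 2 V) {t : ℝ} (ht : 0 ≤ t)
    (x : Xsp d m) {w : ℝ → Xsp d m} {w' : Xsp d m} (hw : HasDerivAt w w' t) :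
    HasDerivAt (fun s => fderiv ℝ (u s) x (w s))
      (backOp β α lam V (fun y => fderiv ℝ (u t) y (w t)) x +
        fderiv ℝ (u t) x (w' + fderiv ℝ (drift α lam V) x (w t))) t := by
  set U : ℝ × Xsp d m → ℝ := fun p => u p.1 p.2 with hU
  have h1 : HasDerivAt (fun s => fderiv ℝ U (s, x)) (fderiv ℝ (fderiv ℝ U) (t, x) (1, 0)) t :=
    (hasFDerivAt_fderiv_of_contDiff h.smooth (t, x)).comp_hasDerivAt t
      ((hasDerivAt_id t).prodMk (hasDerivAt_const t x))
  have h2 := h1.clm_apply ((hasDerivAt_const t (0 : ℝ)).prodMk hw)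
  have h3 : fderiv ℝ (fderiv ℝ U) (t, x) (1, 0) (0, w t) =
      fderiv ℝ (backOp β α lam V (u t)) x (w t) := by
    rw [(h.smooth.contDiffAt.isSymmSndFDerivAt (by simp)).eq, ← fderiv_fderiv_apply h.smooth]
    have h4 : backOp β α lam V (u t) = fun y => fderiv ℝ U (t, y) (1, 0) := by
      ext y
      rw [← h.eq t y ht, h.deriv_eq]
    rw [h4]
    have h5 := ((contDiff_fderiv_apply h.smooth ((1, 0) : ℝ × Xsp d m)).differentiable
      one_ne_zero (t, x)).hasFDerivAt.comp x ((hasFDerivAt_const t x).prodMk (hasFDerivAt_id x))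
    change HasFDerivAt (fun y => fderiv ℝ U (t, y) (1, 0)) _ x at h5
    rw [h5.fderiv]; simp
  have h6 : (fun s => fderiv ℝ (u s) x (w s)) = fun s => fderiv ℝ U (s, x) (0, w s) := by
    ext s; exact h.fderiv_eq s x _
  rw [h6]
  convert! h2 using 1
  rw [h3, (h.regTwo t).fderiv_backOp hV, ← h.fderiv_eq, map_add]
  ring

end Sol

/-- The pointwise density of the modified entropy: the entropy density plus a weighted sum of
squares of directional derivatives. -/
def modEnt {ι : Type*} [Fintype ι] (c : ι → ℝ) (w : ι → Xsp d m) (φ : Xsp d m → ℝ)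
    (x : Xsp d m) : ℝ :=
  φ x * log (φ x) + ∑ a, c a * ((fderiv ℝ φ x (w a)) ^ 2 / φ x)

lemma RegTwo.reg_modEnt {ι : Type*} [Fintype ι] {φ : Xsp d m → ℝ} (h : RegTwo φ)
    (h0 : ∀ x, 0 < φ x) (c : ι → ℝ) (w : ι → Xsp d m) : Reg (modEnt c w φ) :=
  (h.reg.mul_log h0).add (reg_sum_and_backOp (β := 1) (α := 0) (lam := 0) (V := 0) Finset.univ
    fun a => ((h.reg_fderiv (w a)).sq_div h.reg h0).const_mul (c a)).1

lemma RegTwo.backOp_modEnt {ι : Type*} [Fintype ι] {φ : Xsp d m → ℝ} (h : RegTwo φ)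
    (h0 : ∀ x, 0 < φ x) (c : ι → ℝ) (w : ι → Xsp d m) (x : Xsp d m) :
    backOp β α lam V (modEnt c w φ) x =
      (log (φ x) + 1) * backOp β α lam V φ x + 1 / φ x * noiseSq β α (fderiv ℝ φ x) +
      ∑ a, c a * (2 * (fderiv ℝ φ x (w a) / φ x) * backOp β α lam V (fun y => fderiv ℝ φ y (w a)) x
        - (fderiv ℝ φ x (w a) / φ x) ^ 2 * backOp β α lam V φ x +
        2 / φ x * noiseSq β α (fun v => fderiv ℝ (fun y => fderiv ℝ φ y (w a)) x v -
          fderiv ℝ φ x (w a) / φ x * fderiv ℝ φ x v)) := by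
  have h1 : ∀ a, Reg fun y => c a * ((fderiv ℝ φ y (w a)) ^ 2 / φ y) := fun a =>
    ((h.reg_fderiv (w a)).sq_div h.reg h0).const_mul (c a)
  have h2 := reg_sum_and_backOp (β := β) (α := α) (lam := lam) (V := V) Finset.univ h1
  have h3 := backOp_add (β := β) (α := α) (lam := lam) (V := V) (h.reg.mul_log h0) h2.1 x
  change backOp β α lam V (modEnt c w φ) x = _ at h3
  rw [h3, backOp_mul_log h.reg h0, h2.2]
  congr 1
  refine Finset.sum_congr rfl fun a _ => ?_
  rw [backOp_const_mul ((h.reg_fderiv (w a)).sq_div h.reg h0),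
    backOp_sq_div (h.reg_fderiv (w a)) h.reg h0]

/-- The time derivative of the modified entropy density along a solution. -/
def modEntDot {ι : Type*} [Fintype ι] (β : ℝ) (α lam : Fin m → ℝ) (V : (Fin d → ℝ) → ℝ)
    (c c' : ι → ℝ) (w w' : ι → Xsp d m) (φ : Xsp d m → ℝ) (x : Xsp d m) : ℝ :=
  (log (φ x) + 1) * backOp β α lam V φ x + ∑ a, (c' a * ((fderiv ℝ φ x (w a)) ^ 2 / φ x) +
    c a * (2 * (fderiv ℝ φ x (w a) / φ x) * (backOp β α lam V (fun y => fderiv ℝ φ y (w a)) x +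
      fderiv ℝ φ x (w' a + fderiv ℝ (drift α lam V) x (w a))) -
      (fderiv ℝ φ x (w a) / φ x) ^ 2 * backOp β α lam V φ x))

lemma Sol.hasDerivAt_modEnt {ι : Type*} [Fintype ι] {δ : ℝ} {u : ℝ → Xsp d m → ℝ}
    (h : Sol β α lam V δ u) (hδ : 0 < δ) (hV : ContDiff ℝ 2 V) {c : ι → ℝ → ℝ} {c' : ι → ℝ}
    {w : ι → ℝ → Xsp d m} {w' : ι → Xsp d m} {t : ℝ} (ht : 0 ≤ t)
    (hc : ∀ a, HasDerivAt (c a) (c' a) t) (hw : ∀ a, HasDerivAt (w a) (w' a) t) (x : Xsp d m) :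
    HasDerivAt (fun s => modEnt (fun a => c a s) (fun a => w a s) (u s) x)
      (modEntDot β α lam V (fun a => c a t) c' (fun a => w a t) w' (u t) x) t := by
  have hu : u t x ≠ 0 := (hδ.trans_le (h.lower t x ht)).ne'
  have h1 := h.hasDerivAt ht x
  have h2 := h1.mul (h1.log hu)
  have h3 : ∀ a, HasDerivAt (fun s => c a s * ((fderiv ℝ (u s) x (w a s)) ^ 2 / u s x)) _ t :=
    fun a => (hc a).mul (((h.hasDerivAt_fderiv hV ht x (hw a)).pow 2).div h1 hu)
  have h4 := h2.add (HasDerivAt.fun_sum (u := Finset.univ) fun a _ => h3 a)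
  convert! h4 using 1
  unfold modEntDot
  congr 1
  · field_simp
  · refine Finset.sum_congr rfl fun a _ => ?_
    simp only [Pi.pow_apply, Nat.cast_ofNat, Nat.add_one_sub_one, pow_one]
    field_simp

lemma modEntDot_le {ι : Type*} [Fintype ι] (hβ : 0 < β) (hα : ∀ j, 0 < α j)
    {φ : Xsp d m → ℝ} (h : RegTwo φ) (h0 : ∀ x, 0 < φ x) {c : ι → ℝ} (hc : ∀ a, 0 ≤ c a)
    (c' : ι → ℝ) (w w' : ι → Xsp d m) (x : Xsp d m) :
    modEntDot β α lam V c c' w w' φ x ≤ backOp β α lam V (modEnt c w φ) x +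
      1 / φ x * (-noiseSq β α (fderiv ℝ φ x) + ∑ a, (c' a * (fderiv ℝ φ x (w a)) ^ 2 +
        2 * c a * fderiv ℝ φ x (w a) *
          fderiv ℝ φ x (w' a + fderiv ℝ (drift α lam V) x (w a)))) := by
  rw [h.backOp_modEnt h0]
  unfold modEntDot
  have key : ∀ a, (c' a * ((fderiv ℝ φ x (w a)) ^ 2 / φ x) +
    c a * (2 * (fderiv ℝ φ x (w a) / φ x) * (backOp β α lam V (fun y => fderiv ℝ φ y (w a)) x +
      fderiv ℝ φ x (w' a + fderiv ℝ (drift α lam V) x (w a))) -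
      (fderiv ℝ φ x (w a) / φ x) ^ 2 * backOp β α lam V φ x)) ≤
      c a * (2 * (fderiv ℝ φ x (w a) / φ x) * backOp β α lam V (fun y => fderiv ℝ φ y (w a)) x
        - (fderiv ℝ φ x (w a) / φ x) ^ 2 * backOp β α lam V φ x +
        2 / φ x * noiseSq β α (fun v => fderiv ℝ (fun y => fderiv ℝ φ y (w a)) x v -
          fderiv ℝ φ x (w a) / φ x * fderiv ℝ φ x v)) +
      1 / φ x * (c' a * (fderiv ℝ φ x (w a)) ^ 2 + 2 * c a * fderiv ℝ φ x (w a) *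
          fderiv ℝ φ x (w' a + fderiv ℝ (drift α lam V) x (w a))) := by
    intro a
    have h1 : 0 ≤ c a * (2 / φ x * noiseSq β α (fun v =>
        fderiv ℝ (fun y => fderiv ℝ φ y (w a)) x v - fderiv ℝ φ x (w a) / φ x * fderiv ℝ φ x v)) :=
      mul_nonneg (hc a) (mul_nonneg (div_nonneg zero_le_two (h0 x).le) (noiseSq_nonneg hβ hα _))
    have := (h0 x).ne'
    rw [← sub_nonneg]
    convert! h1 using 1
    field_simp
    ring
  have := Finset.sum_le_sum fun a (_ : a ∈ Finset.univ) => key a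
  rw [Finset.sum_add_distrib (f := fun a => c a * _), ← Finset.mul_sum] at this
  rw [mul_add]
  linarith

end

section

variable {d m : ℕ} {β : ℝ} {α lam : Fin m → ℝ} {V : (Fin d → ℝ) → ℝ}

lemma fderiv_drift_apply (hV : ContDiff ℝ 2 V) (x v : Xsp d m) :
    fderiv ℝ (drift α lam V) x v =
      (-v.2.1, (fun i => fderiv ℝ (fun q => fderiv ℝ V q (Pi.single i 1)) x.1 v.1) -
        ∑ j, lam j • v.2.2 j, fun j => lam j • v.2.1 - α j • v.2.2 j) := by
  have h1 : ∀ i, HasFDerivAt (fun y : Xsp d m => fderiv ℝ V y.1 (Pi.single i 1))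
      ((fderiv ℝ (fun q => fderiv ℝ V q (Pi.single i 1)) x.1).comp
        (ContinuousLinearMap.fst ℝ _ _)) x := fun i =>
    ((contDiff_fderiv_apply hV _).differentiable one_ne_zero x.1).hasFDerivAt.comp x hasFDerivAt_fst
  have hq := hasFDerivAt_pi.2 h1
  have hp : HasFDerivAt (fun y : Xsp d m => y.2.1)
    ((ContinuousLinearMap.fst ℝ _ _).comp (ContinuousLinearMap.snd ℝ _ _)) x :=
    ContinuousLinearMap.hasFDerivAt
      ((ContinuousLinearMap.fst ℝ (Fin d → ℝ) (Fin m → Fin d → ℝ)).comp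
        (ContinuousLinearMap.snd ℝ (Fin d → ℝ) _))
  have hz : ∀ j, HasFDerivAt (fun y : Xsp d m => y.2.2 j)
    ((ContinuousLinearMap.proj (R := ℝ) (φ := fun _ : Fin m => Fin d → ℝ) j).comp
      ((ContinuousLinearMap.snd ℝ (Fin d → ℝ) (Fin m → Fin d → ℝ)).comp
        (ContinuousLinearMap.snd ℝ (Fin d → ℝ) _))) x := fun j =>
    ContinuousLinearMap.hasFDerivAt
      ((ContinuousLinearMap.proj (R := ℝ) (φ := fun _ : Fin m => Fin d → ℝ) j).comp
        ((ContinuousLinearMap.snd ℝ (Fin d → ℝ) (Fin m → Fin d → ℝ)).comp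
          (ContinuousLinearMap.snd ℝ (Fin d → ℝ) _)))
  have h := hp.neg.prodMk ((hq.sub (HasFDerivAt.fun_sum (u := Finset.univ)
    fun j _ => (hz j).const_smul (lam j))).prodMk
    (hasFDerivAt_pi.2 fun j => (hp.const_smul (lam j)).sub ((hz j).const_smul (α j))))
  change HasFDerivAt (drift α lam V) _ x at h
  rw [h.fderiv]
  ext i
  · simp
  · simp
  · simp

lemma exists_hessian_bound (hV : ContDiff ℝ 2 V) (hVper : PerV d V) :
    ∃ M : ℝ, ∀ q i k,
      |fderiv ℝ (fun q => fderiv ℝ V q (Pi.single k 1)) q (Pi.single i 1)| ≤ M := by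
  have hper : ∀ (g : (Fin d → ℝ) → ℝ), PerV d g → ∀ v, PerV d fun q => fderiv ℝ g q v := by
    intro g hg v k q
    have : (fun q => g (q + fun i => (k i : ℝ))) = g := funext fun q => hg k q
    change fderiv ℝ g (q + fun i => (k i : ℝ)) v = fderiv ℝ g q v
    rw [← fderiv_comp_add_right, this]
  have hcont : Continuous fun q => ∑ i, ∑ k,
      |fderiv ℝ (fun q => fderiv ℝ V q (Pi.single k 1)) q (Pi.single i 1)| :=
    continuous_finsetSum _ fun i _ => continuous_finsetSum _ fun k _ =>
      (((contDiff_fderiv_apply hV (Pi.single k 1)).continuous_fderiv one_ne_zero).clm_apply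
        continuous_const).abs
  obtain ⟨M, hM⟩ := (isCompact_Icc (a := (0 : Fin d → ℝ)) (b := 1)).exists_bound_of_continuousOn
    hcont.continuousOn
  refine ⟨M, fun q i k => ?_⟩
  have h1 := hper _ (hper V hVper (Pi.single k 1)) (Pi.single i 1) (fun i => -⌊q i⌋) q
  simp only at h1
  rw [← h1]
  have h2 := hM (q + fun i => ((-⌊q i⌋ : ℤ) : ℝ))
    ⟨fun i => by simpa using Int.floor_le (q i), fun i => by
      have := (Int.lt_floor_add_one (q i)).le; simp; linarith⟩
  refine le_trans ?_ (le_trans (le_abs_self _) h2)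
  refine le_trans ?_ (Finset.single_le_sum (f := fun i => ∑ k, |fderiv ℝ (fun q => fderiv ℝ V q
    (Pi.single k 1)) (q + fun i => ((-⌊q i⌋ : ℤ) : ℝ)) (Pi.single i 1)|)
    (fun i _ => Finset.sum_nonneg fun k _ => abs_nonneg _) (Finset.mem_univ i))
  exact Finset.single_le_sum (f := fun k => |fderiv ℝ (fun q => fderiv ℝ V q
    (Pi.single k 1)) (q + fun i => ((-⌊q i⌋ : ℤ) : ℝ)) (Pi.single i 1)|)
    (fun k _ => abs_nonneg _) (Finset.mem_univ k)

set_option maxHeartbeats 1000000 in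
/-- The scalar inequality behind hypocoercivity: with these powers of `ε`, all undesired products
are of smaller order than the good squares. -/
lemma hypo_scalar {ε τ a l κ : ℝ} (hε : 0 ≤ ε) (hε1 : ε ≤ 1) (hτ : 0 ≤ τ) (hτ1 : τ ≤ 1)
    (ha : 0 ≤ a) (ha1 : a ≤ 1) (hl : 0 ≤ l) (hκ : 0 ≤ κ) (z Y W D N : ℝ) :
    ε ^ 10 * (a * (z + ε ^ 8 * Y) ^ 2 + 2 * a * ε ^ 8 * Y * (z + ε ^ 8 * Y) +
      2 * (z + ε ^ 8 * Y) * (-l * Y - κ * τ * z + ε ^ 8 * (-W + τ ^ 2 * D))) +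
    ε ^ 24 * (a * (Y + ε ^ 4 * W) ^ 2 + 2 * (Y + ε ^ 4 * W) *
      (a * Y + 2 * ε ^ 4 * a * W - W + τ ^ 2 * D + ε ^ 4 * τ ^ 2 * N)) +
    ε ^ 30 * (5 * a * W ^ 2 + 2 * τ ^ 2 * W * N) ≤
    -2 * l * (ε ^ 9 * Y) ^ 2 - 2 * (ε ^ 14 * W) ^ 2 +
      ε * ((60 + 6 * κ + 2 * l) *
        (z ^ 2 + D ^ 2 + (ε ^ 9 * Y) ^ 2 + (ε ^ 9 * N) ^ 2 + (ε ^ 14 * W) ^ 2)) := by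
  set y := ε ^ 9 * Y with hy
  set w := ε ^ 14 * W with hw
  set n := ε ^ 9 * N with hn
  set S := z ^ 2 + D ^ 2 + y ^ 2 + n ^ 2 + w ^ 2 with hS
  have key : ∀ c r p : ℝ, 0 ≤ r → r ≤ 1 → |p| ≤ S → c * r * p ≤ |c| * S := by
    intro c r p h0 h1 hp
    calc c * r * p ≤ |c * r * p| := le_abs_self _
      _ = |c| * (r * |p|) := by rw [abs_mul, abs_mul, abs_of_nonneg h0, mul_assoc]
      _ ≤ |c| * (1 * S) := by gcongr
      _ = |c| * S := by ring
  have hp : ∀ b c : ℝ, b ^ 2 + c ^ 2 ≤ 2 * S → |b * c| ≤ S := by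
    intro b c h
    rw [abs_le]
    constructor <;> nlinarith [sq_nonneg (b + c), sq_nonneg (b - c)]
  have hz2 := sq_nonneg z
  have hD2 := sq_nonneg D
  have hy2 := sq_nonneg y
  have hn2 := sq_nonneg n
  have hw2 := sq_nonneg w
  have pzz := hp z z (by linarith)
  have pzy := hp z y (by linarith)
  have pyy := hp y y (by linarith)
  have pzw := hp z w (by linarith)
  have pzD := hp z D (by linarith)
  have pyw := hp y w (by linarith)
  have pyD := hp y D (by linarith)
  have pww := hp w w (by linarith)
  have pwD := hp w D (by linarith)
  have pyn := hp y n (by linarith)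
  have pwn := hp w n (by linarith)
  have e0 : ∀ k, 0 ≤ ε ^ k := fun k => pow_nonneg hε k
  have e1 : ∀ k, ε ^ k ≤ 1 := fun k => pow_le_one₀ hε hε1
  have t0 : 0 ≤ τ ^ 2 := sq_nonneg τ
  have t1 : τ ^ 2 ≤ 1 := pow_le_one₀ hτ hτ1
  have m0 : ∀ s k, 0 ≤ s → 0 ≤ s * ε ^ k := fun s k h => mul_nonneg h (e0 k)
  have m1 : ∀ s k, s ≤ 1 → s * ε ^ k ≤ 1 := fun s k h => mul_le_one₀ h (e0 k) (e1 k)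
  have k1 := key 1 (a * ε ^ 9) (z * z) (m0 _ _ ha) (m1 _ _ ha1) pzz
  have k2 := key (-2 * κ) (τ * ε ^ 9) (z * z) (m0 _ _ hτ) (m1 _ _ hτ1) pzz
  have k3 := key 4 (a * ε ^ 8) (z * y) (m0 _ _ ha) (m1 _ _ ha1) pzy
  have k4 := key (-2 * κ) (τ * ε ^ 8) (z * y) (m0 _ _ hτ) (m1 _ _ hτ1) pzy
  have k5 := key (-2 * l) 1 (z * y) zero_le_one le_rfl pzy
  have k6 := key 3 (a * ε ^ 7) (y * y) (m0 _ _ ha) (m1 _ _ ha1) pyy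
  have k7 := key (-2) (ε ^ 3) (z * w) (e0 _) (e1 _) pzw
  have k8 := key 2 (τ ^ 2 * ε ^ 17) (z * D) (m0 _ _ t0) (m1 _ _ t1) pzD
  have k9 := key (-2) (ε ^ 2) (y * w) (e0 _) (e1 _) pyw
  have k10 := key 2 (τ ^ 2 * ε ^ 16) (y * D) (m0 _ _ t0) (m1 _ _ t1) pyD
  have k11 := key 3 (a * ε ^ 5) (y * y) (m0 _ _ ha) (m1 _ _ ha1) pyy
  have k12 := key 8 (a * ε ^ 4) (y * w) (m0 _ _ ha) (m1 _ _ ha1) pyw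
  have k13 := key (-2) 1 (y * w) zero_le_one le_rfl pyw
  have k14 := key 5 (a * ε ^ 3) (w * w) (m0 _ _ ha) (m1 _ _ ha1) pww
  have k15 := key 2 (τ ^ 2 * ε ^ 14) (y * D) (m0 _ _ t0) (m1 _ _ t1) pyD
  have k16 := key 2 (τ ^ 2 * ε ^ 13) (w * D) (m0 _ _ t0) (m1 _ _ t1) pwD
  have k17 := key 2 (τ ^ 2 * ε ^ 9) (y * n) (m0 _ _ t0) (m1 _ _ t1) pyn
  have k18 := key 2 (τ ^ 2 * ε ^ 8) (w * n) (m0 _ _ t0) (m1 _ _ t1) pwn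
  have k19 := key 5 (a * ε ^ 1) (w * w) (m0 _ _ ha) (m1 _ _ ha1) pww
  have k20 := key 2 (τ ^ 2 * ε ^ 6) (w * n) (m0 _ _ t0) (m1 _ _ t1) pwn
  have ek : |(-2 * κ)| = 2 * κ := by rw [neg_mul, abs_neg, abs_of_nonneg (by positivity)]
  have el : |(-2 * l)| = 2 * l := by rw [neg_mul, abs_neg, abs_of_nonneg (by positivity)]
  rw [ek] at k2 k4
  rw [el] at k5
  norm_num at k1 k3 k6 k7 k8 k9 k10 k11 k12 k13 k14 k15 k16 k17 k18 k19 k20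
  have hS0 : 0 ≤ S := by positivity
  have hκS := mul_nonneg hκ hS0
  have total := add_le_add (add_le_add (add_le_add (add_le_add (add_le_add (add_le_add k1 k2)
    (add_le_add k3 k4)) (add_le_add (add_le_add k5 k6) (add_le_add k7 k8)))
    (add_le_add (add_le_add k9 k10) (add_le_add k11 k12))) (add_le_add (add_le_add k13 k14)
    (add_le_add k15 k16))) (add_le_add (add_le_add k17 k18) (add_le_add k19 k20))
  have total2 := mul_le_mul_of_nonneg_left (total.trans (b := _) (c := (60 + 6 * κ + 2 * l) * S)
    (by nlinarith)) hε
  refine le_trans (le_of_eq ?_) (add_le_add_right total2 (-2 * l * y ^ 2 - 2 * w ^ 2))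
  rw [hy, hw, hn]
  ring

end

section

variable {d m : ℕ} {β : ℝ} {α lam : Fin m → ℝ} {V : (Fin d → ℝ) → ℝ}

lemma clm_apply_p (L : Xsp d m →L[ℝ] ℝ) (v : Fin d → ℝ) :
    L (0, v, 0) = ∑ k, v k * L (0, Pi.single k 1, 0) := by
  have : ((0, v, 0) : Xsp d m) = ∑ k, v k • ((0, Pi.single k 1, 0) : Xsp d m) := by
    ext i
    · simp [Prod.fst_sum]
    · simp [Prod.fst_sum, Prod.snd_sum, Finset.sum_apply, Pi.single_apply]
    · simp [Prod.snd_sum]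
  rw [this, map_sum]
  simp only [map_smul, smul_eq_mul]

lemma clm_apply_z (L : Xsp d m →L[ℝ] ℝ) (g : Fin m → Fin d → ℝ) :
    L (0, 0, g) = ∑ j, L (zdir d m j (g j)) := by
  have : ((0, 0, g) : Xsp d m) = ∑ j, zdir d m j (g j) := by
    ext i k
    · simp [Prod.fst_sum, zdir]
    · simp [Prod.fst_sum, Prod.snd_sum, zdir]
    · simp [Prod.snd_sum, zdir, Finset.sum_apply, Function.update_apply, ite_apply]
  rw [this, map_sum]

lemma zdir_smul (c : ℝ) (j : Fin m) (v : Fin d → ℝ) : zdir d m j (c • v) = c • zdir d m j v := by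
  ext i k
  · simp [zdir]
  · simp [zdir]
  · by_cases h : i = j
    · subst h; simp [zdir]
    · simp [zdir, h]

lemma clm_drift_q (hV : ContDiff ℝ 2 V) (L : Xsp d m →L[ℝ] ℝ) (x : Xsp d m) (i : Fin d) :
    L (fderiv ℝ (drift α lam V) x (Pi.single i 1, 0, 0)) =
      ∑ k, fderiv ℝ (fun q => fderiv ℝ V q (Pi.single k 1)) x.1 (Pi.single i 1) *
        L (0, Pi.single k 1, 0) := by
  rw [fderiv_drift_apply hV, ← clm_apply_p]
  congr 1
  ext <;> simp

lemma clm_drift_p (hV : ContDiff ℝ 2 V) (L : Xsp d m →L[ℝ] ℝ) (x : Xsp d m) (i : Fin d) :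
    L (fderiv ℝ (drift α lam V) x (0, Pi.single i 1, 0)) =
      -L (Pi.single i 1, 0, 0) + ∑ j, lam j * L (zdir d m j (Pi.single i 1)) := by
  have h : ∀ j, lam j * L (zdir d m j (Pi.single i 1)) =
      L (zdir d m j (lam j • Pi.single i 1)) := by
    intro j; rw [zdir_smul, map_smul, smul_eq_mul]
  have h2 : L (0, 0, fun j => lam j • Pi.single i 1) =
      ∑ j, L (zdir d m j (lam j • Pi.single i 1)) := clm_apply_z L _
  simp only [h]
  rw [fderiv_drift_apply hV, ← h2, ← map_neg, ← map_add]
  congr 1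
  ext <;> simp

lemma clm_drift_z (hV : ContDiff ℝ 2 V) (L : Xsp d m →L[ℝ] ℝ) (x : Xsp d m) (j : Fin m)
    (i : Fin d) :
    L (fderiv ℝ (drift α lam V) x (zdir d m j (Pi.single i 1))) =
      -lam j * L (0, Pi.single i 1, 0) - α j * L (zdir d m j (Pi.single i 1)) := by
  rw [fderiv_drift_apply hV, ← smul_eq_mul, ← smul_eq_mul, ← map_smul, ← map_smul, ← map_sub]
  congr 1
  ext a b
  · simp [zdir]
  · by_cases h : a = i
    · subst h; simp [zdir, Function.update_apply]
    · simp [zdir, Function.update_apply, h]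
  · by_cases h : a = j
    · subst h; simp [zdir]
    · simp [zdir, h]

/-- Weights of the three families of squares in the modified entropy. -/
def hypoC (ε τ : ℝ) (a : Fin d × Fin 3) : ℝ := ![ε ^ 10 * τ, ε ^ 24 * τ, ε ^ 30 * τ] a.2

/-- The directions of differentiation in the modified entropy. -/
def hypoW (j₀ : Fin m) (ε τ : ℝ) (a : Fin d × Fin 3) : Xsp d m :=
  ![zdir d m j₀ (Pi.single a.1 1) + (ε ^ 8 * τ) • ((0, Pi.single a.1 1, 0) : Xsp d m),
    τ • ((0, Pi.single a.1 1, 0) : Xsp d m) +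
      (ε ^ 4 * τ ^ 2) • ((Pi.single a.1 1, 0, 0) : Xsp d m),
    τ ^ 2 • ((Pi.single a.1 1, 0, 0) : Xsp d m)] a.2

/-- The time derivative of `hypoW` when `τ` has derivative `b`. -/
def hypoW' (ε τ b : ℝ) (a : Fin d × Fin 3) : Xsp d m :=
  ![(ε ^ 8 * b) • ((0, Pi.single a.1 1, 0) : Xsp d m),
    b • ((0, Pi.single a.1 1, 0) : Xsp d m) +
      (ε ^ 4 * (2 * τ * b)) • ((Pi.single a.1 1, 0, 0) : Xsp d m),
    (2 * τ * b) • ((Pi.single a.1 1, 0, 0) : Xsp d m)] a.2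

/-- The squared Euclidean norm of a linear form, with time weights. -/
def weightedSq (τ : ℝ) (L : Xsp d m → ℝ) : ℝ :=
  ∑ j, ∑ i, (L (zdir d m j (Pi.single i 1))) ^ 2 + τ ^ 2 * ∑ i, (L (0, Pi.single i 1, 0)) ^ 2 +
    τ ^ 4 * ∑ i, (L (Pi.single i 1, 0, 0)) ^ 2

lemma hypo_sum_le (hV : ContDiff ℝ 2 V) (hα : ∀ j, 0 < α j) (hlam : ∀ j, 0 < lam j) (j₀ : Fin m)
    {ε τ b : ℝ} (hε : 0 ≤ ε) (hε1 : ε ≤ 1) (hτ : 0 ≤ τ) (hτ1 : τ ≤ 1) (hb : 0 ≤ b) (hb1 : b ≤ 1)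
    (x : Xsp d m) (L : Xsp d m →L[ℝ] ℝ) (i : Fin d) :
    ∑ s : Fin 3, (hypoC ε b (i, s) * (L (hypoW j₀ ε τ (i, s))) ^ 2 +
      2 * hypoC ε τ (i, s) * L (hypoW j₀ ε τ (i, s)) * L (hypoW' ε τ b (i, s) +
        fderiv ℝ (drift α lam V) x (hypoW j₀ ε τ (i, s)))) ≤
    -2 * lam j₀ * (ε ^ 9 * (τ * L (0, Pi.single i 1, 0))) ^ 2 -
      2 * (ε ^ 14 * (τ ^ 2 * L (Pi.single i 1, 0, 0))) ^ 2 +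
      ε * ((60 + 6 * α j₀ + 2 * lam j₀) * ((L (zdir d m j₀ (Pi.single i 1))) ^ 2 +
        (∑ j, lam j * L (zdir d m j (Pi.single i 1))) ^ 2 +
        (ε ^ 9 * (τ * L (0, Pi.single i 1, 0))) ^ 2 +
        (ε ^ 9 * ∑ k, fderiv ℝ (fun q => fderiv ℝ V q (Pi.single k 1)) x.1 (Pi.single i 1) *
          (τ * L (0, Pi.single k 1, 0))) ^ 2 +
        (ε ^ 14 * (τ ^ 2 * L (Pi.single i 1, 0, 0))) ^ 2)) := by
  have h := hypo_scalar hε hε1 hτ hτ1 hb hb1 (hlam j₀).le (hα j₀).le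
    (L (zdir d m j₀ (Pi.single i 1))) (τ * L (0, Pi.single i 1, 0))
    (τ ^ 2 * L (Pi.single i 1, 0, 0)) (∑ j, lam j * L (zdir d m j (Pi.single i 1)))
    (∑ k, fderiv ℝ (fun q => fderiv ℝ V q (Pi.single k 1)) x.1 (Pi.single i 1) *
          (τ * L (0, Pi.single k 1, 0)))
  refine le_trans (le_of_eq ?_) h
  rw [Fin.sum_univ_three]
  simp only [hypoC, hypoW, hypoW', Matrix.cons_val, map_add, map_smul, smul_eq_mul,
    clm_drift_q hV, clm_drift_p hV, clm_drift_z hV, mul_left_comm _ τ, ← Finset.mul_sum]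
  ring

set_option maxHeartbeats 1000000 in
lemma exists_hypo (hm : 1 ≤ m) (hβ : 0 < β) (hα : ∀ j, 0 < α j) (hlam : ∀ j, 0 < lam j)
    (hV : ContDiff ℝ 2 V) (hVper : PerV d V) :
    ∃ (j₀ : Fin m) (ε κ : ℝ), 0 < ε ∧ ε ≤ 1 ∧ 0 < κ ∧ ∀ τ b : ℝ, 0 ≤ τ → τ ≤ 1 → 0 ≤ b → b ≤ 1 →
      ∀ (x : Xsp d m) (L : Xsp d m →L[ℝ] ℝ),
      -noiseSq β α L + ∑ a : Fin d × Fin 3, (hypoC ε b a * (L (hypoW j₀ ε τ a)) ^ 2 +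
        2 * hypoC ε τ a * L (hypoW j₀ ε τ a) * L (hypoW' ε τ b a +
          fderiv ℝ (drift α lam V) x (hypoW j₀ ε τ a))) ≤ -κ * weightedSq τ L := by
  have : Nonempty (Fin m) := ⟨⟨0, hm⟩⟩
  obtain ⟨j₁, hj₁⟩ := Finite.exists_min α
  obtain ⟨M, hM⟩ := exists_hessian_bound hV hVper
  let j₀ : Fin m := ⟨0, hm⟩
  set κ₀ := β⁻¹ * α j₁ with hκ₀
  have hκ₀0 : 0 < κ₀ := mul_pos (inv_pos.2 hβ) (hα _)
  set K := 60 + 6 * α j₀ + 2 * lam j₀ with hK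
  have hK0 : 0 < K := by have := hα j₀; have := hlam j₀; positivity
  set A := 1 + ∑ j, (lam j) ^ 2 with hA
  have hA0 : 0 < A := by positivity
  set B := 1 + (d : ℝ) * (d * M ^ 2) with hB
  have hB0 : 0 < B := by positivity
  have hl0 := hlam j₀
  obtain ⟨ε, hε, hε1, h1, h2, h3⟩ : ∃ ε : ℝ, 0 < ε ∧ ε ≤ 1 ∧ ε * (K * A) ≤ κ₀ / 2 ∧
      ε * (K * B) ≤ lam j₀ ∧ ε * K ≤ 1 := by
    refine ⟨min (min 1 (κ₀ / 2 / (K * A))) (min (lam j₀ / (K * B)) (1 / K)), by positivity,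
      (min_le_left _ _).trans (min_le_left _ _), ?_, ?_, ?_⟩
    · rw [← le_div_iff₀ (by positivity)]; exact (min_le_left _ _).trans (min_le_right _ _)
    · rw [← le_div_iff₀ (by positivity)]; exact (min_le_right _ _).trans (min_le_left _ _)
    · rw [← le_div_iff₀ (by positivity)]; exact (min_le_right _ _).trans (min_le_right _ _)
  refine ⟨j₀, ε, min (κ₀ / 2) (min (lam j₀ * ε ^ 18) (ε ^ 28)), hε, hε1, by positivity, ?_⟩
  intro τ b hτ hτ1 hb hb1 x L
  set ζ : Fin m → Fin d → ℝ := fun j i => L (zdir d m j (Pi.single i 1)) with hζ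
  set Y : Fin d → ℝ := fun i => τ * L (0, Pi.single i 1, 0) with hY
  set W : Fin d → ℝ := fun i => τ ^ 2 * L (Pi.single i 1, 0, 0) with hW
  set H : Fin d → Fin d → ℝ := fun i k =>
    fderiv ℝ (fun q => fderiv ℝ V q (Pi.single k 1)) x.1 (Pi.single i 1) with hH
  have hsum := Finset.sum_le_sum fun i (_ : i ∈ Finset.univ) =>
    hypo_sum_le hV hα hlam j₀ hε.le hε1 hτ hτ1 hb hb1 x L i
  rw [← Fintype.sum_prod_type (f := fun a : Fin d × Fin 3 =>
    (hypoC ε b a * (L (hypoW j₀ ε τ a)) ^ 2 + 2 * hypoC ε τ a * L (hypoW j₀ ε τ a) *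
      L (hypoW' ε τ b a + fderiv ℝ (drift α lam V) x (hypoW j₀ ε τ a))))] at hsum
  have hterm : ∀ i, -2 * lam j₀ * (ε ^ 9 * Y i) ^ 2 - 2 * (ε ^ 14 * W i) ^ 2 +
      ε * (K * ((ζ j₀ i) ^ 2 + (∑ j, lam j * ζ j i) ^ 2 + (ε ^ 9 * Y i) ^ 2 +
        (ε ^ 9 * ∑ k, H i k * Y k) ^ 2 + (ε ^ 14 * W i) ^ 2)) ≤
      -2 * lam j₀ * ε ^ 18 * (Y i) ^ 2 - 2 * ε ^ 28 * (W i) ^ 2 +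
      ε * K * (A * (∑ j, (ζ j i) ^ 2) + ε ^ 18 * (Y i) ^ 2 +
        ε ^ 18 * (d * M ^ 2 * ∑ k, (Y k) ^ 2) + ε ^ 28 * (W i) ^ 2) := by
    intro i
    have e1 : (ζ j₀ i) ^ 2 ≤ ∑ j, (ζ j i) ^ 2 :=
      Finset.single_le_sum (f := fun j => (ζ j i) ^ 2) (fun j _ => sq_nonneg _) (Finset.mem_univ _)
    have e2 : (∑ j, lam j * ζ j i) ^ 2 ≤ (∑ j, (lam j) ^ 2) * ∑ j, (ζ j i) ^ 2 :=
      Finset.sum_mul_sq_le_sq_mul_sq _ _ _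
    have e3 : (∑ k, H i k * Y k) ^ 2 ≤ d * M ^ 2 * ∑ k, (Y k) ^ 2 := by
      refine (Finset.sum_mul_sq_le_sq_mul_sq _ _ _).trans ?_
      gcongr
      calc ∑ k, (H i k) ^ 2 ≤ ∑ k : Fin d, M ^ 2 := Finset.sum_le_sum fun k _ => by
            have := hM x.1 i k
            rw [← sq_abs]
            exact pow_le_pow_left₀ (abs_nonneg _) this 2
        _ = d * M ^ 2 := by simp
    have e4 : (ζ j₀ i) ^ 2 + (∑ j, lam j * ζ j i) ^ 2 + (ε ^ 9 * Y i) ^ 2 +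
        (ε ^ 9 * ∑ k, H i k * Y k) ^ 2 + (ε ^ 14 * W i) ^ 2 ≤
        A * (∑ j, (ζ j i) ^ 2) + ε ^ 18 * (Y i) ^ 2 +
        ε ^ 18 * (d * M ^ 2 * ∑ k, (Y k) ^ 2) + ε ^ 28 * (W i) ^ 2 := by
      have e5 := mul_le_mul_of_nonneg_left e3 (pow_nonneg hε.le 18)
      have : (ε ^ 9 * ∑ k, H i k * Y k) ^ 2 = ε ^ 18 * (∑ k, H i k * Y k) ^ 2 := by ring
      rw [this, hA]
      nlinarith
    have e6 := mul_le_mul_of_nonneg_left e4 (mul_pos hε hK0).le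
    nlinarith
  have h4 := hsum.trans (Finset.sum_le_sum fun i _ => hterm i)
  have hnoise : κ₀ * ∑ j, ∑ i, (ζ j i) ^ 2 ≤ noiseSq β α L := by
    unfold noiseSq
    rw [hκ₀, mul_assoc, Finset.mul_sum]
    refine mul_le_mul_of_nonneg_left (Finset.sum_le_sum fun j _ => ?_) (inv_nonneg.2 hβ.le)
    exact mul_le_mul_of_nonneg_right (hj₁ j) (Finset.sum_nonneg fun _ _ => sq_nonneg _)
  have h5 : ∑ i, (-2 * lam j₀ * ε ^ 18 * (Y i) ^ 2 - 2 * ε ^ 28 * (W i) ^ 2 +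
      ε * K * (A * (∑ j, (ζ j i) ^ 2) + ε ^ 18 * (Y i) ^ 2 +
        ε ^ 18 * (d * M ^ 2 * ∑ k, (Y k) ^ 2) + ε ^ 28 * (W i) ^ 2)) =
      (ε * (K * A)) * (∑ j, ∑ i, (ζ j i) ^ 2) + (ε * (K * B) - 2 * lam j₀) * ε ^ 18 * ∑ i, (Y i) ^ 2
        + (ε * K - 2) * ε ^ 28 * ∑ i, (W i) ^ 2 := by
    rw [Finset.sum_comm (f := fun j i => (ζ j i) ^ 2)]
    simp only [Finset.sum_add_distrib, Finset.sum_sub_distrib, ← Finset.mul_sum, Finset.sum_const,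
      Finset.card_univ, Fintype.card_fin, nsmul_eq_mul, hB]
    ring
  rw [h5] at h4
  have hw : weightedSq τ L = ∑ j, ∑ i, (ζ j i) ^ 2 + ∑ i, (Y i) ^ 2 + ∑ i, (W i) ^ 2 := by
    simp only [weightedSq, hζ, hY, hW, Finset.mul_sum, mul_pow]
    congr 2
    ring_nf
  have s1 : 0 ≤ ∑ j, ∑ i, (ζ j i) ^ 2 :=
    Finset.sum_nonneg fun _ _ => Finset.sum_nonneg fun _ _ => sq_nonneg _
  have s2 : 0 ≤ ∑ i, (Y i) ^ 2 := Finset.sum_nonneg fun _ _ => sq_nonneg _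
  have s3 : 0 ≤ ∑ i, (W i) ^ 2 := Finset.sum_nonneg fun _ _ => sq_nonneg _
  have g1 := mul_le_mul_of_nonneg_right h1 s1
  have g2 := mul_le_mul_of_nonneg_right h2 (mul_nonneg (pow_nonneg hε.le 18) s2)
  have g3 := mul_le_mul_of_nonneg_right h3 (mul_nonneg (pow_nonneg hε.le 28) s3)
  set κ := min (κ₀ / 2) (min (lam j₀ * ε ^ 18) (ε ^ 28)) with hκ
  have f1 := mul_le_mul_of_nonneg_right (show κ ≤ κ₀ / 2 from min_le_left _ _) s1
  have f2 := mul_le_mul_of_nonneg_right (show κ ≤ lam j₀ * ε ^ 18 from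
    (min_le_right _ _).trans (min_le_left _ _)) s2
  have f3 := mul_le_mul_of_nonneg_right (show κ ≤ ε ^ 28 from
    (min_le_right _ _).trans (min_le_right _ _)) s3
  rw [hw]
  nlinarith

end

section

lemma exists_step :
    ∃ (θ θ₁ θ₂ : ℝ → ℝ) (C : ℝ), ContDiff ℝ 2 θ ∧ (∀ s, HasDerivAt θ (θ₁ s) s) ∧
      (∀ s, HasDerivAt θ₁ (θ₂ s) s) ∧ (∀ s, 0 ≤ θ s) ∧ (∀ s, θ s ≤ 1) ∧ (∀ s, 2 ≤ s → θ s = 0) ∧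
      (∀ s, s ≤ 1 → θ s = 1) ∧ (∀ s, |θ₁ s| ≤ C) ∧ ∀ s, |θ₂ s| ≤ C := by
  set θ : ℝ → ℝ := fun s => Real.smoothTransition (2 - s) with hθ
  have h2 : ContDiff ℝ (2 + 1) θ := by
    have : ContDiff ℝ (2 + 1) Real.smoothTransition := Real.smoothTransition.contDiff (n := 3)
    exact this.comp (contDiff_const.sub contDiff_id)
  have h1 : ContDiff ℝ 2 θ := h2.of_le (by norm_num)
  have hd1 : ContDiff ℝ 2 (deriv θ) := ((contDiff_succ_iff_deriv (n := 2)).1 h2).2.2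
  have e0 : ∀ s, 2 ≤ s → θ s = 0 := fun s hs =>
    Real.smoothTransition.zero_of_nonpos (by linarith)
  have e1 : ∀ s, s ≤ 1 → θ s = 1 := fun s hs => Real.smoothTransition.one_of_one_le (by linarith)
  have hsupp : HasCompactSupport (deriv θ) := by
    refine HasCompactSupport.of_support_subset_isCompact (isCompact_Icc (a := (1 : ℝ)) (b := 2)) ?_
    intro s hs
    by_contra hn
    rw [Set.mem_Icc, not_and_or, not_le, not_le] at hn
    apply hs
    rcases hn with hn | hn
    · have : θ =ᶠ[nhds s] fun _ => 1 := by
        filter_upwards [Iio_mem_nhds hn] with r hr using e1 r (le_of_lt hr)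
      rw [this.deriv_eq]; simp
    · have : θ =ᶠ[nhds s] fun _ => 0 := by
        filter_upwards [Ioi_mem_nhds hn] with r hr using e0 r (le_of_lt hr)
      rw [this.deriv_eq]; simp
  obtain ⟨C1, hC1⟩ := hsupp.exists_bound_of_continuous hd1.continuous
  obtain ⟨C2, hC2⟩ := hsupp.deriv.exists_bound_of_continuous (hd1.continuous_deriv (by norm_num))
  refine ⟨θ, deriv θ, deriv (deriv θ), max C1 C2, h1,
    fun s => (h1.differentiable two_ne_zero s).hasDerivAt,
    fun s => (hd1.differentiable two_ne_zero s).hasDerivAt,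
    fun s => Real.smoothTransition.nonneg _, fun s => Real.smoothTransition.le_one _, e0, e1,
    fun s => (hC1 s).trans (le_max_left _ _), fun s => (hC2 s).trans (le_max_right _ _)⟩

lemma exists_cutoff :
    ∃ C : ℝ, 0 < C ∧ ∀ R : ℝ, 1 ≤ R → ∃ g g₁ g₂ : ℝ → ℝ, ContDiff ℝ 2 g ∧
      (∀ s, HasDerivAt g (g₁ s) s) ∧ (∀ s, HasDerivAt g₁ (g₂ s) s) ∧ (∀ s, 0 ≤ g s) ∧
      (∀ s, g s ≤ 1) ∧ (∃ r, ∀ s, r ≤ s → g s = 0) ∧ (∀ s, log (1 + s ^ 2) ≤ R → g s = 1) ∧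
      ∀ s, 1 ≤ s → |g₁ s| ≤ C / R ∧ s * |g₁ s| ≤ C / R ∧ s * |g₂ s| ≤ C / R := by
  obtain ⟨θ, θ₁, θ₂, C, hθ, hθ1, hθ2, h0, h1, hz, ho, hC1, hC2⟩ := exists_step
  have hC : 0 ≤ C := (abs_nonneg _).trans (hC1 0)
  refine ⟨8 * C + 1, by positivity, fun R hR => ?_⟩
  have hR0 : 0 < R := by linarith
  have hpos : ∀ s : ℝ, 0 < 1 + s ^ 2 := fun s => by positivity
  have hl : ∀ s, HasDerivAt (fun s => log (1 + s ^ 2) / R) (2 * s / (1 + s ^ 2) / R) s := by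
    intro s
    have := ((((hasDerivAt_id s).pow 2).const_add 1).log (hpos s).ne').div_const R
    simpa using this
  have hq : ∀ s, HasDerivAt (fun s => 2 * s / (1 + s ^ 2) / R)
      ((2 - 2 * s ^ 2) / (1 + s ^ 2) ^ 2 / R) s := by
    intro s
    have := (((hasDerivAt_id s).const_mul 2).div (((hasDerivAt_id s).pow 2).const_add 1)
      (hpos s).ne').div_const R
    convert! this using 1
    simp
    ring
  have hlc : ContDiff ℝ 2 fun s : ℝ => log (1 + s ^ 2) / R :=
    ((contDiff_const.add (contDiff_id.pow 2)).log fun s => (hpos s).ne').div_const R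
  refine ⟨fun s => θ (log (1 + s ^ 2) / R), fun s => θ₁ (log (1 + s ^ 2) / R) *
    (2 * s / (1 + s ^ 2) / R), fun s => θ₂ (log (1 + s ^ 2) / R) * (2 * s / (1 + s ^ 2) / R) *
      (2 * s / (1 + s ^ 2) / R) + θ₁ (log (1 + s ^ 2) / R) *
      ((2 - 2 * s ^ 2) / (1 + s ^ 2) ^ 2 / R), hθ.comp hlc, fun s => (hθ1 _).comp s (hl s),
    fun s => ((hθ2 _).comp s (hl s)).mul (hq s), fun s => h0 _, fun s => h1 _,
    ⟨exp R, fun s hs => hz _ ?_⟩, fun s hs => ho _ (by rwa [div_le_one hR0]), fun s hs => ?_⟩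
  · rw [le_div_iff₀ hR0, le_log_iff_exp_le (hpos s), mul_comm, mul_two, exp_add]
    nlinarith [exp_pos R]
  · have hs0 : 0 < s := by linarith
    set A := 2 * s / (1 + s ^ 2) with hA
    set B := (2 - 2 * s ^ 2) / (1 + s ^ 2) ^ 2 with hB
    have hA0 : 0 ≤ A := by positivity
    have hsA : s * A ≤ 2 := by
      rw [hA, mul_div_assoc', div_le_iff₀ (hpos s)]; nlinarith
    have hA1 : A ≤ 1 := by
      rw [hA, div_le_iff₀ (hpos s)]; nlinarith [sq_nonneg (s - 1)]
    have hsB : s * |B| ≤ 2 := by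
      rw [hB, abs_div, abs_of_pos (pow_pos (hpos s) 2), mul_div_assoc',
        div_le_iff₀ (pow_pos (hpos s) 2), abs_of_nonpos (by nlinarith)]
      nlinarith [pow_pos hs0 2, pow_pos hs0 3, pow_pos hs0 4, sq_nonneg (s ^ 2 - s), sq_nonneg s]
    set a := θ₁ (log (1 + s ^ 2) / R)
    set b := θ₂ (log (1 + s ^ 2) / R)
    have ha : |a| ≤ C := hC1 _
    have hb : |b| ≤ C := hC2 _
    have hRi : 0 < R⁻¹ := inv_pos.2 hR0
    have hRi1 : R⁻¹ ≤ 1 := inv_le_one_of_one_le₀ hR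
    have q2 : s * |a * (A / R)| ≤ 2 * C / R := by
      rw [abs_mul, abs_of_nonneg (div_nonneg hA0 hR0.le)]
      calc s * (|a| * (A / R)) = |a| * (s * A) / R := by ring
        _ ≤ C * 2 / R := by gcongr
        _ = 2 * C / R := by ring
    have hm : ∀ {y k : ℝ}, y ≤ k * C / R → k ≤ 8 → y ≤ (8 * C + 1) / R := fun {y k} h hk =>
      h.trans (div_le_div_of_nonneg_right (by nlinarith) hR0.le)
    refine ⟨hm (le_trans ?_ q2) (by norm_num), hm q2 (by norm_num), ?_⟩
    · nlinarith [abs_nonneg (a * (A / R))]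
    · refine hm (k := 4) ?_ (by norm_num)
      calc s * |b * (A / R) * (A / R) + a * (B / R)|
          ≤ s * (|b * (A / R) * (A / R)| + |a * (B / R)|) := by gcongr; exact abs_add_le _ _
        _ = |b| * ((s * A) * A) * R⁻¹ / R + |a| * (s * |B|) / R := by
            rw [abs_mul, abs_mul, abs_mul a, abs_of_nonneg (div_nonneg hA0 hR0.le), abs_div B,
              abs_of_pos hR0]
            ring
        _ ≤ C * (2 * 1) * 1 / R + C * 2 / R := by gcongr
        _ = 4 * C / R := by ring

end

section

variable {d m : ℕ} {β : ℝ} {α lam : Fin m → ℝ} {V : (Fin d → ℝ) → ℝ}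

lemma integrable_fun_add {Y : Type*} [MeasurableSpace Y] {μ : Measure Y} {f g : Y → ℝ}
    (hf : Integrable f μ) (hg : Integrable g μ) : Integrable (fun x => f x + g x) μ :=
  hf.add hg

lemma zdir_eq_sum (j : Fin m) (g : Fin d → ℝ) :
    zdir d m j g = ∑ k, g k • zdir d m j (Pi.single k 1) := by
  ext a b
  · simp [zdir, Prod.fst_sum]
  · simp [zdir, Prod.fst_sum, Prod.snd_sum]
  · by_cases h : a = j
    · subst h; simp [zdir, Prod.snd_sum, Finset.sum_apply, Pi.single_apply]
    · simp [zdir, h, Prod.snd_sum, Finset.sum_apply]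

lemma clm_apply_eq_sum (L : Xsp d m →L[ℝ] ℝ) (v : Xsp d m) :
    L v = ∑ i, v.1 i * L (Pi.single i 1, 0, 0) + ∑ i, v.2.1 i * L (0, Pi.single i 1, 0) +
      ∑ j, ∑ k, v.2.2 j k * L (zdir d m j (Pi.single k 1)) := by
  have hq : ((v.1, 0, 0) : Xsp d m) = ∑ k, v.1 k • ((Pi.single k 1, 0, 0) : Xsp d m) := by
    ext i
    · simp [Prod.fst_sum, Finset.sum_apply, Pi.single_apply]
    · simp [Prod.snd_sum]
    · simp [Prod.snd_sum]
  have hv : v = (v.1, 0, 0) + (0, v.2.1, 0) + (0, 0, v.2.2) := by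
    ext <;> simp
  conv_lhs => rw [hv]
  rw [map_add, map_add, clm_apply_p, clm_apply_z, hq, map_sum]
  congr 1
  · simp only [map_smul, smul_eq_mul]
  · refine Finset.sum_congr rfl fun j _ => ?_
    rw [zdir_eq_sum, map_sum]
    simp only [map_smul, smul_eq_mul]

lemma PerQ.mul {φ ψ : Xsp d m → ℝ} (hφ : PerQ d m φ) (hψ : PerQ d m ψ) :
    PerQ d m fun x => φ x * ψ x := fun k x => by simp only [hφ k x, hψ k x]

lemma PerQ.fderiv {φ : Xsp d m → ℝ} (hφ : PerQ d m φ) (v : Xsp d m) :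
    PerQ d m fun x => fderiv ℝ φ x v := by
  intro k x
  have h1 : (fun y : Xsp d m => φ (y + ((fun i => (k i : ℝ)), 0))) = φ := by
    funext y
    have := hφ k y
    rw [← this]
    congr 1
    ext <;> simp
  have h2 : ((x.1 + fun i => (k i : ℝ), x.2) : Xsp d m) = x + ((fun i => (k i : ℝ)), 0) := by
    ext <;> simp
  simp only
  rw [h2, ← fderiv_comp_add_right, h1]

lemma perQ_fderiv_V (hVper : PerV d V) (v : Fin d → ℝ) :
    PerQ d m fun x => _root_.fderiv ℝ V x.1 v := by
  intro k x
  have h1 : (fun y : Fin d → ℝ => V (y + fun i => (k i : ℝ))) = V := funext fun y => hVper k y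
  simp only
  rw [← fderiv_comp_add_right, h1]

/-- The formal adjoint of `backOp` with respect to Lebesgue measure. -/
def adjOp (β : ℝ) (α lam : Fin m → ℝ) (V : (Fin d → ℝ) → ℝ) (W : Xsp d m → ℝ) (x : Xsp d m) : ℝ :=
  ∑ j, ∑ _k : Fin d, α j * W x - fderiv ℝ W x (drift α lam V x) +
    β⁻¹ * ∑ j, α j * ∑ k, fderiv ℝ (pZ d m j k W) x (zdir d m j (Pi.single k 1))

lemma fderiv_eval_p (i : Fin d) (x v : Xsp d m) :
    fderiv ℝ (fun y : Xsp d m => y.2.1 i) x v = v.2.1 i :=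
  congrArg (fun L : Xsp d m →L[ℝ] ℝ => L v) (ContinuousLinearMap.fderiv
    ((ContinuousLinearMap.proj (R := ℝ) (φ := fun _ : Fin d => ℝ) i).comp
      ((ContinuousLinearMap.fst ℝ (Fin d → ℝ) (Fin m → Fin d → ℝ)).comp
        (ContinuousLinearMap.snd ℝ (Fin d → ℝ) _))))

lemma fderiv_eval_z (j : Fin m) (i : Fin d) (x v : Xsp d m) :
    fderiv ℝ (fun y : Xsp d m => y.2.2 j i) x v = v.2.2 j i :=
  congrArg (fun L : Xsp d m →L[ℝ] ℝ => L v) (ContinuousLinearMap.fderiv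
    ((ContinuousLinearMap.proj (R := ℝ) (φ := fun _ : Fin d => ℝ) i).comp
      ((ContinuousLinearMap.proj (R := ℝ) (φ := fun _ : Fin m => Fin d → ℝ) j).comp
      ((ContinuousLinearMap.snd ℝ (Fin d → ℝ) (Fin m → Fin d → ℝ)).comp
        (ContinuousLinearMap.snd ℝ (Fin d → ℝ) _)))))

lemma integral_mul_backOp (hV : ContDiff ℝ 2 V) (hVper : PerV d V) {W φ : Xsp d m → ℝ}
    (hW : ContDiff ℝ 2 W) (hWp : PerQ d m W) (hWs : BddSupp W) (hφ : Reg φ) (hφp : PerQ d m φ) :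
    ∫ x, W x * backOp β α lam V φ x ∂(volX d m) =
      ∫ x, φ x * adjOp β α lam V W x ∂(volX d m) := by
  have hW1 : ContDiff ℝ 1 W := hW.of_le (by norm_num)
  have hWd : Differentiable ℝ W := hW.differentiable two_ne_zero
  have hφd : Differentiable ℝ φ := hφ.1.differentiable one_ne_zero
  have hpZW : ∀ j k, ContDiff ℝ 1 (pZ d m j k W) := fun j k => contDiff_fderiv_apply hW _
  -- the coefficients of the drift
  let bQ : Fin d → Xsp d m → ℝ := fun i x => -x.2.1 i
  let bP : Fin d → Xsp d m → ℝ := fun i x =>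
    fderiv ℝ V x.1 (Pi.single i 1) - ∑ j, lam j * x.2.2 j i
  let bZ : Fin m → Fin d → Xsp d m → ℝ := fun j i x => lam j * x.2.1 i - α j * x.2.2 j i
  have hV1 : ∀ i, ContDiff ℝ 1 fun x : Xsp d m => fderiv ℝ V x.1 (Pi.single i 1) := fun i =>
    (contDiff_fderiv_apply hV _).comp contDiff_fst
  have cQ : ∀ i, ContDiff ℝ 1 (bQ i) := fun i => by unfold bQ; fun_prop
  have cP : ∀ i, ContDiff ℝ 1 (bP i) := fun i => by
    have := hV1 i
    unfold bP; fun_prop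
  have cZ : ∀ j i, ContDiff ℝ 1 (bZ j i) := fun j i => by unfold bZ; fun_prop
  have pQ' : ∀ i, PerQ d m (bQ i) := fun i k x => rfl
  have pP' : ∀ i, PerQ d m (bP i) := fun i k x => by
    have := perQ_fderiv_V (m := m) hVper (Pi.single i 1) k x
    simp only [bP] at this ⊢
    rw [this]
  have pZ' : ∀ j i, PerQ d m (bZ j i) := fun j i k x => rfl
  have dQ : ∀ i x, fderiv ℝ (bQ i) x (Pi.single i 1, 0, 0) = 0 := by
    intro i x
    change fderiv ℝ (fun y : Xsp d m => -y.2.1 i) x _ = 0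
    rw [fderiv_fun_neg, neg_apply, fderiv_eval_p]; simp
  have dP : ∀ i x, fderiv ℝ (bP i) x (0, Pi.single i 1, 0) = 0 := by
    intro i x
    have h1 := ((contDiff_fderiv_apply hV (Pi.single i 1)).differentiable
      one_ne_zero x.1).hasFDerivAt.comp x hasFDerivAt_fst
    have h2 : ∀ j : Fin m, HasFDerivAt (fun y : Xsp d m => lam j * y.2.2 j i)
        (lam j • fderiv ℝ (fun y : Xsp d m => y.2.2 j i) x) x := fun j =>
      (DifferentiableAt.hasFDerivAt (by fun_prop)).const_mul (lam j)
    have h3 := h1.sub (HasFDerivAt.fun_sum (u := Finset.univ) fun j _ => h2 j)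
    change HasFDerivAt (bP i) _ x at h3
    rw [h3.fderiv]
    simp [fderiv_eval_z, sum_apply]
  have dZ : ∀ j i x, fderiv ℝ (bZ j i) x (zdir d m j (Pi.single i 1)) = -α j := by
    intro j i x
    have h1 : HasFDerivAt (fun y : Xsp d m => lam j * y.2.1 i)
        (lam j • fderiv ℝ (fun y : Xsp d m => y.2.1 i) x) x :=
      (DifferentiableAt.hasFDerivAt (by fun_prop)).const_mul (lam j)
    have h2 : HasFDerivAt (fun y : Xsp d m => α j * y.2.2 j i)
        (α j • fderiv ℝ (fun y : Xsp d m => y.2.2 j i) x) x :=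
      (DifferentiableAt.hasFDerivAt (by fun_prop)).const_mul (α j)
    have h3 := h1.sub h2
    change HasFDerivAt (bZ j i) _ x at h3
    rw [h3.fderiv]
    simp [fderiv_eval_z, fderiv_eval_p, zdir]
  -- total derivatives
  have hFc : ∀ b : Xsp d m → ℝ, ContDiff ℝ 1 b → ContDiff ℝ 1 fun x => W x * (φ x * b x) :=
    fun b hb => hW1.mul (hφ.1.mul hb)
  have hFd : ∀ b : Xsp d m → ℝ, ContDiff ℝ 1 b → ∀ x v, fderiv ℝ (fun x => W x * (φ x * b x)) x v =
      W x * (b x * fderiv ℝ φ x v) + φ x * (b x * fderiv ℝ W x v) +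
        W x * φ x * fderiv ℝ b x v := by
    intro b hb x v
    have := (hWd x).hasFDerivAt.mul ((hφd x).hasFDerivAt.mul
      (hb.differentiable one_ne_zero x).hasFDerivAt)
    change HasFDerivAt (fun x => W x * (φ x * b x)) _ x at this
    rw [this.fderiv]
    simp; ring
  have hF0 : ∀ b : Xsp d m → ℝ, ContDiff ℝ 1 b → PerQ d m b → ∀ v,
      ∫ x, fderiv ℝ (fun x => W x * (φ x * b x)) x v ∂(volX d m) = 0 := fun b hb hp v =>
    integral_fderiv_volX (hFc b hb) (hWp.mul (hφp.mul hp)) hWs.mul_right v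
  have hFi : ∀ b : Xsp d m → ℝ, ContDiff ℝ 1 b → ∀ v,
      Integrable (fun x => fderiv ℝ (fun x => W x * (φ x * b x)) x v) (volX d m) := fun b hb v =>
    ((hWs.mul_right (ψ := fun x => φ x * b x)).fderiv v).integrable
      (((hFc b hb).continuous_fderiv one_ne_zero).clm_apply continuous_const)
  let G : Fin m → Fin d → Xsp d m → ℝ := fun j k x =>
    W x * fderiv ℝ (pZ d m j k φ) x (zdir d m j (Pi.single k 1)) -
      φ x * fderiv ℝ (pZ d m j k W) x (zdir d m j (Pi.single k 1))
  have hpWs : ∀ j k, BddSupp (pZ d m j k W) := fun j k => hWs.fderiv _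
  have cont1 : ∀ j k, Continuous fun x =>
      W x * fderiv ℝ (pZ d m j k φ) x (zdir d m j (Pi.single k 1)) := fun j k =>
    hW.continuous.mul (((hφ.2 j k).continuous_fderiv one_ne_zero).clm_apply continuous_const)
  have cont2 : ∀ j k, Continuous fun x =>
      φ x * fderiv ℝ (pZ d m j k W) x (zdir d m j (Pi.single k 1)) := fun j k =>
    hφ.1.continuous.mul (((hpZW j k).continuous_fderiv one_ne_zero).clm_apply continuous_const)
  have i1 : ∀ j k, Integrable (fun x =>
      W x * fderiv ℝ (pZ d m j k φ) x (zdir d m j (Pi.single k 1))) (volX d m) := fun j k =>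
    hWs.mul_right.integrable (cont1 j k)
  have i2 : ∀ j k, Integrable (fun x =>
      φ x * fderiv ℝ (pZ d m j k W) x (zdir d m j (Pi.single k 1))) (volX d m) := fun j k =>
    ((hpWs j k).fderiv _).mul_left.integrable (cont2 j k)
  have hGi : ∀ j k, Integrable (G j k) (volX d m) := fun j k => (i1 j k).sub (i2 j k)
  have hG0 : ∀ j k, ∫ x, G j k x ∂(volX d m) = 0 := by
    intro j k
    have e1 := integral_mul_fderiv_volX hW1 (hφ.2 j k) hWp (hφp.fderiv _) hWs
      (zdir d m j (Pi.single k 1))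
    have e2 := integral_mul_fderiv_volX (hpZW j k) hφ.1 (hWp.fderiv _) hφp (hpWs j k)
      (zdir d m j (Pi.single k 1))
    have e3 : ∫ x, G j k x ∂(volX d m) = _ := integral_sub (i1 j k) (i2 j k)
    rw [e3, e1]
    have e4 : ∫ x, pZ d m j k φ x * fderiv ℝ W x (zdir d m j (Pi.single k 1)) ∂(volX d m) =
        ∫ x, pZ d m j k W x * fderiv ℝ φ x (zdir d m j (Pi.single k 1)) ∂(volX d m) :=
      integral_congr_ae (Eventually.of_forall fun x => mul_comm _ _)
    rw [e4, e2]
    ring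
  have hpt : ∀ x, W x * backOp β α lam V φ x - φ x * adjOp β α lam V W x =
      ∑ i, fderiv ℝ (fun x => W x * (φ x * bQ i x)) x (Pi.single i 1, 0, 0) +
      ∑ i, fderiv ℝ (fun x => W x * (φ x * bP i x)) x (0, Pi.single i 1, 0) +
      ∑ j, ∑ k, fderiv ℝ (fun x => W x * (φ x * bZ j k x)) x (zdir d m j (Pi.single k 1)) +
      β⁻¹ * ∑ j, α j * ∑ k, G j k x := by
    intro x
    simp only [hFd _ (cQ _), hFd _ (cP _), hFd _ (cZ _ _), dQ, dP, dZ]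
    unfold backOp adjOp
    rw [clm_apply_eq_sum (fderiv ℝ φ x), clm_apply_eq_sum (fderiv ℝ W x)]
    have r1 : ∀ i, (drift α lam V x).1 i = bQ i x := fun i => rfl
    have r2 : ∀ i, (drift α lam V x).2.1 i = bP i x := fun i => by
      simp [drift, bP, Finset.sum_apply]
    have r3 : ∀ j i, (drift α lam V x).2.2 j i = bZ j i x := fun j i => rfl
    simp only [r1, r2, r3, G, Finset.sum_add_distrib, Finset.sum_sub_distrib, mul_sub, mul_add,
      ← Finset.mul_sum, mul_zero, mul_neg, Finset.sum_neg_distrib, add_zero]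
    have r4 : ∑ j, ∑ k : Fin d, W x * φ x * α j = φ x * ∑ j, ∑ k : Fin d, α j * W x := by
      simp only [Finset.mul_sum]
      refine Finset.sum_congr rfl fun j _ => Finset.sum_congr rfl fun k _ => by ring
    have r5 : ∀ (c : ℝ) (F : Fin m → Fin d → ℝ), β⁻¹ * ∑ j, α j * (c * ∑ k, F j k) =
        c * (β⁻¹ * ∑ j, α j * ∑ k, F j k) := by
      intro c F
      simp only [Finset.mul_sum]
      refine Finset.sum_congr rfl fun j _ => Finset.sum_congr rfl fun k _ => by ring
    rw [r5, r5]
    simp only [← Finset.mul_sum] at r4 ⊢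
    linear_combination r4
  have j1 : Integrable (fun x => W x * backOp β α lam V φ x) (volX d m) := by
    refine hWs.mul_right.integrable (hW.continuous.mul ?_)
    have h1 : Continuous (fun x => fderiv ℝ φ x (drift α lam V x)) :=
      (hφ.1.continuous_fderiv one_ne_zero).clm_apply (contDiff_drift hV).continuous
    have h2 : ∀ j k, Continuous fun x => fderiv ℝ (pZ d m j k φ) x (zdir d m j (Pi.single k 1)) :=
      fun j k => ((hφ.2 j k).continuous_fderiv one_ne_zero).clm_apply continuous_const
    unfold backOp
    fun_prop
  have j0 : Integrable (fun x => W x * backOp β α lam V φ x - φ x * adjOp β α lam V W x)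
      (volX d m) := by
    simp only [hpt]
    exact (((integrable_finsetSum _ fun i _ => hFi _ (cQ i) _).add
      (integrable_finsetSum _ fun i _ => hFi _ (cP i) _)).add
      (integrable_finsetSum _ fun j _ => integrable_finsetSum _ fun k _ => hFi _ (cZ j k) _)).add
      ((integrable_finsetSum _ fun j _ =>
        (integrable_finsetSum _ fun k _ => hGi j k).const_mul (α j)).const_mul β⁻¹)
  have j2 : Integrable (fun x => φ x * adjOp β α lam V W x) (volX d m) := by
    have := j1.sub j0
    refine this.congr (Eventually.of_forall fun x => ?_)
    simp
  rw [← sub_eq_zero, ← integral_sub j1 j2]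
  simp only [hpt]
  have k1 := integrable_finsetSum Finset.univ fun i _ => hFi _ (cQ i) (Pi.single i 1, 0, 0)
  have k2 := integrable_finsetSum Finset.univ fun i _ => hFi _ (cP i) (0, Pi.single i 1, 0)
  have k3 := integrable_finsetSum Finset.univ fun j _ => integrable_finsetSum Finset.univ
    fun k _ => hFi _ (cZ j k) (zdir d m j (Pi.single k 1))
  have k4 := (integrable_finsetSum Finset.univ fun j _ =>
        (integrable_finsetSum Finset.univ fun k _ => hGi j k).const_mul (α j)).const_mul β⁻¹
  have k12 := integrable_fun_add k1 k2
  have k123 := integrable_fun_add k12 k3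
  rw [integral_add k123 k4, integral_add k12 k3, integral_add k1 k2,
    integral_finsetSum _ fun i _ => hFi _ (cQ i) _, integral_finsetSum _ fun i _ => hFi _ (cP i) _,
    integral_finsetSum _ fun j _ => integrable_finsetSum _ fun k _ => hFi _ (cZ j k) _,
    integral_const_mul, integral_finsetSum _ fun j _ =>
        (integrable_finsetSum Finset.univ fun k _ => hGi j k).const_mul (α j)]
  simp only [integral_const_mul]
  simp only [integral_finsetSum Finset.univ fun k _ => hGi _ k,
    integral_finsetSum Finset.univ fun k _ => hFi _ (cZ _ k) _, hG0, hF0 _ (cQ _) (pQ' _),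
    hF0 _ (cP _) (pP' _), hF0 _ (cZ _ _) (pZ' _ _)]
  simp

end

section

variable {d m : ℕ} {β Z : ℝ} {α lam : Fin m → ℝ} {V : (Fin d → ℝ) → ℝ}

/-- The Hamiltonian, shifted by the constant `c`. -/
def energy (V : (Fin d → ℝ) → ℝ) (c : ℝ) (x : Xsp d m) : ℝ :=
  V x.1 + c + (∑ i, (x.2.1 i) ^ 2) / 2 + (∑ j, ∑ i, (x.2.2 j i) ^ 2) / 2

lemma exists_lower_bound (hV : Continuous V) (hVper : PerV d V) : ∃ c : ℝ, ∀ q, 1 ≤ V q + c := by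
  obtain ⟨M, hM⟩ := (isCompact_Icc (a := (0 : Fin d → ℝ)) (b := 1)).exists_bound_of_continuousOn
    hV.continuousOn
  refine ⟨M + 1, fun q => ?_⟩
  rw [← hVper (fun i => -⌊q i⌋) q]
  have h2 := hM (q + fun i => ((-⌊q i⌋ : ℤ) : ℝ)) ⟨fun i => by simpa using Int.floor_le (q i),
    fun i => by have := (Int.lt_floor_add_one (q i)).le; simp; linarith⟩
  have := (abs_le.1 h2).1
  linarith

lemma contDiff_energy (hV : ContDiff ℝ 2 V) (c : ℝ) :
    ContDiff ℝ 2 (energy V c : Xsp d m → ℝ) := by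
  unfold energy; fun_prop

lemma fderiv_energy (hV : ContDiff ℝ 2 V) (c : ℝ) (x v : Xsp d m) :
    fderiv ℝ (energy V c) x v = fderiv ℝ V x.1 v.1 + ∑ i, x.2.1 i * v.2.1 i +
      ∑ j, ∑ i, x.2.2 j i * v.2.2 j i := by
  have h0 := (hV.differentiable two_ne_zero x.1).hasFDerivAt.comp x hasFDerivAt_fst
  have h1 : ∀ i, HasFDerivAt (fun y : Xsp d m => (y.2.1 i) ^ 2)
      ((2 * x.2.1 i) • fderiv ℝ (fun y : Xsp d m => y.2.1 i) x) x := fun i => by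
    convert! (DifferentiableAt.hasFDerivAt (by fun_prop : DifferentiableAt ℝ
      (fun y : Xsp d m => y.2.1 i) x)).pow 2 using 1
    simp
  have h2 : ∀ j i, HasFDerivAt (fun y : Xsp d m => (y.2.2 j i) ^ 2)
      ((2 * x.2.2 j i) • fderiv ℝ (fun y : Xsp d m => y.2.2 j i) x) x := fun j i => by
    convert! (DifferentiableAt.hasFDerivAt (by fun_prop : DifferentiableAt ℝ
      (fun y : Xsp d m => y.2.2 j i) x)).pow 2 using 1
    simp
  have h3 := ((h0.add_const c).add ((HasFDerivAt.fun_sum (u := Finset.univ)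
    fun i _ => h1 i).mul_const (2⁻¹ : ℝ))).add
    ((HasFDerivAt.fun_sum (u := Finset.univ) fun j _ => HasFDerivAt.fun_sum (u := Finset.univ)
      fun i _ => h2 j i).mul_const (2⁻¹ : ℝ))
  have h4 : HasFDerivAt (energy V c) _ x := h3.congr_of_eventuallyEq
    (Eventually.of_forall fun y => by simp [energy, div_eq_mul_inv])
  rw [h4.fderiv]
  simp only [add_apply, smul_apply, sum_apply, ContinuousLinearMap.comp_apply, fderiv_eval_p,
    fderiv_eval_z, smul_eq_mul, Finset.mul_sum, ContinuousLinearMap.coe_fst']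
  refine congrArg₂ _ (congrArg₂ _ rfl (Finset.sum_congr rfl fun i _ => by ring))
    (Finset.sum_congr rfl fun j _ => Finset.sum_congr rfl fun i _ => by ring)

lemma fderiv_energy_drift (hV : ContDiff ℝ 2 V) (c : ℝ) (x : Xsp d m) :
    fderiv ℝ (energy V c) x (drift α lam V x) = -∑ j, ∑ i, α j * (x.2.2 j i) ^ 2 := by
  rw [fderiv_energy hV]
  have h1 : fderiv ℝ V x.1 (drift α lam V x).1 =
      -∑ i, x.2.1 i * fderiv ℝ V x.1 (Pi.single i 1) := by
    have : (drift α lam V x).1 = -∑ i, x.2.1 i • (Pi.single i 1 : Fin d → ℝ) := by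
      ext k
      simp [drift, Finset.sum_apply, Pi.single_apply]
    rw [this]; simp
  have h2 : ∀ i, (drift α lam V x).2.1 i =
      fderiv ℝ V x.1 (Pi.single i 1) - ∑ j, lam j * x.2.2 j i := fun i => by
    simp [drift, Finset.sum_apply]
  have h3 : ∀ j i, (drift α lam V x).2.2 j i = lam j * x.2.1 i - α j * x.2.2 j i := fun _ _ => rfl
  have h4 : ∑ i, x.2.1 i * ∑ j, lam j * x.2.2 j i = ∑ j, ∑ i, x.2.2 j i * (lam j * x.2.1 i) := by
    simp only [Finset.mul_sum]
    rw [Finset.sum_comm]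
    refine Finset.sum_congr rfl fun j _ => Finset.sum_congr rfl fun i _ => by ring
  have h5 : ∑ j, ∑ i, x.2.2 j i * (α j * x.2.2 j i) = ∑ j, ∑ i, α j * (x.2.2 j i) ^ 2 :=
    Finset.sum_congr rfl fun j _ => Finset.sum_congr rfl fun i _ => by ring
  simp only [h1, h2, h3, mul_sub, Finset.sum_sub_distrib, h4, h5]
  ring

lemma fderiv_comp_energy (hV : ContDiff ℝ 2 V) (c : ℝ) {G G₁ : ℝ → ℝ}
    (h : ∀ s, HasDerivAt G (G₁ s) s) (x v : Xsp d m) :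
    fderiv ℝ (fun x => G (energy V c x)) x v =
      G₁ (energy V c x) * fderiv ℝ (energy V c) x v := by
  have := (h (energy V c x)).comp_hasFDerivAt x
    ((contDiff_energy hV c).differentiable two_ne_zero x).hasFDerivAt
  change HasFDerivAt (fun x => G (energy V c x)) _ x at this
  rw [this.fderiv]; simp

lemma pZ_comp_energy (hV : ContDiff ℝ 2 V) (c : ℝ) {G G₁ : ℝ → ℝ}
    (h : ∀ s, HasDerivAt G (G₁ s) s) (j : Fin m) (k : Fin d) (x : Xsp d m) :
    pZ d m j k (fun x => G (energy V c x)) x = G₁ (energy V c x) * x.2.2 j k := by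
  unfold pZ
  rw [fderiv_comp_energy hV c h, fderiv_energy hV]
  congr 1
  have : ∀ j' i, (zdir d m j (Pi.single k 1)).2.2 j' i =
      if j' = j then (if i = k then 1 else 0) else 0 := by
    intro j' i
    by_cases h : j' = j
    · subst h; simp [zdir, Pi.single_apply]
    · simp [zdir, h]
  simp only [this]
  simp [zdir]

lemma adjOp_comp_energy (hV : ContDiff ℝ 2 V) (c : ℝ) {G G₁ G₂ : ℝ → ℝ}
    (h : ∀ s, HasDerivAt G (G₁ s) s) (h₁ : ∀ s, HasDerivAt G₁ (G₂ s) s) (x : Xsp d m) :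
    adjOp β α lam V (fun x => G (energy V c x)) x = ∑ j, ∑ k, α j *
      (G (energy V c x) + G₁ (energy V c x) * (x.2.2 j k) ^ 2 +
        β⁻¹ * (G₂ (energy V c x) * (x.2.2 j k) ^ 2 + G₁ (energy V c x))) := by
  unfold adjOp
  rw [fderiv_comp_energy hV c h, fderiv_energy_drift hV]
  have h2 : ∀ j k, fderiv ℝ (pZ d m j k fun x => G (energy V c x)) x (zdir d m j (Pi.single k 1)) =
      G₂ (energy V c x) * (x.2.2 j k) ^ 2 + G₁ (energy V c x) := by
    intro j k
    have e : (pZ d m j k fun x => G (energy V c x)) = fun x => G₁ (energy V c x) * x.2.2 j k :=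
      funext fun x => pZ_comp_energy hV c h j k x
    rw [e]
    have h3 := pZ_comp_energy hV c h₁ j k x
    unfold pZ at h3
    rw [fderiv_fun_mul]
    · simp only [add_apply, smul_apply, h3, fderiv_eval_z, smul_eq_mul]
      simp [zdir]; ring
    · exact DifferentiableAt.comp x (h₁ _).differentiableAt
        ((contDiff_energy hV c).differentiable two_ne_zero x)
    · fun_prop
  simp only [h2, Finset.mul_sum, ← Finset.sum_neg_distrib, ← Finset.sum_sub_distrib,
    ← Finset.sum_add_distrib]
  refine Finset.sum_congr rfl fun j _ => Finset.sum_congr rfl fun i _ => by ring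

/-- Smooth weights with bounded momentum support, increasing to the Gibbs density and almost
invariant. -/
theorem exists_weights (hβ : 0 < β) (hα : ∀ j, 0 < α j) (hZ : 0 < Z)
    (hV : ContDiff ℝ 2 V) (hVper : PerV d V) :
    ∃ C : ℝ, 0 ≤ C ∧ ∃ W : ℕ → Xsp d m → ℝ, (∀ n, ContDiff ℝ 2 (W n)) ∧ (∀ n, PerQ d m (W n)) ∧
      (∀ n, BddSupp (W n)) ∧ (∀ n x, 0 ≤ W n x) ∧ (∀ n x, W n x ≤ rho d m β Z V x) ∧
      (∀ n x, |adjOp β α lam V (W n) x| ≤ C / (n + 1) * rho d m β Z V x) ∧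
      ∀ x, ∀ᶠ n in atTop, W n x = rho d m β Z V x := by
  obtain ⟨c, hc⟩ := exists_lower_bound hV.continuous hVper
  obtain ⟨C, hC, hcut⟩ := exists_cutoff
  choose g g₁ g₂ hg hd1 hd2 hg0 hg1 hgz hgo hgb using
    fun n : ℕ => hcut ((n : ℝ) + 1) (by linarith [(Nat.cast_nonneg n : (0:ℝ) ≤ n)])
  set κ := Z⁻¹ * exp (β * c)
  have hκ : 0 < κ := by positivity
  have hrho : ∀ x : Xsp d m, rho d m β Z V x = κ * exp (-β * energy V c x) := by
    intro x
    simp only [rho, gdens, κ, energy, mul_assoc, ← exp_add]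
    congr 2; ring
  have hE1 : ∀ x : Xsp d m, 1 ≤ energy V c x := fun x => by
    have := hc x.1
    have h1 : 0 ≤ ∑ i, (x.2.1 i) ^ 2 := Finset.sum_nonneg fun _ _ => sq_nonneg _
    have h2 : 0 ≤ ∑ j, ∑ i, (x.2.2 j i) ^ 2 :=
      Finset.sum_nonneg fun _ _ => Finset.sum_nonneg fun _ _ => sq_nonneg _
    unfold energy; linarith
  have hEz : ∀ (x : Xsp d m) j i, (x.2.2 j i) ^ 2 ≤ 2 * energy V c x := fun x j i => by
    have := hc x.1
    have h1 : 0 ≤ ∑ i, (x.2.1 i) ^ 2 := Finset.sum_nonneg fun _ _ => sq_nonneg _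
    have h2 : (x.2.2 j i) ^ 2 ≤ ∑ i, (x.2.2 j i) ^ 2 :=
      Finset.single_le_sum (f := fun i => (x.2.2 j i) ^ 2) (fun _ _ => sq_nonneg _)
        (Finset.mem_univ i)
    have h3 : ∑ i, (x.2.2 j i) ^ 2 ≤ ∑ j, ∑ i, (x.2.2 j i) ^ 2 :=
      Finset.single_le_sum (f := fun j => ∑ i, (x.2.2 j i) ^ 2)
        (fun _ _ => Finset.sum_nonneg fun _ _ => sq_nonneg _) (Finset.mem_univ j)
    unfold energy; linarith
  have hEp : ∀ (x : Xsp d m) i, (x.2.1 i) ^ 2 ≤ 2 * energy V c x := fun x i => by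
    have := hc x.1
    have h2 : (x.2.1 i) ^ 2 ≤ ∑ i, (x.2.1 i) ^ 2 :=
      Finset.single_le_sum (f := fun i => (x.2.1 i) ^ 2) (fun _ _ => sq_nonneg _)
        (Finset.mem_univ i)
    have h3 : 0 ≤ ∑ j, ∑ i, (x.2.2 j i) ^ 2 :=
      Finset.sum_nonneg fun _ _ => Finset.sum_nonneg fun _ _ => sq_nonneg _
    unfold energy; linarith
  have hEper : ∀ (k : Fin d → ℤ) (x : Xsp d m),
      energy V c (x.1 + (fun i => (k i : ℝ)), x.2) = energy V c x := fun k x => by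
    simp only [energy, hVper k x.1]
  have hexp : ∀ s, HasDerivAt (fun s => κ * exp (-β * s)) (κ * (exp (-β * s) * -β)) s := fun s => by
    simpa using ((((hasDerivAt_id s).const_mul (-β)).exp).const_mul κ)
  let G : ℕ → ℝ → ℝ := fun n s => g n s * (κ * exp (-β * s))
  let G₁ : ℕ → ℝ → ℝ := fun n s => (g₁ n s - β * g n s) * (κ * exp (-β * s))
  let G₂ : ℕ → ℝ → ℝ := fun n s =>
    (g₂ n s - 2 * β * g₁ n s + β ^ 2 * g n s) * (κ * exp (-β * s))
  have hG : ∀ n s, HasDerivAt (G n) (G₁ n s) s := fun n s => by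
    convert! (hd1 n s).mul (hexp s) using 1
    simp only [G₁]; ring
  have hG₁ : ∀ n s, HasDerivAt (G₁ n) (G₂ n s) s := fun n s => by
    convert! ((hd2 n s).sub ((hd1 n s).const_mul β)).mul (hexp s) using 1
    simp only [G₂]; ring_nf; simp; ring
  set D := (∑ j, ∑ _k : Fin d, α j) * ((3 * β⁻¹ + 2) * C)
  have hS : 0 ≤ ∑ j, ∑ _k : Fin d, α j :=
    Finset.sum_nonneg fun j _ => Finset.sum_nonneg fun _ _ => (hα j).le
  refine ⟨D, mul_nonneg hS (by positivity), fun n x => G n (energy V c x), fun n => ?_,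
    fun n k x => ?_, fun n => ?_, fun n x => ?_, fun n x => ?_, fun n x => ?_, fun x => ?_⟩
  · have h1 : ContDiff ℝ 2 fun s => κ * exp (-β * s) := by fun_prop
    have h2 : ContDiff ℝ 2 (G n) := (hg n).mul h1
    exact h2.comp (contDiff_energy hV c)
  · simp only [hEper k x]
  · obtain ⟨r, hr⟩ := hgz n
    refine ⟨2 * |r| + 1, fun x hx => ?_⟩
    simp only [G]
    rw [hr, zero_mul]
    have hr1 : 0 ≤ |r| := abs_nonneg r
    have hr2 := le_abs_self r
    by_contra! hlt
    have hb : ∀ s : ℝ, s ^ 2 ≤ 2 * energy V c x → |s| ≤ 2 * |r| := fun s hs => by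
      refine abs_le_of_sq_le_sq ?_ (by positivity)
      have := hE1 x
      nlinarith
    have : ‖x.2‖ ≤ 2 * |r| := by
      refine norm_prod_le_iff.2 ⟨(pi_norm_le_iff_of_nonneg (by positivity)).2 fun i => ?_,
        (pi_norm_le_iff_of_nonneg (by positivity)).2 fun j =>
          (pi_norm_le_iff_of_nonneg (by positivity)).2 fun i => ?_⟩
      · exact hb _ (hEp x i)
      · exact hb _ (hEz x j i)
    linarith
  · exact mul_nonneg (hg0 n _) (by positivity)
  · rw [hrho]
    exact mul_le_of_le_one_left (by positivity) (hg1 n _)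
  · rw [adjOp_comp_energy hV c (hG n) (hG₁ n), hrho]
    refine (Finset.abs_sum_le_sum_abs _ _).trans ?_
    have hn : (0 : ℝ) < n + 1 := by positivity
    have hk : 0 < κ * exp (-β * energy V c x) := by positivity
    obtain ⟨b1, b2, b3⟩ := hgb n _ (hE1 x)
    have key : ∀ j k, |α j * (G n (energy V c x) + G₁ n (energy V c x) * (x.2.2 j k) ^ 2 +
        β⁻¹ * (G₂ n (energy V c x) * (x.2.2 j k) ^ 2 + G₁ n (energy V c x)))| ≤
        α j * ((3 * β⁻¹ + 2) * (C / (n + 1)) * (κ * exp (-β * energy V c x))) := by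
      intro j k
      rw [abs_mul, abs_of_pos (hα j)]
      refine mul_le_mul_of_nonneg_left ?_ (hα j).le
      have e : G n (energy V c x) + G₁ n (energy V c x) * (x.2.2 j k) ^ 2 +
          β⁻¹ * (G₂ n (energy V c x) * (x.2.2 j k) ^ 2 + G₁ n (energy V c x)) =
          (β⁻¹ * (g₂ n (energy V c x) * (x.2.2 j k) ^ 2) - g₁ n (energy V c x) * (x.2.2 j k) ^ 2 +
            β⁻¹ * g₁ n (energy V c x)) * (κ * exp (-β * energy V c x)) := by
        simp only [G, G₁, G₂]
        field_simp
        ring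
      rw [e, abs_mul, abs_of_pos hk]
      refine mul_le_mul_of_nonneg_right ?_ hk.le
      have hz := hEz x j k
      have hz0 := sq_nonneg (x.2.2 j k)
      have c1 : |g₂ n (energy V c x) * (x.2.2 j k) ^ 2| ≤ 2 * (C / (n + 1)) := by
        rw [abs_mul, abs_of_nonneg hz0]
        nlinarith [abs_nonneg (g₂ n (energy V c x))]
      have c2 : |g₁ n (energy V c x) * (x.2.2 j k) ^ 2| ≤ 2 * (C / (n + 1)) := by
        rw [abs_mul, abs_of_nonneg hz0]
        nlinarith [abs_nonneg (g₁ n (energy V c x))]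
      have hbi : 0 < β⁻¹ := inv_pos.2 hβ
      have d1 := mul_le_mul_of_nonneg_left c1 hbi.le
      have d3 := mul_le_mul_of_nonneg_left b1 hbi.le
      rw [← abs_of_pos hbi, ← abs_mul, abs_of_pos hbi] at d1 d3
      calc _ ≤ |β⁻¹ * (g₂ n (energy V c x) * (x.2.2 j k) ^ 2)| +
            |g₁ n (energy V c x) * (x.2.2 j k) ^ 2| + |β⁻¹ * g₁ n (energy V c x)| :=
            (abs_add_le _ _).trans (add_le_add_left (abs_sub _ _) _)
        _ ≤ _ := by linarith
    calc _ ≤ ∑ j, ∑ _k : Fin d,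
          α j * ((3 * β⁻¹ + 2) * (C / (n + 1)) * (κ * exp (-β * energy V c x))) :=
          Finset.sum_le_sum fun j _ => (Finset.abs_sum_le_sum_abs _ _).trans
            (Finset.sum_le_sum fun k _ => key j k)
      _ = _ := by
        simp only [← Finset.sum_mul, D]
        ring
  · obtain ⟨N, hN⟩ := exists_nat_ge (log (1 + (energy V c x) ^ 2))
    filter_upwards [eventually_ge_atTop N] with n hn
    have : (N : ℝ) ≤ n := by exact_mod_cast hn
    simp only [G, hrho]
    rw [hgo n _ (by linarith), one_mul]

end

section

variable {d m : ℕ} {β Z : ℝ} {α lam : Fin m → ℝ} {V : (Fin d → ℝ) → ℝ}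

instance sFinite_volX (d m : ℕ) : SFinite (volX d m) := by
  unfold volX; infer_instance

lemma integrable_prod_of_bddSupp {H : ℝ × Xsp d m → ℝ} (hH : Continuous H) {r : ℝ}
    (h0 : ∀ t x, r ≤ ‖x.2‖ → H (t, x) = 0) (s t : ℝ) :
    Integrable H ((volume.restrict (Set.Ioc s t)).prod (volX d m)) := by
  have hm : MeasurableSet {x : Xsp d m | x.1 ∈ cube d} := measurable_fst (measurableSet_cube d)
  have h1 : IntegrableOn H (Set.Icc s t ×ˢ Metric.closedBall (0 : Xsp d m) (max 1 |r|))
      (volume.prod volume) :=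
    hH.continuousOn.integrableOn_compact (isCompact_Icc.prod (isCompact_closedBall _ _))
  unfold volX
  rw [Measure.prod_restrict]
  have h2 : IntegrableOn H ((Set.Icc s t ×ˢ Metric.closedBall (0 : Xsp d m) (max 1 |r|)) ∩
      (Set.Ioc s t ×ˢ {x : Xsp d m | x.1 ∈ cube d})) (volume.prod volume) :=
    h1.mono_set Set.inter_subset_left
  refine h2.of_forall_sdiff_eq_zero (measurableSet_Ioc.prod hm) fun p hp => ?_
  by_contra hne
  refine hp.2 ⟨⟨Set.Ioc_subset_Icc_self hp.1.1, ?_⟩, hp.1⟩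
  have hx : ‖p.2.2‖ < r := lt_of_not_ge fun h => hne (h0 p.1 p.2 h)
  rw [mem_closedBall_zero_iff]
  refine norm_prod_le_iff.2 ⟨?_, (hx.le.trans (le_abs_self r)).trans (le_max_right _ _)⟩
  refine ((pi_norm_le_iff_of_nonneg zero_le_one).2 fun i => ?_).trans (le_max_left _ _)
  have := hp.1.2 i
  rw [Real.norm_eq_abs, abs_le]
  constructor <;> linarith [this.1, this.2]

/-- Evolution of a weighted integral of a time-dependent density. -/
lemma weighted_evolution {e D : ℝ → Xsp d m → ℝ} (he : ∀ r, 0 ≤ r → Continuous (e r))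
    (hD : Continuous fun p : ℝ × Xsp d m => D p.1 p.2)
    (hd : ∀ r x, 0 ≤ r → HasDerivAt (fun s => e s x) (D r x) r)
    {W : Xsp d m → ℝ} (hW : Continuous W) (hWs : BddSupp W) {s t : ℝ} (hs : 0 ≤ s) (hst : s ≤ t) :
    IntervalIntegrable (fun r => ∫ x, W x * D r x ∂(volX d m)) volume s t ∧
      (∫ x, W x * e t x ∂(volX d m)) - ∫ x, W x * e s x ∂(volX d m) =
        ∫ r in s..t, ∫ x, W x * D r x ∂(volX d m) := by
  obtain ⟨r₀, hr₀⟩ := hWs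
  have hint := integrable_prod_of_bddSupp (r := r₀) (H := fun p => W p.2 * D p.1 p.2)
    ((hW.comp continuous_snd).mul hD) (fun t x hx => by simp [hr₀ x hx]) s t
  have hWs : BddSupp W := ⟨r₀, hr₀⟩
  refine ⟨(intervalIntegrable_iff_integrableOn_Ioc_of_le hst).2 hint.integral_prod_left, ?_⟩
  rw [intervalIntegral.integral_of_le hst,
    integral_integral_swap (f := fun r x => W x * D r x) hint,
    ← integral_sub (hWs.mul_right.integrable (hW.mul (he t (hs.trans hst))))
      (hWs.mul_right.integrable (hW.mul (he s hs)))]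
  refine integral_congr_ae (Eventually.of_forall fun x => ?_)
  simp only
  rw [integral_const_mul, ← intervalIntegral.integral_of_le hst,
    intervalIntegral.integral_eq_sub_of_hasDerivAt (f := fun r => e r x)]
  · ring
  · intro r hr
    rw [Set.uIcc_of_le hst] at hr
    exact hd r x (hs.trans hr.1)
  · exact (hD.comp (continuous_id.prodMk continuous_const)).intervalIntegrable _ _

namespace Sol

variable {δ : ℝ} {u : ℝ → Xsp d m → ℝ}

lemma pos (h : Sol β α lam V δ u) (hδ : 0 < δ) {t : ℝ} (ht : 0 ≤ t) (x : Xsp d m) : 0 < u t x :=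
  hδ.trans_le (h.lower t x ht)

lemma continuous_fderiv (h : Sol β α lam V δ u) {w : ℝ → Xsp d m} (hw : Continuous w) :
    Continuous fun p : ℝ × Xsp d m => fderiv ℝ (u p.1) p.2 (w p.1) := by
  simp only [h.fderiv_eq]
  exact (h.smooth.continuous_fderiv two_ne_zero).clm_apply
    (continuous_const.prodMk (hw.comp continuous_fst))

lemma exists_continuous_deriv_modEnt {ι : Type*} [Fintype ι] (h : Sol β α lam V δ u)
    (hδ : 0 < δ) {c : ι → ℝ → ℝ} {w : ι → ℝ → Xsp d m}
    (hc : ∀ a, ContDiff ℝ 1 (c a)) (hw : ∀ a, ContDiff ℝ 1 (w a)) :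
    ∃ D : ℝ → Xsp d m → ℝ, (Continuous fun p : ℝ × Xsp d m => D p.1 p.2) ∧
      ∀ r x, 0 ≤ r →
        HasDerivAt (fun s => modEnt (fun a => c a s) (fun a => w a s) (u s) x) (D r x) r := by
  set F : ℝ × Xsp d m → ℝ := fun p =>
    modEnt (fun a => c a p.1) (fun a => w a p.1) (u p.1) p.2 with hF
  have hFc : ∀ p : ℝ × Xsp d m, 0 ≤ p.1 → ContDiffAt ℝ 1 F p := by
    intro p hp
    have h0 : u p.1 p.2 ≠ 0 := (h.pos hδ hp p.2).ne'
    have h1 : ContDiffAt ℝ 1 (fun p : ℝ × Xsp d m => u p.1 p.2) p :=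
      (h.smooth.of_le one_le_two).contDiffAt
    have h2 : ∀ a, ContDiffAt ℝ 1 (fun p : ℝ × Xsp d m => fderiv ℝ (u p.1) p.2 (w a p.1)) p := by
      intro a
      simp only [h.fderiv_eq]
      exact (((h.smooth.fderiv_right (m := 1) (by norm_num)).clm_apply
        (contDiff_const.prodMk ((hw a).comp contDiff_fst)))).contDiffAt
    simp only [hF, modEnt]
    exact (h1.mul (h1.log h0)).add (ContDiffAt.sum fun a _ =>
      ((hc a).comp contDiff_fst).contDiffAt.mul (((h2 a).pow 2).div h1 h0))
  refine ⟨fun r x => fderiv ℝ F (max r 0, x) (1, 0), ?_, fun r x hr => ?_⟩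
  · refine continuous_iff_continuousAt.2 fun p => ?_
    have h1 : ContinuousAt (fderiv ℝ F) (max p.1 0, p.2) :=
      ((hFc (max p.1 0, p.2) (le_max_right _ _)).fderiv_right (m := 0) (by norm_num)).continuousAt
    have h2 : ContinuousAt (fun p : ℝ × Xsp d m => (max p.1 0, p.2)) p := by fun_prop
    exact (ContinuousAt.comp (f := fun p : ℝ × Xsp d m => (max p.1 0, p.2)) h1 h2).clm_apply
      continuousAt_const
  · simp only [max_eq_left hr]
    have h1 := ((hFc (r, x) hr).differentiableAt one_ne_zero).hasFDerivAt.comp_hasDerivAt r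
      ((hasDerivAt_id r).prodMk (hasDerivAt_const r x))
    exact h1

end Sol

lemma PerQ.modEnt {ι : Type*} [Fintype ι] {φ : Xsp d m → ℝ} (h : PerQ d m φ) (c : ι → ℝ)
    (w : ι → Xsp d m) : PerQ d m (modEnt c w φ) := by
  intro k x
  have h1 := fun a => h.fderiv (w a) k x
  simp only at h1
  simp only [_root_.modEnt, h1, h k x]

end

section

variable {d m : ℕ} {β Z : ℝ} {α lam : Fin m → ℝ} {V : (Fin d → ℝ) → ℝ}

/-- The dissipation density of the modified entropy. -/
def dissH (τ : ℝ) (φ : Xsp d m → ℝ) (x : Xsp d m) : ℝ := weightedSq τ (fderiv ℝ φ x) / φ x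

lemma weightedSq_nonneg (τ : ℝ) (L : Xsp d m → ℝ) : 0 ≤ weightedSq τ L := by
  unfold weightedSq
  have h1 : 0 ≤ ∑ j, ∑ i, (L (zdir d m j (Pi.single i 1))) ^ 2 :=
    Finset.sum_nonneg fun _ _ => Finset.sum_nonneg fun _ _ => sq_nonneg _
  have h2 : 0 ≤ ∑ i, (L (0, Pi.single i 1, 0)) ^ 2 := Finset.sum_nonneg fun _ _ => sq_nonneg _
  have h3 : 0 ≤ ∑ i, (L (Pi.single i 1, 0, 0)) ^ 2 := Finset.sum_nonneg fun _ _ => sq_nonneg _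
  positivity

lemma hypoC_nonneg {ε τ : ℝ} (hε : 0 < ε) (hτ : 0 ≤ τ) (a : Fin d × Fin 3) :
    0 ≤ hypoC ε τ a := by
  obtain ⟨i, k⟩ := a
  fin_cases k <;> simp [hypoC] <;> positivity

lemma hasDerivAt_hypoC (ε τ₀ b : ℝ) (a : Fin d × Fin 3) (r : ℝ) :
    HasDerivAt (fun r => hypoC ε (τ₀ + b * r) a) (hypoC ε b a) r := by
  have h : HasDerivAt (fun r => τ₀ + b * r) b r := by
    simpa using ((hasDerivAt_id r).const_mul b).const_add τ₀
  obtain ⟨i, k⟩ := a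
  fin_cases k <;> simp [hypoC] <;> exact h.const_mul _

lemma hasDerivAt_hypoW (j₀ : Fin m) (ε τ₀ b : ℝ) (a : Fin d × Fin 3) (r : ℝ) :
    HasDerivAt (fun r => hypoW j₀ ε (τ₀ + b * r) a) (hypoW' ε (τ₀ + b * r) b a) r := by
  have h : HasDerivAt (fun r => τ₀ + b * r) b r := by
    simpa using ((hasDerivAt_id r).const_mul b).const_add τ₀
  have h2 : HasDerivAt (fun r => (τ₀ + b * r) ^ 2) (2 * (τ₀ + b * r) * b) r := by
    simpa using h.fun_pow 2
  obtain ⟨i, k⟩ := a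
  fin_cases k <;> simp only [hypoW, hypoW', Fin.zero_eta, Fin.mk_one, Fin.reduceFinMk,
    Matrix.cons_val]
  · exact ((h.const_mul _).smul_const _).const_add _
  · exact (h.smul_const _).add ((h2.const_mul _).smul_const _)
  · exact h2.smul_const _

lemma contDiff_hypoC (ε τ₀ b : ℝ) (a : Fin d × Fin 3) :
    ContDiff ℝ 1 fun r => hypoC ε (τ₀ + b * r) a := by
  obtain ⟨i, k⟩ := a
  fin_cases k <;> simp [hypoC] <;> fun_prop

lemma contDiff_hypoW (j₀ : Fin m) (ε τ₀ b : ℝ) (a : Fin d × Fin 3) :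
    ContDiff ℝ 1 fun r => hypoW j₀ ε (τ₀ + b * r) a := by
  obtain ⟨i, k⟩ := a
  fin_cases k <;> simp only [hypoW, Fin.zero_eta, Fin.mk_one, Fin.reduceFinMk,
    Matrix.cons_val] <;> fun_prop

lemma tendsto_integral_weights {W : ℕ → Xsp d m → ℝ} (hWc : ∀ n, Continuous (W n))
    (hW0 : ∀ n x, 0 ≤ W n x) (hW1 : ∀ n x, W n x ≤ rho d m β Z V x)
    (hW : ∀ x, ∀ᶠ n in atTop, W n x = rho d m β Z V x) {g : Xsp d m → ℝ} (hg : Continuous g)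
    (hgi : Integrable (fun x => rho d m β Z V x * g x) (volX d m)) :
    Tendsto (fun n => ∫ x, W n x * g x ∂(volX d m)) atTop
      (nhds (∫ x, rho d m β Z V x * g x ∂(volX d m))) := by
  refine tendsto_integral_of_dominated_convergence (fun x => ‖rho d m β Z V x * g x‖)
    (fun n => ((hWc n).mul hg).aestronglyMeasurable) hgi.norm
    (fun n => Eventually.of_forall fun x => ?_) (Eventually.of_forall fun x => ?_)
  · rw [norm_mul, norm_mul]
    refine mul_le_mul_of_nonneg_right ?_ (norm_nonneg _)
    rw [Real.norm_of_nonneg (hW0 n x)]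
    exact (hW1 n x).trans (le_abs_self _)
  · refine tendsto_const_nhds.congr' ?_
    filter_upwards [hW x] with n hn
    rw [hn]

lemma Sol.continuous_dissH {δ : ℝ} {u : ℝ → Xsp d m → ℝ} (h : Sol β α lam V δ u) (hδ : 0 < δ)
    (τ₀ b : ℝ) :
    Continuous fun p : ℝ × Xsp d m => dissH (τ₀ + b * max p.1 0) (u (max p.1 0)) p.2 := by
  have hmax : Continuous fun p : ℝ × Xsp d m => ((max p.1 0, p.2) : ℝ × Xsp d m) := by fun_prop
  have h1 : ∀ v : Xsp d m, Continuous fun p : ℝ × Xsp d m => fderiv ℝ (u (max p.1 0)) p.2 v :=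
    fun v => (h.continuous_fderiv (w := fun _ => v) continuous_const).comp hmax
  have h2 : Continuous fun p : ℝ × Xsp d m => u (max p.1 0) p.2 :=
    h.smooth.continuous.comp hmax
  have h3 : Continuous fun p : ℝ × Xsp d m => τ₀ + b * max p.1 0 := by fun_prop
  have h4 : Continuous fun p : ℝ × Xsp d m =>
      weightedSq (τ₀ + b * max p.1 0) (fderiv ℝ (u (max p.1 0)) p.2) := by
    unfold weightedSq
    exact ((continuous_finsetSum _ fun j _ => continuous_finsetSum _ fun i _ =>
      (h1 _).pow 2).add ((h3.pow 2).mul (continuous_finsetSum _ fun i _ => (h1 _).pow 2))).add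
      ((h3.pow 4).mul (continuous_finsetSum _ fun i _ => (h1 _).pow 2))
  exact h4.div h2 fun p => (h.pos hδ (le_max_right _ _) _).ne'

set_option maxHeartbeats 1000000 in
/-- The modified entropy decreases at least at the rate given by the dissipation. -/
theorem Sol.entropy_ineq (hβ : 0 < β) (hα : ∀ j, 0 < α j) (hZ : 0 < Z)
    (hV : ContDiff ℝ 2 V) (hVper : PerV d V) {j₀ : Fin m} {ε κ : ℝ} (hε : 0 < ε) (hκ : 0 < κ)
    (hyp : ∀ τ b : ℝ, 0 ≤ τ → τ ≤ 1 → 0 ≤ b → b ≤ 1 → ∀ (x : Xsp d m) (L : Xsp d m →L[ℝ] ℝ),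
      -noiseSq β α L + ∑ a, (hypoC ε b a * (L (hypoW j₀ ε τ a)) ^ 2 + 2 * hypoC ε τ a *
        L (hypoW j₀ ε τ a) * L (hypoW' ε τ b a + fderiv ℝ (drift α lam V) x (hypoW j₀ ε τ a))) ≤
      -κ * weightedSq τ L)
    {δ : ℝ} {u : ℝ → Xsp d m → ℝ} (h : Sol β α lam V δ u) (hδ : 0 < δ) {τ₀ b s t B mm : ℝ}
    (hb : 0 ≤ b) (hb1 : b ≤ 1) (hs : 0 ≤ s) (hst : s ≤ t)
    (hτ : ∀ r ∈ Set.Icc s t, 0 ≤ τ₀ + b * r ∧ τ₀ + b * r ≤ 1)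
    (he : ∀ r ∈ Set.Icc s t,
      Integrable (modEnt (hypoC ε (τ₀ + b * r)) (hypoW j₀ ε (τ₀ + b * r)) (u r))
        (gibbs d m β Z V) ∧
      ∫ x, |modEnt (hypoC ε (τ₀ + b * r)) (hypoW j₀ ε (τ₀ + b * r)) (u r) x|
        ∂(gibbs d m β Z V) ≤ B)
    (hdi : ∀ r ∈ Set.Icc s t, Integrable (dissH (τ₀ + b * r) (u r)) (gibbs d m β Z V) ∧
      ∫ x, dissH (τ₀ + b * r) (u r) x ∂(gibbs d m β Z V) ≤ B)
    (hmm : ∀ r ∈ Set.Icc s t, mm ≤ ∫ x, dissH (τ₀ + b * r) (u r) x ∂(gibbs d m β Z V)) :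
    ∫ x, modEnt (hypoC ε (τ₀ + b * t)) (hypoW j₀ ε (τ₀ + b * t)) (u t) x ∂(gibbs d m β Z V) +
      κ * ((t - s) * mm) ≤
    ∫ x, modEnt (hypoC ε (τ₀ + b * s)) (hypoW j₀ ε (τ₀ + b * s)) (u s) x ∂(gibbs d m β Z V) := by
  obtain ⟨C, hC, W, hW2, hWp, hWs, hW0, hW1, hWa, hWt⟩ :=
    exists_weights (lam := lam) hβ hα hZ hV hVper
  have hWc : ∀ n, Continuous (W n) := fun n => (hW2 n).continuous
  have hVc := hV.continuous
  have hrc : Continuous (rho d m β Z V) := continuous_rho hVc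
  set e : ℝ → Xsp d m → ℝ := fun r =>
    modEnt (hypoC ε (τ₀ + b * r)) (hypoW j₀ ε (τ₀ + b * r)) (u r) with he_def
  obtain ⟨D, hDc, hD⟩ := h.exists_continuous_deriv_modEnt hδ
    (contDiff_hypoC (d := d) ε τ₀ b) (contDiff_hypoW j₀ ε τ₀ b)
  have hereg : ∀ r, 0 ≤ r → Reg (e r) := fun r hr => (h.regTwo r).reg_modEnt (h.pos hδ hr) _ _
  have hec : ∀ r, 0 ≤ r → Continuous (e r) := fun r hr => (hereg r hr).1.continuous
  -- the dissipation, extended continuously to negative times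
  obtain ⟨dd, hdd⟩ : ∃ dd : ℝ → Xsp d m → ℝ,
      dd = fun r x => dissH (τ₀ + b * max r 0) (u (max r 0)) x := ⟨_, rfl⟩
  have hddr : ∀ r ∈ Set.Icc s t, dd r = dissH (τ₀ + b * r) (u r) := fun r hr => by
    funext x
    simp only [hdd, max_eq_left (hs.trans hr.1)]
  have hddc : Continuous fun p : ℝ × Xsp d m => dd p.1 p.2 := by
    rw [hdd]; exact h.continuous_dissH hδ τ₀ b
  have hddx : ∀ r, Continuous (dd r) := fun r => hddc.comp (continuous_const.prodMk continuous_id)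
  have hdd0 : ∀ r x, 0 ≤ dd r x := fun r x => by
    rw [hdd]
    exact div_nonneg (weightedSq_nonneg _ _) (h.pos hδ (le_max_right _ _) _).le
  have hddi : ∀ r ∈ Set.Icc s t, Integrable (fun x => rho d m β Z V x * dd r x) (volX d m) :=
    fun r hr => by rw [hddr r hr]; exact (integrable_gibbs hVc hZ).1 (hdi r hr).1
  have hddB : ∀ r ∈ Set.Icc s t, ∫ x, rho d m β Z V x * dd r x ∂(volX d m) ≤ B := fun r hr => by
    rw [hddr r hr, ← integral_gibbs hVc hZ]; exact (hdi r hr).2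
  have hddm : ∀ r ∈ Set.Icc s t, mm ≤ ∫ x, rho d m β Z V x * dd r x ∂(volX d m) := fun r hr => by
    rw [hddr r hr, ← integral_gibbs hVc hZ]; exact hmm r hr
  -- the pointwise inequality
  have hpt : ∀ r ∈ Set.Icc s t, ∀ x, D r x ≤ backOp β α lam V (e r) x - κ * dd r x := by
    intro r hr x
    have hr0 := hs.trans hr.1
    have hu := h.pos hδ hr0 x
    have h1 := (hD r x hr0).unique (h.hasDerivAt_modEnt hδ hV hr0
      (fun a => hasDerivAt_hypoC ε τ₀ b a r) (fun a => hasDerivAt_hypoW j₀ ε τ₀ b a r) x)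
    rw [h1]
    refine (modEntDot_le hβ hα (h.regTwo r) (h.pos hδ hr0)
      (fun a => hypoC_nonneg hε (hτ r hr).1 a) _ _ _ x).trans ?_
    have h2 := mul_le_mul_of_nonneg_left (hyp _ b (hτ r hr).1 (hτ r hr).2 hb hb1 x
      (fderiv ℝ (u r) x)) (one_div_pos.2 hu).le
    have h3 : 1 / u r x * (-κ * weightedSq (τ₀ + b * r) (fderiv ℝ (u r) x)) = -(κ * dd r x) := by
      rw [hddr r hr]; unfold dissH; ring
    rw [h3] at h2
    exact (add_le_add_right h2 _).trans (by rw [sub_eq_add_neg])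
  -- the weighted inequality
  have hw : ∀ n r, r ∈ Set.Icc s t → ∫ x, W n x * D r x ∂(volX d m) ≤
      C / (n + 1) * B - κ * ∫ x, W n x * dd r x ∂(volX d m) := by
    intro n r hr
    have hr0 := hs.trans hr.1
    have c1 : Continuous (backOp β α lam V (e r)) := by
      have h1 : Continuous (fun x => fderiv ℝ (e r) x (drift α lam V x)) :=
        ((hereg r hr0).1.continuous_fderiv one_ne_zero).clm_apply (contDiff_drift hV).continuous
      have h2 : ∀ j k, Continuous fun x =>
          fderiv ℝ (pZ d m j k (e r)) x (zdir d m j (Pi.single k 1)) :=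
        fun j k => (((hereg r hr0).2 j k).continuous_fderiv one_ne_zero).clm_apply continuous_const
      unfold backOp
      fun_prop
    have i1 : Integrable (fun x => W n x * backOp β α lam V (e r) x) (volX d m) :=
      (hWs n).mul_right.integrable ((hWc n).mul c1)
    have i2 : Integrable (fun x => κ * (W n x * dd r x)) (volX d m) :=
      ((hWs n).mul_right.integrable ((hWc n).mul (hddx r))).const_mul κ
    have i3 : Integrable (fun x => W n x * D r x) (volX d m) :=
      (hWs n).mul_right.integrable ((hWc n).mul (hDc.comp (continuous_const.prodMk continuous_id)))
    have e1 : ∫ x, W n x * D r x ∂(volX d m) ≤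
        ∫ x, (W n x * backOp β α lam V (e r) x - κ * (W n x * dd r x)) ∂(volX d m) := by
      refine integral_mono i3 (i1.sub i2) fun x => ?_
      have := mul_le_mul_of_nonneg_left (hpt r hr x) (hW0 n x)
      calc _ ≤ _ := this
        _ = _ := by ring
    rw [integral_sub i1 i2, integral_const_mul, integral_mul_backOp hV hVper (hW2 n) (hWp n) (hWs n)
      (hereg r hr0) ((h.per r hr0).modEnt _ _)] at e1
    have i4 : Integrable (fun x => C / (n + 1) * (rho d m β Z V x * |e r x|)) (volX d m) :=
      ((integrable_gibbs hVc hZ).1 (he r hr).1.abs).const_mul _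
    have e2 := norm_integral_le_of_norm_le i4 (f := fun x => e r x * adjOp β α lam V (W n) x)
      (Eventually.of_forall fun x => by
        rw [norm_mul, Real.norm_eq_abs, Real.norm_eq_abs]
        calc _ ≤ |e r x| * (C / (n + 1) * rho d m β Z V x) :=
              mul_le_mul_of_nonneg_left (hWa n x) (abs_nonneg _)
          _ = _ := by ring)
    rw [integral_const_mul, ← integral_gibbs hVc hZ] at e2
    have e3 := mul_le_mul_of_nonneg_left (he r hr).2
      (by positivity : (0 : ℝ) ≤ C / (n + 1))
    have e4 := (le_abs_self _).trans e2
    linarith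
  -- integrability in time
  have hJint : ∀ n, IntervalIntegrable (fun r => ∫ x, W n x * dd r x ∂(volX d m)) volume s t := by
    intro n
    obtain ⟨r₀, hr₀⟩ := hWs n
    exact (intervalIntegrable_iff_integrableOn_Ioc_of_le hst).2
      (integrable_prod_of_bddSupp (r := r₀) (H := fun p => W n p.2 * dd p.1 p.2)
        (((hWc n).comp continuous_snd).mul hddc)
        (fun t x hx => by simp [hr₀ x hx]) s t).integral_prod_left
  have hIint : IntervalIntegrable (fun r => ∫ x, rho d m β Z V x * dd r x ∂(volX d m))
      volume s t := by
    have hsm : StronglyMeasurable fun r => ∫ x, rho d m β Z V x * dd r x ∂(volX d m) :=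
      (((hrc.comp continuous_snd).mul hddc).stronglyMeasurable
        (f := fun p : ℝ × Xsp d m => rho d m β Z V p.2 * dd p.1 p.2)).integral_prod_right'
    refine (intervalIntegrable_const (c := B)).mono_fun hsm.aestronglyMeasurable ?_
    refine (ae_restrict_iff' measurableSet_uIoc).2 (Eventually.of_forall fun r hr => ?_)
    rw [Set.uIoc_of_le hst] at hr
    have hr' := Set.Ioc_subset_Icc_self hr
    have h0 : 0 ≤ ∫ x, rho d m β Z V x * dd r x ∂(volX d m) :=
      integral_nonneg fun x => mul_nonneg (rho_pos hZ x).le (hdd0 r x)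
    refine (Real.norm_of_nonneg h0).le.trans ?_
    exact (hddB r hr').trans (le_abs_self _)
  have hJle : ∀ n r, r ∈ Set.Icc s t → ∫ x, W n x * dd r x ∂(volX d m) ≤ B := fun n r hr =>
    (integral_mono ((hWs n).mul_right.integrable ((hWc n).mul (hddx r))) (hddi r hr) fun x =>
      mul_le_mul_of_nonneg_right (hW1 n x) (hdd0 r x)).trans (hddB r hr)
  have hJlim : Tendsto (fun n => ∫ r in s..t, ∫ x, W n x * dd r x ∂(volX d m)) atTop
      (nhds (∫ r in s..t, ∫ x, rho d m β Z V x * dd r x ∂(volX d m))) := by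
    refine intervalIntegral.tendsto_integral_filter_of_dominated_convergence (fun _ => B)
      (Eventually.of_forall fun n => ?_) (Eventually.of_forall fun n => ?_)
      intervalIntegrable_const ?_
    · rw [Set.uIoc_of_le hst]
      exact ((intervalIntegrable_iff_integrableOn_Ioc_of_le hst).1 (hJint n)).aestronglyMeasurable
    · refine Eventually.of_forall fun r hr => ?_
      rw [Set.uIoc_of_le hst] at hr
      rw [Real.norm_of_nonneg (integral_nonneg fun x => mul_nonneg (hW0 n x) (hdd0 r x))]
      exact hJle n r (Set.Ioc_subset_Icc_self hr)
    · refine Eventually.of_forall fun r hr => ?_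
      rw [Set.uIoc_of_le hst] at hr
      exact tendsto_integral_weights hWc hW0 hW1 hWt (hddx r) (hddi r (Set.Ioc_subset_Icc_self hr))
  have hmain : ∀ n : ℕ, (∫ x, W n x * e t x ∂(volX d m)) - ∫ x, W n x * e s x ∂(volX d m) ≤
      (t - s) * (C / (n + 1) * B) - κ * ∫ r in s..t, ∫ x, W n x * dd r x ∂(volX d m) := by
    intro n
    obtain ⟨k1, k2⟩ := weighted_evolution hec hDc hD (hWc n) (hWs n) hs hst
    rw [k2]
    have k3 : IntervalIntegrable (fun _ : ℝ => C / (n + 1) * B) volume s t :=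
      intervalIntegrable_const
    calc _ ≤ ∫ r in s..t, (C / (n + 1) * B - κ * ∫ x, W n x * dd r x ∂(volX d m)) :=
          intervalIntegral.integral_mono_on hst k1 (k3.sub ((hJint n).const_mul κ))
            fun r hr => hw n r hr
      _ = _ := by
        rw [intervalIntegral.integral_sub k3 ((hJint n).const_mul κ),
          intervalIntegral.integral_const, smul_eq_mul]
        simp only [intervalIntegral.integral_const_mul]
  have hEs := he s (Set.left_mem_Icc.2 hst)
  have hEt := he t (Set.right_mem_Icc.2 hst)
  have l1 := (tendsto_integral_weights hWc hW0 hW1 hWt (hec t (hs.trans hst))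
    ((integrable_gibbs hVc hZ).1 hEt.1)).sub (tendsto_integral_weights hWc hW0 hW1 hWt (hec s hs)
    ((integrable_gibbs hVc hZ).1 hEs.1))
  have l2 : Tendsto (fun n : ℕ => (t - s) * (C / ((n : ℝ) + 1) * B)) atTop (nhds 0) := by
    have := ((tendsto_const_div_atTop_nhds_zero_nat C).comp (tendsto_add_atTop_nat 1))
    have := (this.mul_const B).const_mul (t - s)
    simpa using this
  have l3 := le_of_tendsto_of_tendsto' l1 (l2.sub (hJlim.const_mul κ)) hmain
  rw [← integral_gibbs hVc hZ, ← integral_gibbs hVc hZ] at l3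
  have l4 : (t - s) * mm ≤ ∫ r in s..t, ∫ x, rho d m β Z V x * dd r x ∂(volX d m) := by
    have := intervalIntegral.integral_mono_on hst (intervalIntegrable_const (c := mm)) hIint
      fun r hr => hddm r hr
    rwa [intervalIntegral.integral_const, smul_eq_mul] at this
  have l5 := mul_le_mul_of_nonneg_left l4 hκ.le
  linarith

end

section

variable {d m : ℕ} {β Z : ℝ} {α lam : Fin m → ℝ} {V : (Fin d → ℝ) → ℝ}

lemma weightedSq_one (φ : Xsp d m → ℝ) (x : Xsp d m) :
    weightedSq 1 (fderiv ℝ φ x) = gradSq d m φ x := by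
  simp only [weightedSq, gradSq, pZ, pP, pQ]; ring

lemma weightedSq_le {τ : ℝ} (hτ : 0 ≤ τ) (hτ1 : τ ≤ 1) (L : Xsp d m → ℝ) :
    weightedSq τ L ≤ weightedSq 1 L := by
  unfold weightedSq
  have h2 : 0 ≤ ∑ i, (L (0, Pi.single i 1, 0)) ^ 2 := Finset.sum_nonneg fun _ _ => sq_nonneg _
  have h3 : 0 ≤ ∑ i, (L (Pi.single i 1, 0, 0)) ^ 2 := Finset.sum_nonneg fun _ _ => sq_nonneg _
  have h4 := mul_le_mul_of_nonneg_right (pow_le_one₀ hτ hτ1 (n := 2)) h2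
  have h5 := mul_le_mul_of_nonneg_right (pow_le_one₀ hτ hτ1 (n := 4)) h3
  linarith

lemma hypoC_mul_le (j₀ : Fin m) {ε τ : ℝ} (hε : 0 < ε) (hε1 : ε ≤ 1) (hτ : 0 ≤ τ) (hτ1 : τ ≤ 1)
    (L : Xsp d m →L[ℝ] ℝ) :
    ∑ a, hypoC ε τ a * (L (hypoW j₀ ε τ a)) ^ 2 ≤ 4 * weightedSq 1 L := by
  have key : ∀ c : ℝ, 0 ≤ c → c ≤ 1 → ∀ a b x y : ℝ, 0 ≤ a → a ≤ 1 → 0 ≤ b → b ≤ 1 →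
      c * (a * x + b * y) ^ 2 ≤ 2 * x ^ 2 + 2 * y ^ 2 := by
    intro c hc hc1 a b x y ha ha1 hb hb1
    have h1 : (a * x + b * y) ^ 2 ≤ 2 * (a * x) ^ 2 + 2 * (b * y) ^ 2 := by
      nlinarith [sq_nonneg (a * x - b * y)]
    have h2 : (a * x) ^ 2 ≤ x ^ 2 := by
      rw [mul_pow]; exact mul_le_of_le_one_left (sq_nonneg _) (pow_le_one₀ ha ha1)
    have h3 : (b * y) ^ 2 ≤ y ^ 2 := by
      rw [mul_pow]; exact mul_le_of_le_one_left (sq_nonneg _) (pow_le_one₀ hb hb1)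
    have h4 := mul_le_of_le_one_left (sq_nonneg (a * x + b * y)) hc1
    linarith
  have he : ∀ n, 0 ≤ ε ^ n ∧ ε ^ n ≤ 1 := fun n => ⟨by positivity, pow_le_one₀ hε.le hε1⟩
  have ht : ∀ n, 0 ≤ τ ^ n ∧ τ ^ n ≤ 1 := fun n => ⟨by positivity, pow_le_one₀ hτ hτ1⟩
  have het : ∀ n k, 0 ≤ ε ^ n * τ ^ k ∧ ε ^ n * τ ^ k ≤ 1 := fun n k =>
    ⟨by positivity, mul_le_one₀ (he n).2 (ht k).1 (ht k).2⟩
  have het1 : ∀ n, 0 ≤ ε ^ n * τ ∧ ε ^ n * τ ≤ 1 := fun n => by simpa using het n 1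
  have hi : ∀ i : Fin d, ∑ k, hypoC ε τ (i, k) * (L (hypoW j₀ ε τ (i, k))) ^ 2 ≤
      4 * ((L (zdir d m j₀ (Pi.single i 1))) ^ 2 + (L (0, Pi.single i 1, 0)) ^ 2 +
        (L (Pi.single i 1, 0, 0)) ^ 2) := by
    intro i
    simp only [Fin.sum_univ_three, hypoC, hypoW, Matrix.cons_val, map_add, map_smul, smul_eq_mul]
    have k1 := key _ (het1 10).1 (het1 10).2 1 (ε ^ 8 * τ) (L (zdir d m j₀ (Pi.single i 1)))
      (L (0, Pi.single i 1, 0)) zero_le_one le_rfl (het1 8).1 (het1 8).2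
    have k2 := key _ (het1 24).1 (het1 24).2 τ (ε ^ 4 * τ ^ 2) (L (0, Pi.single i 1, 0))
      (L (Pi.single i 1, 0, 0)) hτ hτ1 (het 4 2).1 (het 4 2).2
    have k3 := key _ (het1 30).1 (het1 30).2 0 (τ ^ 2) 0
      (L (Pi.single i 1, 0, 0)) le_rfl zero_le_one (ht 2).1 (ht 2).2
    rw [one_mul] at k1
    rw [zero_mul, zero_add] at k3
    nlinarith [sq_nonneg (L (zdir d m j₀ (Pi.single i 1))), sq_nonneg (L (Pi.single i 1, 0, 0))]
  rw [Fintype.sum_prod_type]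
  refine (Finset.sum_le_sum fun i _ => hi i).trans ?_
  rw [← Finset.mul_sum]
  refine mul_le_mul_of_nonneg_left ?_ (by norm_num)
  simp only [Finset.sum_add_distrib, weightedSq, one_pow, one_mul]
  have := Finset.single_le_sum (s := Finset.univ) (a := j₀)
    (f := fun j => ∑ i, (L (zdir d m j (Pi.single i 1))) ^ 2)
    (fun j _ => Finset.sum_nonneg fun _ _ => sq_nonneg _) (Finset.mem_univ _)
  linarith

lemma mul_log_le_modEnt {ε τ : ℝ} (j₀ : Fin m) (hε : 0 < ε) (hτ : 0 ≤ τ)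
    {φ : Xsp d m → ℝ} {x : Xsp d m} (hφ : 0 < φ x) :
    φ x * log (φ x) ≤ modEnt (hypoC ε τ) (hypoW j₀ ε τ) φ x :=
  le_add_of_nonneg_right (Finset.sum_nonneg fun a _ =>
    mul_nonneg (hypoC_nonneg hε hτ a) (by positivity))

lemma modEnt_le {ε τ : ℝ} (j₀ : Fin m) (hε : 0 < ε) (hε1 : ε ≤ 1) (hτ : 0 ≤ τ) (hτ1 : τ ≤ 1)
    {φ : Xsp d m → ℝ} {x : Xsp d m} (hφ : 0 < φ x) :
    modEnt (hypoC ε τ) (hypoW j₀ ε τ) φ x ≤ φ x * log (φ x) + 4 * dissH 1 φ x := by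
  have h := div_le_div_of_nonneg_right (hypoC_mul_le j₀ hε hε1 hτ hτ1 (fderiv ℝ φ x)) hφ.le
  rw [Finset.sum_div, mul_div_assoc] at h
  simp only [mul_div_assoc] at h
  exact add_le_add_right h _

lemma modEnt_zero {ε : ℝ} (j₀ : Fin m) (φ : Xsp d m → ℝ) (x : Xsp d m) :
    modEnt (hypoC ε 0) (hypoW j₀ ε 0) φ x = φ x * log (φ x) := by
  have : ∀ a : Fin d × Fin 3, hypoC ε 0 a = 0 := by
    rintro ⟨i, k⟩; fin_cases k <;> simp [hypoC]
  simp [modEnt, this]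

lemma abs_mul_log_le {s : ℝ} (hs : 0 < s) : |s * log s| ≤ s ^ 2 + 1 := by
  have h1 := Real.log_le_sub_one_of_pos hs
  have h2 := Real.one_sub_inv_le_log_of_pos hs
  have h3 : s - 1 ≤ s * log s := by
    calc s - 1 = s * (1 - s⁻¹) := by field_simp
      _ ≤ _ := mul_le_mul_of_nonneg_left h2 hs.le
  have h4 := mul_le_mul_of_nonneg_left h1 hs.le
  rw [abs_le]
  constructor <;> nlinarith

/-- Local-in-time `H¹` bounds with respect to the Gibbs measure. -/
def BddH1 (β Z : ℝ) (V : (Fin d → ℝ) → ℝ) (u : ℝ → Xsp d m → ℝ) : Prop :=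
  ∀ T : ℝ, ∃ M : ℝ, ∀ t ∈ Set.Icc 0 T,
    (Integrable (fun x => (u t x) ^ 2) (gibbs d m β Z V) ∧
      ∫ x, (u t x) ^ 2 ∂(gibbs d m β Z V) ≤ M) ∧
    Integrable (fun x => gradSq d m (u t) x) (gibbs d m β Z V) ∧
      ∫ x, gradSq d m (u t) x ∂(gibbs d m β Z V) ≤ M

namespace Sol

variable {δ : ℝ} {u : ℝ → Xsp d m → ℝ}

lemma continuous_dissH_apply (h : Sol β α lam V δ u) (hδ : 0 < δ) (τ : ℝ) {t : ℝ} (ht : 0 ≤ t) :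
    Continuous (dissH τ (u t)) := by
  have := (h.continuous_dissH hδ τ 0).comp (Continuous.prodMk_right t)
  simpa [Function.comp_def, max_eq_left ht] using this

lemma dissH_le (h : Sol β α lam V δ u) (hδ : 0 < δ) {τ : ℝ} (hτ : 0 ≤ τ) (hτ1 : τ ≤ 1)
    {t : ℝ} (ht : 0 ≤ t) (x : Xsp d m) : dissH τ (u t) x ≤ gradSq d m (u t) x / δ := by
  have h1 := weightedSq_le hτ hτ1 (fderiv ℝ (u t) x)
  rw [weightedSq_one] at h1
  exact div_le_div₀ ((weightedSq_nonneg _ _).trans h1) h1 hδ (h.lower t x ht)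

lemma dissH_nonneg (h : Sol β α lam V δ u) (hδ : 0 < δ) (τ : ℝ)
    {t : ℝ} (ht : 0 ≤ t) (x : Xsp d m) : 0 ≤ dissH τ (u t) x :=
  div_nonneg (weightedSq_nonneg _ _) (h.pos hδ ht x).le

lemma integrable_dissH (h : Sol β α lam V δ u) (hδ : 0 < δ) (hu : BddH1 β Z V u)
    {τ : ℝ} (hτ : 0 ≤ τ) (hτ1 : τ ≤ 1) {t : ℝ} (ht : 0 ≤ t) :
    Integrable (dissH τ (u t)) (gibbs d m β Z V) := by
  obtain ⟨M, hM⟩ := hu t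
  refine ((hM t ⟨ht, le_rfl⟩).2.1.div_const δ).mono'
    (h.continuous_dissH_apply hδ τ ht).aestronglyMeasurable (Eventually.of_forall fun x => ?_)
  rw [Real.norm_of_nonneg (h.dissH_nonneg hδ τ ht x)]
  exact h.dissH_le hδ hτ hτ1 ht x

lemma abs_modEnt_le (h : Sol β α lam V δ u) (hδ : 0 < δ) {ε τ : ℝ} (j₀ : Fin m) (hε : 0 < ε)
    (hε1 : ε ≤ 1) (hτ : 0 ≤ τ) (hτ1 : τ ≤ 1) {t : ℝ} (ht : 0 ≤ t) (x : Xsp d m) :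
    |modEnt (hypoC ε τ) (hypoW j₀ ε τ) (u t) x| ≤
      (u t x) ^ 2 + 1 + 4 / δ * gradSq d m (u t) x := by
  have hu := h.pos hδ ht x
  have h1 := mul_log_le_modEnt j₀ hε hτ hu
  have h2 := modEnt_le j₀ hε hε1 hτ hτ1 hu
  have h3 := h.dissH_le hδ zero_le_one le_rfl ht x
  have h4 := h.dissH_nonneg hδ 1 ht x
  have h5 := abs_le.1 (abs_mul_log_le hu)
  have h6 : 4 / δ * gradSq d m (u t) x = 4 * (gradSq d m (u t) x / δ) := by ring
  rw [h6, abs_le]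
  constructor <;> linarith

variable [IsProbabilityMeasure (gibbs d m β Z V)]

lemma integrable_modEnt (h : Sol β α lam V δ u) (hδ : 0 < δ) (hu : BddH1 β Z V u)
    {ε τ : ℝ} (j₀ : Fin m) (hε : 0 < ε) (hε1 : ε ≤ 1) (hτ : 0 ≤ τ) (hτ1 : τ ≤ 1)
    {t : ℝ} (ht : 0 ≤ t) :
    Integrable (modEnt (hypoC ε τ) (hypoW j₀ ε τ) (u t)) (gibbs d m β Z V) := by
  obtain ⟨M, hM⟩ := hu t
  have h1 := hM t ⟨ht, le_rfl⟩
  refine ((h1.1.1.add (integrable_const 1)).add (h1.2.1.const_mul (4 / δ))).mono'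
    ((h.regTwo t).reg_modEnt (h.pos hδ ht) _ _).1.continuous.aestronglyMeasurable
    (Eventually.of_forall fun x => ?_)
  exact h.abs_modEnt_le hδ j₀ hε hε1 hτ hτ1 ht x

lemma exists_bound (h : Sol β α lam V δ u) (hδ : 0 < δ) (hu : BddH1 β Z V u)
    {ε : ℝ} (j₀ : Fin m) (hε : 0 < ε) (hε1 : ε ≤ 1) (T : ℝ) :
    ∃ B : ℝ, ∀ t ∈ Set.Icc 0 T, ∀ τ, 0 ≤ τ → τ ≤ 1 →
      ∫ x, |modEnt (hypoC ε τ) (hypoW j₀ ε τ) (u t) x| ∂(gibbs d m β Z V) ≤ B ∧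
      ∫ x, dissH τ (u t) x ∂(gibbs d m β Z V) ≤ B := by
  obtain ⟨M, hM⟩ := hu T
  refine ⟨max (M + 1 + 4 / δ * M) (M / δ), fun t ht τ hτ hτ1 => ?_⟩
  obtain ⟨⟨i1, b1⟩, i2, b2⟩ := hM t ht
  have hd : 0 ≤ 4 / δ := by positivity
  constructor
  · refine le_trans ?_ (le_max_left _ _)
    have i3 : Integrable (fun x => (u t x) ^ 2 + 1) (gibbs d m β Z V) :=
      i1.add (integrable_const 1)
    have i4 := i2.const_mul (4 / δ)
    refine (integral_mono (h.integrable_modEnt hδ hu j₀ hε hε1 hτ hτ1 ht.1).abs (i3.add i4)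
      fun x => h.abs_modEnt_le hδ j₀ hε hε1 hτ hτ1 ht.1 x).trans ?_
    have e1 := integral_add i3 i4
    have e2 := integral_add i1 (integrable_const (μ := gibbs d m β Z V) (1 : ℝ))
    rw [integral_const_mul] at e1
    simp only [integral_const, probReal_univ, smul_eq_mul, mul_one] at e2
    have e3 := mul_le_mul_of_nonneg_left b2 hd
    refine e1.le.trans ?_
    linarith
  · refine le_trans ?_ (le_max_right _ _)
    refine (integral_mono (h.integrable_dissH hδ hu hτ hτ1 ht.1) (i2.div_const δ)
      fun x => h.dissH_le hδ hτ hτ1 ht.1 x).trans ?_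
    rw [integral_div]
    exact div_le_div_of_nonneg_right b2 hδ.le

end Sol

/-- Jensen's inequality for the entropy. -/
lemma mul_log_le_integral {Y : Type*} [MeasurableSpace Y] {μ : Measure Y} [IsProbabilityMeasure μ]
    {u : Y → ℝ} (h0 : ∀ x, 0 < u x) (hu : Integrable u μ)
    (hul : Integrable (fun x => u x * log (u x)) μ) (hN : 0 < ∫ x, u x ∂μ) :
    (∫ x, u x ∂μ) * log (∫ x, u x ∂μ) ≤ ∫ x, u x * log (u x) ∂μ := by
  set N := ∫ x, u x ∂μ with hN_def
  have i1 : Integrable (fun x => (1 + log N) * u x - N) μ :=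
    (hu.const_mul _).sub (integrable_const _)
  have h1 := integral_mono i1 hul fun x => by
    have h2 := Real.log_le_sub_one_of_pos (div_pos hN (h0 x))
    rw [Real.log_div hN.ne' (h0 x).ne'] at h2
    have h3 := mul_le_mul_of_nonneg_left h2 (h0 x).le
    have h4 : u x * (N / u x - 1) = N - u x := by
      have := (h0 x).ne'
      field_simp
    simp only
    nlinarith
  rw [integral_sub (hu.const_mul _) (integrable_const _), integral_const_mul] at h1
  simp only [integral_const, probReal_univ, smul_eq_mul, one_mul] at h1
  linarith

end

section

variable {d m : ℕ} {β Z : ℝ} {α lam : Fin m → ℝ} {V : (Fin d → ℝ) → ℝ}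

lemma exp_decay_of_step {E : ℝ → ℝ} {k : ℝ} (hk : 0 < k)
    (hE : ∀ s t, 1 ≤ s → s ≤ t → E t ≤ E s) (h1 : ∀ s, 1 ≤ s → (1 + k) * E (s + 1) ≤ E s)
    (h0 : 0 ≤ E 1) {t : ℝ} (ht : 1 ≤ t) :
    E t ≤ exp (2 * log (1 + k)) * exp (-log (1 + k) * t) * E 1 := by
  have hk1 : 0 < 1 + k := by linarith
  have hn : ∀ n : ℕ, E (1 + n) ≤ exp (-log (1 + k) * n) * E 1 := by
    intro n
    induction n with
    | zero => simp
    | succ n ih =>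
      have h2 := h1 (1 + n) (by linarith [Nat.cast_nonneg (α := ℝ) n])
      have h3 : E (1 + n + 1) ≤ (1 + k)⁻¹ * E (1 + n) := by
        rw [← div_eq_inv_mul, le_div_iff₀ hk1]; linarith
      have h4 : exp (-log (1 + k) * ((n + 1 : ℕ) : ℝ)) = (1 + k)⁻¹ * exp (-log (1 + k) * n) := by
        push_cast
        rw [mul_add, Real.exp_add, mul_one, Real.exp_neg, Real.exp_log hk1, mul_comm]
      rw [h4, mul_assoc]
      push_cast
      rw [← add_assoc]
      exact h3.trans (mul_le_mul_of_nonneg_left ih (inv_nonneg.2 hk1.le))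
  have hf := Nat.floor_le (sub_nonneg.2 ht)
  have hf2 := Nat.lt_floor_add_one (t - 1)
  have hl : 0 < log (1 + k) := Real.log_pos (by linarith)
  refine (hE (1 + ⌊t - 1⌋₊) t (by linarith [Nat.cast_nonneg (α := ℝ) ⌊t - 1⌋₊])
    (by linarith)).trans ((hn _).trans (mul_le_mul_of_nonneg_right ?_ h0))
  rw [← Real.exp_add, Real.exp_le_exp]
  nlinarith

/-- Exponential decay of the entropy for solutions bounded away from zero. -/
theorem exists_decay_sol (hm : 1 ≤ m) (hβ : 0 < β) (hα : ∀ j, 0 < α j) (hlam : ∀ j, 0 < lam j)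
    (hV : ContDiff ℝ 2 V) (hVper : PerV d V) (hZ : 0 < Z)
    [IsProbabilityMeasure (gibbs d m β Z V)] :
    ∃ C a : ℝ, 0 < C ∧ 0 < a ∧ ∀ (δ : ℝ) (u : ℝ → Xsp d m → ℝ), 0 < δ → Sol β α lam V δ u →
      BddH1 β Z V u → ∀ N : ℝ, 0 < N → (∀ t, 0 ≤ t → Integrable (u t) (gibbs d m β Z V) ∧
        ∫ x, u t x ∂(gibbs d m β Z V) = N) → ∀ t, 0 ≤ t →
      (∫ x, u t x * log (u t x) ∂(gibbs d m β Z V)) - N * log N ≤ C * exp (-a * t) *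
        ((∫ x, u 0 x * log (u 0 x) ∂(gibbs d m β Z V)) - N * log N) := by
  obtain ⟨j₀, ε, κ, hε, hε1, hκ, hyp⟩ :=
    exists_hypo (β := β) hm hβ hα hlam hV hVper
  obtain ⟨K, hK, hls⟩ := exists_logSobolev_gibbs (m := m) hβ hZ hV.continuous
  have hk : 0 < κ / (K + 4) := by positivity
  have hl : 0 < log (1 + κ / (K + 4)) := Real.log_pos (by linarith)
  refine ⟨exp (2 * log (1 + κ / (K + 4))), log (1 + κ / (K + 4)), exp_pos _, hl, ?_⟩
  intro δ u hδ h hu N hN hmass t ht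
  set E : ℝ → ℝ → ℝ := fun τ r =>
    (∫ x, modEnt (hypoC ε τ) (hypoW j₀ ε τ) (u r) x ∂(gibbs d m β Z V)) - N * log N with hE
  have hstep : ∀ τ₀ b s t mm : ℝ, 0 ≤ b → b ≤ 1 → 0 ≤ s → s ≤ t →
      (∀ r ∈ Set.Icc s t, 0 ≤ τ₀ + b * r ∧ τ₀ + b * r ≤ 1) →
      (∀ r ∈ Set.Icc s t, mm ≤ ∫ x, dissH (τ₀ + b * r) (u r) x ∂(gibbs d m β Z V)) →
      E (τ₀ + b * t) t + κ * ((t - s) * mm) ≤ E (τ₀ + b * s) s := by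
    intro τ₀ b s t mm hb hb1 hs hst hτ hmm
    obtain ⟨B, hB⟩ := h.exists_bound hδ hu j₀ hε hε1 t
    have := h.entropy_ineq hβ hα hZ hV hVper hε hκ hyp hδ (τ₀ := τ₀) (B := B) (mm := mm)
      hb hb1 hs hst hτ
      (fun r hr => ⟨h.integrable_modEnt hδ hu j₀ hε hε1 (hτ r hr).1 (hτ r hr).2 (hs.trans hr.1),
        (hB r ⟨hs.trans hr.1, hr.2⟩ _ (hτ r hr).1 (hτ r hr).2).1⟩)
      (fun r hr => ⟨h.integrable_dissH hδ hu (hτ r hr).1 (hτ r hr).2 (hs.trans hr.1),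
        (hB r ⟨hs.trans hr.1, hr.2⟩ _ (hτ r hr).1 (hτ r hr).2).2⟩) hmm
    simp only [hE]
    linarith
  have hdiss0 : ∀ τ r, 0 ≤ r → 0 ≤ ∫ x, dissH τ (u r) x ∂(gibbs d m β Z V) := fun τ r hr =>
    integral_nonneg fun x => h.dissH_nonneg hδ τ hr x
  have hent : ∀ r, 0 ≤ r →
      Integrable (fun x => u r x * log (u r x)) (gibbs d m β Z V) := fun r hr => by
    rw [← funext fun x => modEnt_zero (ε := ε) j₀ (u r) x]
    exact h.integrable_modEnt hδ hu j₀ hε hε1 le_rfl zero_le_one hr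
  have hjen : ∀ r, 0 ≤ r → 0 ≤ (∫ x, u r x * log (u r x) ∂(gibbs d m β Z V)) - N * log N := by
    intro r hr
    have := mul_log_le_integral (h.pos hδ hr) (hmass r hr).1 (hent r hr) (by rwa [(hmass r hr).2])
    rw [(hmass r hr).2] at this
    linarith
  have hle : ∀ τ r, 0 ≤ τ → τ ≤ 1 → 0 ≤ r →
      (∫ x, u r x * log (u r x) ∂(gibbs d m β Z V)) - N * log N ≤ E τ r := fun τ r hτ hτ1 hr =>
    sub_le_sub_right (integral_mono (hent r hr)
      (h.integrable_modEnt hδ hu j₀ hε hε1 hτ hτ1 hr)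
      fun x => mul_log_le_modEnt j₀ hε hτ (h.pos hδ hr x)) _
  have hE0 : E 0 0 = (∫ x, u 0 x * log (u 0 x) ∂(gibbs d m β Z V)) - N * log N := by
    simp only [hE, modEnt_zero]
  have hreg : ∀ r, 0 ≤ r → r ≤ 1 → E r r ≤ E 0 0 := by
    intro r hr hr1
    have := hstep 0 1 0 r 0 zero_le_one le_rfl le_rfl hr
      (fun q hq => by constructor <;> linarith [hq.1, hq.2]) fun q hq => hdiss0 _ _ hq.1
    simpa using this
  have hanti : ∀ s t, 1 ≤ s → s ≤ t → E 1 t ≤ E 1 s := by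
    intro s t hs hst
    have := hstep 1 0 s t 0 le_rfl zero_le_one (by linarith) hst (fun q hq => by norm_num)
      fun q hq => hdiss0 _ _ (by linarith [hq.1])
    simpa using this
  have hlsE : ∀ r, 0 ≤ r → E 1 r ≤ (K + 4) * ∫ x, dissH 1 (u r) x ∂(gibbs d m β Z V) := by
    intro r hr
    have i1 := h.integrable_dissH hδ hu zero_le_one le_rfl hr
    have e1 : (fun x => gradSq d m (u r) x / u r x) = dissH 1 (u r) := by
      funext x; rw [dissH, weightedSq_one]
    have h1 := hls (u r) ((h.regTwo r).reg.1) (h.pos hδ hr) (hmass r hr).1 (hent r hr)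
      (by rw [e1]; exact i1)
    rw [(hmass r hr).2, e1] at h1
    have h2 := integral_mono (h.integrable_modEnt hδ hu j₀ hε hε1 zero_le_one le_rfl hr)
      ((hent r hr).add (i1.const_mul 4)) fun x => modEnt_le j₀ hε hε1 zero_le_one le_rfl
        (h.pos hδ hr x)
    have h3 := integral_add (hent r hr) (i1.const_mul 4)
    rw [integral_const_mul] at h3
    have h4 := h2.trans h3.le
    simp only [hE]
    linarith
  have hcontr : ∀ s, 1 ≤ s → (1 + κ / (K + 4)) * E 1 (s + 1) ≤ E 1 s := by
    intro s hs
    have := hstep 1 0 s (s + 1) (E 1 (s + 1) / (K + 4)) le_rfl zero_le_one (by linarith)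
      (by linarith) (fun q hq => by norm_num) fun q hq => by
        rw [zero_mul, add_zero, div_le_iff₀' (by positivity)]
        exact (hanti q (s + 1) (hs.trans hq.1) hq.2).trans (hlsE q (by linarith [hq.1]))
    simp only [zero_mul, add_zero, add_sub_cancel_left, one_mul] at this
    calc _ = E 1 (s + 1) + κ * (E 1 (s + 1) / (K + 4)) := by ring
      _ ≤ _ := this
  rcases le_total t 1 with ht1 | ht1
  · have h1 := (hle t t ht ht1 ht).trans (hreg t ht ht1)
    rw [hE0] at h1
    refine h1.trans (le_mul_of_one_le_left (hjen 0 le_rfl) ?_)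
    rw [← Real.exp_add]
    refine Real.one_le_exp ?_
    nlinarith
  · have h1 := exp_decay_of_step hk hanti hcontr
      ((hjen 1 zero_le_one).trans (hle 1 1 zero_le_one le_rfl zero_le_one)) ht1
    have h2 := hreg 1 zero_le_one le_rfl
    rw [hE0] at h2
    exact (hle 1 t zero_le_one le_rfl ht).trans
      (h1.trans (mul_le_mul_of_nonneg_left h2 (by positivity)))

end

section

variable {d m : ℕ} {β Z : ℝ} {α lam : Fin m → ℝ} {V : (Fin d → ℝ) → ℝ}

/-- The reciprocal of the Gibbs density. -/
def invRho (d m : ℕ) (β Z : ℝ) (V : (Fin d → ℝ) → ℝ) (x : Xsp d m) : ℝ :=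
  Z * exp (β * energy V 0 x)

lemma inv_rho (x : Xsp d m) : (rho d m β Z V x)⁻¹ = invRho d m β Z V x := by
  have h : energy V 0 x =
      V x.1 + (∑ i, (x.2.1 i) ^ 2) / 2 + (∑ j, ∑ i, (x.2.2 j i) ^ 2) / 2 := by
    unfold energy; ring
  rw [rho, gdens, invRho, h, mul_inv, inv_inv, ← Real.exp_neg, neg_mul, neg_neg]

lemma contDiff_invRho (hV : ContDiff ℝ 2 V) : ContDiff ℝ 2 (invRho d m β Z V) :=
  contDiff_const.mul (contDiff_const.mul (contDiff_energy hV 0)).exp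

lemma hasDerivAt_mul_exp_mul (Z β s : ℝ) :
    HasDerivAt (fun s => Z * exp (β * s)) (Z * β * exp (β * s)) s := by
  have := (((hasDerivAt_id s).const_mul β).exp).const_mul Z
  refine this.congr_deriv ?_
  simp only [id]; ring

lemma fderiv_invRho (hV : ContDiff ℝ 2 V) (x v : Xsp d m) :
    fderiv ℝ (invRho d m β Z V) x v =
      β * invRho d m β Z V x * fderiv ℝ (energy V 0) x v := by
  refine (fderiv_comp_energy hV 0 (hasDerivAt_mul_exp_mul Z β) x v).trans ?_
  unfold invRho; ring

lemma pZ_invRho (hV : ContDiff ℝ 2 V) (j : Fin m) (k : Fin d) (x : Xsp d m) :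
    pZ d m j k (invRho d m β Z V) x = β * invRho d m β Z V x * x.2.2 j k := by
  refine (pZ_comp_energy hV 0 (hasDerivAt_mul_exp_mul Z β) j k x).trans ?_
  unfold invRho; ring

lemma fp_drift (L : Xsp d m →L[ℝ] ℝ) (x : Xsp d m) (c : ℝ) :
    -L (x.2.1, 0, 0) +
      L (0, (fun i => fderiv ℝ V x.1 (Pi.single i 1)) - ∑ j, lam j • x.2.2 j, 0) +
      ∑ j, (L (zdir d m j (lam j • x.2.1 + α j • x.2.2 j)) + α j * d * c) =
    L (drift α lam V x) +
      ∑ j, α j * ∑ k : Fin d, (2 * (x.2.2 j k * L (zdir d m j (Pi.single k 1))) + c) := by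
  have h1 : drift α lam V x = -((x.2.1, 0, 0) : Xsp d m) +
      (0, (fun i => fderiv ℝ V x.1 (Pi.single i 1)) - ∑ j, lam j • x.2.2 j, 0) +
      (0, 0, fun j => lam j • x.2.1 - α j • x.2.2 j) := by
    unfold drift
    ext <;> simp
  rw [h1, map_add, map_add, map_neg, clm_apply_z, add_assoc (-L _ + L _), ← Finset.sum_add_distrib]
  congr 1
  refine Finset.sum_congr rfl fun j _ => ?_
  rw [zdir_eq_sum j (lam j • x.2.1 + α j • x.2.2 j), zdir_eq_sum j (lam j • x.2.1 - α j • x.2.2 j),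
    map_sum, map_sum, Finset.mul_sum, ← Finset.sum_add_distrib]
  have h2 : α j * d * c = ∑ _k : Fin d, α j * c := by simp; ring
  rw [h2, ← Finset.sum_add_distrib]
  refine Finset.sum_congr rfl fun k _ => ?_
  simp only [map_smul, smul_eq_mul, Pi.add_apply, Pi.sub_apply, Pi.smul_apply]
  ring

lemma pZ_mul_invRho (hV : ContDiff ℝ 2 V) {g : Xsp d m → ℝ} (hg : Differentiable ℝ g) (δ : ℝ)
    (j : Fin m) (k : Fin d) (x : Xsp d m) :
    pZ d m j k (fun y => g y * invRho d m β Z V y + δ) x =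
      invRho d m β Z V x * (pZ d m j k g x + β * x.2.2 j k * g x) := by
  have h := (hg x).hasFDerivAt.mul
    ((contDiff_invRho (β := β) (Z := Z) hV).differentiable two_ne_zero x).hasFDerivAt
  have h' := h.add_const δ
  change HasFDerivAt (fun y => g y * invRho d m β Z V y + δ) _ x at h'
  have h2 := pZ_invRho (β := β) (Z := Z) hV j k x
  unfold pZ at h2 ⊢
  rw [h'.fderiv]
  simp only [add_apply, smul_apply, smul_eq_mul, h2]
  ring

lemma backOp_mul_invRho (hβ : β ≠ 0) (hV : ContDiff ℝ 2 V) {g : Xsp d m → ℝ} (hg : ContDiff ℝ 2 g)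
    (δ : ℝ) (x : Xsp d m) :
    backOp β α lam V (fun y => g y * invRho d m β Z V y + δ) x =
      FP d m β α lam V g x * invRho d m β Z V x := by
  have hr := contDiff_invRho (d := d) (m := m) (β := β) (Z := Z) hV
  have hgd := hg.differentiable two_ne_zero
  have h1 : ∀ v, fderiv ℝ (fun y => g y * invRho d m β Z V y + δ) x v =
      invRho d m β Z V x * (fderiv ℝ g x v + β * g x * fderiv ℝ (energy V 0) x v) := by
    intro v
    have h := ((hgd x).hasFDerivAt.mul (hr.differentiable two_ne_zero x).hasFDerivAt).add_const δ
    change HasFDerivAt (fun y => g y * invRho d m β Z V y + δ) _ x at h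
    rw [h.fderiv]
    simp only [add_apply, smul_apply, smul_eq_mul, fderiv_invRho hV]
    ring
  have hz : ∀ (j : Fin m) (k : Fin d), fderiv ℝ (fun y : Xsp d m => y.2.2 j k) x
      (zdir d m j (Pi.single k 1)) = 1 := by
    intro j k
    rw [fderiv_eval_z]; simp [zdir]
  have h2 : ∀ j k, fderiv ℝ (pZ d m j k (fun y => g y * invRho d m β Z V y + δ)) x
      (zdir d m j (Pi.single k 1)) = invRho d m β Z V x *
        (fderiv ℝ (pZ d m j k g) x (zdir d m j (Pi.single k 1)) + β * g x +
          2 * β * x.2.2 j k * pZ d m j k g x + β ^ 2 * (x.2.2 j k) ^ 2 * g x) := by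
    intro j k
    have e : pZ d m j k (fun y => g y * invRho d m β Z V y + δ) = fun y =>
        invRho d m β Z V y * (pZ d m j k g y + β * y.2.2 j k * g y) :=
      funext fun y => pZ_mul_invRho hV hgd δ j k y
    have d1 : DifferentiableAt ℝ (pZ d m j k g) x :=
      (contDiff_fderiv_apply hg _).differentiable one_ne_zero x
    have d2 : DifferentiableAt ℝ (fun y : Xsp d m => y.2.2 j k) x := by fun_prop
    have h := (hr.differentiable two_ne_zero x).hasFDerivAt.mul
      (d1.hasFDerivAt.add ((d2.hasFDerivAt.const_mul β).mul (hgd x).hasFDerivAt))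
    change HasFDerivAt (fun y => invRho d m β Z V y *
      (pZ d m j k g y + β * y.2.2 j k * g y)) _ x at h
    have e2 := pZ_invRho (β := β) (Z := Z) hV j k x
    unfold pZ at e2
    rw [e, h.fderiv]
    simp only [add_apply, smul_apply, smul_eq_mul, e2, hz, Pi.add_apply, Pi.mul_apply]
    have e3 : fderiv ℝ g x (zdir d m j (Pi.single k 1)) = pZ d m j k g x := rfl
    rw [e3]
    ring
  have h3 := fp_drift (α := α) (lam := lam) (V := V) (fderiv ℝ g x) x (g x)
  simp only [backOp, FP, h1, h2, fderiv_energy_drift hV]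
  rw [h3]
  have h4 : β⁻¹ * ∑ j, α j * ∑ k, invRho d m β Z V x *
      (fderiv ℝ (pZ d m j k g) x (zdir d m j (Pi.single k 1)) + β * g x +
        2 * β * x.2.2 j k * pZ d m j k g x + β ^ 2 * (x.2.2 j k) ^ 2 * g x) =
      invRho d m β Z V x * (β⁻¹ * ∑ j, α j * ∑ k,
        fderiv ℝ (pZ d m j k g) x (zdir d m j (Pi.single k 1)) +
      ∑ j, α j * ∑ k : Fin d, (2 * (x.2.2 j k * pZ d m j k g x) + g x) +
      β * g x * ∑ j, ∑ k, α j * (x.2.2 j k) ^ 2) := by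
    simp only [Finset.mul_sum, ← Finset.sum_add_distrib]
    refine Finset.sum_congr rfl fun j _ => Finset.sum_congr rfl fun k _ => ?_
    field_simp
    ring
  rw [h4]
  simp only [pZ]
  ring

end

section

variable {d m : ℕ} {β Z : ℝ} {α lam : Fin m → ℝ} {V : (Fin d → ℝ) → ℝ}

lemma invRho_pos (hZ : 0 < Z) (x : Xsp d m) : 0 < invRho d m β Z V x :=
  mul_pos hZ (exp_pos _)

lemma fderiv_slice {E : Type*} [NormedAddCommGroup E] [NormedSpace ℝ E] {f : ℝ → E → ℝ}
    (hf : Differentiable ℝ fun p : ℝ × E => f p.1 p.2) (t : ℝ) (x v : E) :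
    fderiv ℝ (f t) x v = fderiv ℝ (fun p : ℝ × E => f p.1 p.2) (t, x) (0, v) := by
  have h1 := (hf (t, x)).hasFDerivAt.comp x ((hasFDerivAt_const t x).prodMk (hasFDerivAt_id x))
  change HasFDerivAt (f t) _ x at h1
  rw [h1.fderiv]; simp

/-- The relative density of a positive solution of the Fokker–Planck equation, shifted by a
constant, solves the backward equation. -/
theorem sol_of_fokkerPlanck (hβ : 0 < β) (hZ : 0 < Z) (hV : ContDiff ℝ 2 V) (hVper : PerV d V)
    {f : ℝ → Xsp d m → ℝ} (hf : ContDiff ℝ (⊤ : ℕ∞) (fun tx : ℝ × Xsp d m => f tx.1 tx.2))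
    (hper : ∀ t, 0 ≤ t → PerQ d m (f t)) (hpos : ∀ t x, 0 ≤ t → 0 < f t x)
    (hFP : ∀ t, 0 ≤ t → ∀ x, deriv (fun s => f s x) t = FP d m β α lam V (f t) x) (δ : ℝ) :
    Sol β α lam V δ fun t x => f t x * invRho d m β Z V x + δ := by
  have hr := contDiff_invRho (d := d) (m := m) (β := β) (Z := Z) hV
  have hf2 : ContDiff ℝ 2 fun p : ℝ × Xsp d m => f p.1 p.2 :=
    hf.of_le (WithTop.coe_le_coe.2 le_top)
  have hf3 : ContDiff ℝ 3 fun p : ℝ × Xsp d m => f p.1 p.2 :=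
    hf.of_le (WithTop.coe_le_coe.2 le_top)
  have hfd := hf2.differentiable two_ne_zero
  have hft : ∀ t, ContDiff ℝ 2 (f t) := fun t => hf2.comp (contDiff_const.prodMk contDiff_id)
  refine ⟨(hf2.mul (hr.comp contDiff_snd)).add contDiff_const, fun j k => ?_, fun t x ht => ?_,
    fun t ht k x => ?_, fun t x ht => ?_⟩
  · have e : (fun p : ℝ × Xsp d m =>
        pZ d m j k (fun x => f p.1 x * invRho d m β Z V x + δ) p.2) = fun p =>
        invRho d m β Z V p.2 * (fderiv ℝ (fun p : ℝ × Xsp d m => f p.1 p.2) p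
          (0, zdir d m j (Pi.single k 1)) + β * p.2.2.2 j k * f p.1 p.2) := by
      funext p
      rw [pZ_mul_invRho hV ((hft p.1).differentiable two_ne_zero), ← fderiv_slice hfd]
      rfl
    rw [e]
    have h1 : ContDiff ℝ 2 fun p : ℝ × Xsp d m => fderiv ℝ (fun p : ℝ × Xsp d m => f p.1 p.2) p
        (0, zdir d m j (Pi.single k 1)) :=
      (hf3.fderiv_right (m := 2) (by norm_num)).clm_apply contDiff_const
    have h2 : ContDiff ℝ 2 fun p : ℝ × Xsp d m => β * p.2.2.2 j k := by fun_prop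
    exact (hr.comp contDiff_snd).mul (h1.add (h2.mul hf2))
  · exact le_add_of_nonneg_left (mul_nonneg (hpos t x ht).le (invRho_pos hZ x).le)
  · simp only [hper t ht k x, invRho, energy, hVper k x.1]
  · rw [backOp_mul_invRho hβ.ne' hV (hft t), ← hFP t ht x, deriv_add_const, deriv_mul_const]
    exact (hfd (t, x)).comp t (by fun_prop : DifferentiableAt ℝ (fun s : ℝ => (s, x)) t)

lemma integrable_finset_sum_bound {ι Y : Type*} [MeasurableSpace Y] {μ : Measure Y}
    (s : Finset ι) {F : ι → ℝ → Y → ℝ} {T : ℝ}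
    (h : ∀ i, ∃ M : ℝ, ∀ t ∈ Set.Icc 0 T, Integrable (F i t) μ ∧ ∫ x, F i t x ∂μ ≤ M) :
    ∃ M : ℝ, ∀ t ∈ Set.Icc 0 T, Integrable (fun x => ∑ i ∈ s, F i t x) μ ∧
      ∫ x, ∑ i ∈ s, F i t x ∂μ ≤ M := by
  choose M hM using h
  refine ⟨∑ i ∈ s, M i, fun t ht => ⟨integrable_finsetSum _ fun i _ => (hM i t ht).1, ?_⟩⟩
  rw [integral_finsetSum _ fun i _ => (hM i t ht).1]
  exact Finset.sum_le_sum fun i _ => (hM i t ht).2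

lemma integrable_add_bound {Y : Type*} [MeasurableSpace Y] {μ : Measure Y}
    {F G : ℝ → Y → ℝ} {T : ℝ}
    (hF : ∃ M : ℝ, ∀ t ∈ Set.Icc 0 T, Integrable (F t) μ ∧ ∫ x, F t x ∂μ ≤ M)
    (hG : ∃ M : ℝ, ∀ t ∈ Set.Icc 0 T, Integrable (G t) μ ∧ ∫ x, G t x ∂μ ≤ M) :
    ∃ M : ℝ, ∀ t ∈ Set.Icc 0 T, Integrable (fun x => F t x + G t x) μ ∧
      ∫ x, (F t x + G t x) ∂μ ≤ M := by
  obtain ⟨M, hM⟩ := hF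
  obtain ⟨M', hM'⟩ := hG
  refine ⟨M + M', fun t ht => ⟨(hM t ht).1.add (hM' t ht).1, ?_⟩⟩
  rw [integral_add (hM t ht).1 (hM' t ht).1]
  exact add_le_add (hM t ht).2 (hM' t ht).2

theorem bddH1_of_iteratedFDeriv [IsProbabilityMeasure (gibbs d m β Z V)] {h : ℝ → Xsp d m → ℝ}
    (hc : ∀ t, Continuous (h t))
    (hL2 : ∀ (n : ℕ) (v : Fin n → Xsp d m) (T : ℝ), 0 < T → ∃ M : ℝ, ∀ t ∈ Set.Icc (0 : ℝ) T,
      Integrable (fun x => (iteratedFDeriv ℝ n (h t) x v) ^ 2) (gibbs d m β Z V) ∧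
      ∫ x, (iteratedFDeriv ℝ n (h t) x v) ^ 2 ∂(gibbs d m β Z V) ≤ M) (δ : ℝ) :
    BddH1 β Z V fun t x => h t x + δ := by
  have h0 : ∀ T : ℝ, ∃ M : ℝ, ∀ t ∈ Set.Icc (0 : ℝ) T,
      Integrable (fun x => (h t x) ^ 2) (gibbs d m β Z V) ∧
      ∫ x, (h t x) ^ 2 ∂(gibbs d m β Z V) ≤ M := by
    intro T
    obtain ⟨M, hM⟩ := hL2 0 ![] (max T 1) (by positivity)
    refine ⟨M, fun t ht => ?_⟩
    simpa only [iteratedFDeriv_zero_apply] using hM t ⟨ht.1, ht.2.trans (le_max_left _ _)⟩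
  have h1 : ∀ (v : Xsp d m) (T : ℝ), ∃ M : ℝ, ∀ t ∈ Set.Icc (0 : ℝ) T,
      Integrable (fun x => (fderiv ℝ (h t) x v) ^ 2) (gibbs d m β Z V) ∧
      ∫ x, (fderiv ℝ (h t) x v) ^ 2 ∂(gibbs d m β Z V) ≤ M := by
    intro v T
    obtain ⟨M, hM⟩ := hL2 1 (fun _ => v) (max T 1) (by positivity)
    refine ⟨M, fun t ht => ?_⟩
    simpa only [iteratedFDeriv_one_apply] using hM t ⟨ht.1, ht.2.trans (le_max_left _ _)⟩
  intro T
  have hg : ∃ M : ℝ, ∀ t ∈ Set.Icc 0 T,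
      Integrable (fun x => gradSq d m (fun y => h t y + δ) x) (gibbs d m β Z V) ∧
      ∫ x, gradSq d m (fun y => h t y + δ) x ∂(gibbs d m β Z V) ≤ M := by
    simp only [gradSq, pQ, pP, pZ, fderiv_add_const]
    exact integrable_add_bound (integrable_add_bound
      (integrable_finset_sum_bound _ fun k => h1 _ T)
      (integrable_finset_sum_bound _ fun k => h1 _ T))
      (integrable_finset_sum_bound _ fun j => integrable_finset_sum_bound
        (F := fun k t x => (fderiv ℝ (h t) x (zdir d m j (Pi.single k 1))) ^ 2) _ fun k => h1 _ T)
  obtain ⟨M, hM⟩ := h0 T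
  obtain ⟨M', hM'⟩ := hg
  refine ⟨max (2 * M + 2 * δ ^ 2) M', fun t ht => ⟨?_, (hM' t ht).1,
    (hM' t ht).2.trans (le_max_right _ _)⟩⟩
  obtain ⟨i1, b1⟩ := hM t ht
  have i2 : Integrable (fun x => 2 * (h t x) ^ 2 + 2 * δ ^ 2) (gibbs d m β Z V) :=
    (i1.const_mul 2).add (integrable_const _)
  have hle : ∀ x, (h t x + δ) ^ 2 ≤ 2 * (h t x) ^ 2 + 2 * δ ^ 2 := fun x => by
    nlinarith [sq_nonneg (h t x - δ)]
  have i3 : Integrable (fun x => (h t x + δ) ^ 2) (gibbs d m β Z V) := by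
    refine i2.mono' (((hc t).add continuous_const).pow 2).aestronglyMeasurable
      (Eventually.of_forall fun x => ?_)
    rw [Real.norm_of_nonneg (sq_nonneg _)]
    exact hle x
  refine ⟨i3, le_trans ?_ (le_max_left _ _)⟩
  have e1 := integral_mono i3 i2 hle
  rw [integral_add (i1.const_mul 2) (integrable_const _), integral_const_mul] at e1
  simp only [integral_const, probReal_univ, smul_eq_mul, one_mul] at e1
  linarith

lemma tendsto_integral_mul_log_add {Y : Type*} [MeasurableSpace Y] {μ : Measure Y}
    [IsFiniteMeasure μ] {h : Y → ℝ} (h0 : ∀ x, 0 < h x) (hm : AEStronglyMeasurable h μ)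
    (h2 : Integrable (fun x => (h x) ^ 2) μ) :
    Tendsto (fun n : ℕ => ∫ x, (h x + 1 / ((n : ℝ) + 1)) * log (h x + 1 / ((n : ℝ) + 1)) ∂μ) atTop
      (nhds (∫ x, h x * log (h x) ∂μ)) := by
  have hb : Integrable (fun x => 2 * (h x) ^ 2 + 3) μ :=
    (h2.const_mul 2).add (integrable_const _)
  have hn : ∀ n : ℕ, 0 < 1 / ((n : ℝ) + 1) ∧ 1 / ((n : ℝ) + 1) ≤ 1 := fun n => by
    have : (0 : ℝ) < (n : ℝ) + 1 := by positivity
    exact ⟨by positivity, by rw [div_le_one this]; linarith [Nat.cast_nonneg (α := ℝ) n]⟩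
  refine tendsto_integral_of_dominated_convergence _ (fun n => ?_) hb
    (fun n => Eventually.of_forall fun x => ?_) (Eventually.of_forall fun x => ?_)
  · exact Real.continuous_mul_log.comp_aestronglyMeasurable
      (hm.add aestronglyMeasurable_const)
  · obtain ⟨k1, k2⟩ := hn n
    have k3 := abs_mul_log_le (add_pos (h0 x) k1)
    rw [Real.norm_eq_abs]
    nlinarith [sq_nonneg (h x - 1 / ((n : ℝ) + 1))]
  · have k : Tendsto (fun n : ℕ => h x + 1 / ((n : ℝ) + 1)) atTop (nhds (h x + 0)) :=
      tendsto_const_nhds.add tendsto_one_div_add_atTop_nhds_zero_nat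
    rw [add_zero] at k
    exact (Real.continuous_mul_log.tendsto (h x)).comp k

end

/-- (Exponential decay of relative entropy.) Assume `V ∈ C²(𝕋^d)`.
There are `C, a > 0` such that every smooth positive solution `f` of the Fokker–Planck
equation which is a probability density for each time (with `f(t,·)/ρ` and all its spatial
derivatives in `L²(μ_β)` locally uniformly in `t`) and has finite initial relative entropy
satisfies `H_ρ(f(t)) ≤ C e^{−at} H_ρ(f(0))`. -/
theorem entropy_decay
    (d m : ℕ) (hd : 1 ≤ d) (hm : 1 ≤ m)
    (β : ℝ) (hβ : 0 < β)
    (α lam : Fin m → ℝ) (hα : ∀ j, 0 < α j) (hlam : ∀ j, 0 < lam j)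
    (V : (Fin d → ℝ) → ℝ) (hV : ContDiff ℝ 2 V) (hVper : PerV d V)
    (Z : ℝ) (hZ : 0 < Z)
    (hprob : IsProbabilityMeasure (gibbs d m β Z V)) :
    ∃ C a : ℝ, 0 < C ∧ 0 < a ∧
      ∀ f : ℝ → Xsp d m → ℝ,
        ContDiff ℝ (⊤ : ℕ∞) (fun tx : ℝ × Xsp d m => f tx.1 tx.2) →
        (∀ t, 0 ≤ t → PerQ d m (f t)) →
        (∀ t x, 0 ≤ t → 0 < f t x) →
        (∀ t, 0 ≤ t → Integrable (f t) (volX d m)) →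
        (∀ t, 0 ≤ t → (∫ x, f t x ∂(volX d m)) = 1) →
        (∀ (n : ℕ) (v : Fin n → Xsp d m) (T : ℝ), 0 < T → ∃ M : ℝ,
          ∀ t ∈ Set.Icc (0 : ℝ) T,
            Integrable
              (fun x =>
                (iteratedFDeriv ℝ n (fun y => f t y / (Z⁻¹ * gdens d m β V y)) x v) ^ 2)
              (gibbs d m β Z V) ∧
            ∫ x, (iteratedFDeriv ℝ n (fun y => f t y / (Z⁻¹ * gdens d m β V y)) x v) ^ 2
                ∂(gibbs d m β Z V) ≤ M) →
        (∀ t, 0 ≤ t → ∀ x, deriv (fun s => f s x) t = FP d m β α lam V (f t) x) →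
        Integrable
          (fun x => f 0 x * Real.log (f 0 x / (Z⁻¹ * gdens d m β V x))) (volX d m) →
        ∀ t, 0 ≤ t →
          relEnt d m (fun x => Z⁻¹ * gdens d m β V x) (f t)
            ≤ C * Real.exp (-a * t) * relEnt d m (fun x => Z⁻¹ * gdens d m β V x) (f 0) := by
  have hden : ∀ x : Xsp d m, (Z⁻¹ * gdens d m β V x)⁻¹ = invRho d m β Z V x := inv_rho
  have hri : ∀ x : Xsp d m, rho d m β Z V x * invRho d m β Z V x = 1 := fun x => by
    rw [← inv_rho, mul_inv_cancel₀ (rho_pos hZ x).ne']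
  have hr := contDiff_invRho (d := d) (m := m) (β := β) (Z := Z) hV
  obtain ⟨C, a, hC, ha, hdecay⟩ := exists_decay_sol hm hβ hα hlam hV hVper hZ
  refine ⟨C, a, hC, ha, fun f hf hper hpos hint hmass hL2 hFP _ t ht => ?_⟩
  simp only [div_eq_mul_inv, hden] at hL2
  have hc : ∀ t, Continuous fun x => f t x * invRho d m β Z V x := fun t =>
    (hf.continuous.comp (by fun_prop : Continuous fun x : Xsp d m => (t, x))).mul hr.continuous
  have hpos' : ∀ t, 0 ≤ t → ∀ x, 0 < f t x * invRho d m β Z V x := fun t ht x =>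
    mul_pos (hpos t x ht) (invRho_pos hZ x)
  have hcancel : ∀ t x, rho d m β Z V x * (f t x * invRho d m β Z V x) = f t x := fun t x => by
    rw [mul_left_comm, hri, mul_one]
  have hsq : ∀ t, 0 ≤ t → Integrable (fun x => (f t x * invRho d m β Z V x) ^ 2)
      (gibbs d m β Z V) := by
    intro t ht
    obtain ⟨M, hM⟩ := hL2 0 ![] (max t 1) (by positivity)
    simpa only [iteratedFDeriv_zero_apply] using (hM t ⟨ht, le_max_left _ _⟩).1
  have hi : ∀ t, 0 ≤ t → Integrable (fun x => f t x * invRho d m β Z V x) (gibbs d m β Z V) := by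
    intro t ht
    rw [integrable_gibbs hV.continuous hZ]
    simpa only [hcancel] using hint t ht
  have hi1 : ∀ t, 0 ≤ t → ∫ x, f t x * invRho d m β Z V x ∂(gibbs d m β Z V) = 1 := by
    intro t ht
    rw [integral_gibbs hV.continuous hZ]
    simpa only [hcancel] using hmass t ht
  have hent : ∀ t, relEnt d m (fun x => Z⁻¹ * gdens d m β V x) (f t) =
      ∫ x, f t x * invRho d m β Z V x * log (f t x * invRho d m β Z V x)
        ∂(gibbs d m β Z V) := by
    intro t
    rw [integral_gibbs hV.continuous hZ]
    simp only [relEnt, div_eq_mul_inv, hden]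
    refine integral_congr_ae (Eventually.of_forall fun x => ?_)
    dsimp only
    linear_combination (-f t x * log (f t x * invRho d m β Z V x)) * hri x
  have hlim : ∀ t, 0 ≤ t → Tendsto (fun n : ℕ =>
      (∫ x, (f t x * invRho d m β Z V x + 1 / ((n : ℝ) + 1)) *
        log (f t x * invRho d m β Z V x + 1 / ((n : ℝ) + 1)) ∂(gibbs d m β Z V)) -
      (1 + 1 / ((n : ℝ) + 1)) * log (1 + 1 / ((n : ℝ) + 1))) atTop
      (nhds (relEnt d m (fun x => Z⁻¹ * gdens d m β V x) (f t))) := by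
    intro t ht
    have k1 := tendsto_integral_mul_log_add (hpos' t ht) (hc t).aestronglyMeasurable (hsq t ht)
    have k2 : Tendsto (fun n : ℕ => 1 + 1 / ((n : ℝ) + 1)) atTop (nhds (1 + 0)) :=
      tendsto_const_nhds.add tendsto_one_div_add_atTop_nhds_zero_nat
    have k3 := k1.sub ((Real.continuous_mul_log.tendsto (1 + 0)).comp k2)
    simpa only [hent t, Function.comp_def, add_zero, log_one, mul_zero, sub_zero] using k3
  refine le_of_tendsto_of_tendsto' (hlim t ht) ((hlim 0 le_rfl).const_mul _) fun n => ?_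
  have hn : (0 : ℝ) < 1 / ((n : ℝ) + 1) := by positivity
  refine hdecay _ _ hn (sol_of_fokkerPlanck hβ hZ hV hVper hf hper hpos hFP _)
    (bddH1_of_iteratedFDeriv hc hL2 _) (1 + 1 / ((n : ℝ) + 1)) (by positivity)
    (fun s hs => ⟨(hi s hs).add (integrable_const _), ?_⟩) t ht
  rw [integral_add (hi s hs) (integrable_const _), hi1 s hs]
  simp
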